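/- Suppose K = K_1, the residue field of F has exactly p elements (q = p), and sigma is a weight of K with chi_sigma different from chi_sigma^s. Then the universal quotient (ind_K^G sigma)/(T) is not an irreducible representation of G. -/

import Mathlib

open scoped Classical

noncomputable section

namespace U21

/-- The arithmetic setting: `E` is the unramified quadratic extension of a non-archimedean
local field `F` of odd residue characteristic `p`, with residue field of `F` of cardinality
`q = p ^ fdeg`.  The field `E` is encoded through its valuation subring `O = o_E`, a
uniformizer `ϖ`, the maximal ideal `mI` (so that `p_E^k` is `ϖ ^ k * O`), and the nontrivial
`F`-automorphism `conj` of `E` (which induces the `q`-power Frobenius on the residue field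
of `E`, of cardinality `q ^ 2`). -/
structure Setting where
  p : ℕ
  q : ℕ
  fdeg : ℕ
  hp : p.Prime
  hodd : p ≠ 2
  hfdeg : 0 < fdeg
  hq : q = p ^ fdeg
  E : Type
  [fieldE : Field E]
  conj : E →+* E
  conj_invol : ∀ x, conj (conj x) = x
  conj_ne : conj ≠ RingHom.id E
  O : Subring E
  val_ring : ∀ x : E, x ≠ 0 → x ∈ O ∨ x⁻¹ ∈ O
  conj_O : ∀ x, x ∈ O → conj x ∈ O
  ϖ : E
  unif_mem : ϖ ∈ O
  unif_ne : ϖ ≠ 0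
  unif_conj : conj ϖ = ϖ
  unif_not_unit : ¬ IsUnit (⟨ϖ, unif_mem⟩ : O)
  disc : ∀ x : E, x ≠ 0 → ∃ (n : ℤ) (u : Oˣ), x = (u : O) * ϖ ^ n
  mI : Ideal O
  hmI : ∀ x : O, x ∈ mI ↔ ∃ y ∈ O, (x : E) = ϖ * y
  [fin_res : Fintype (O ⧸ mI)]
  card_res : Fintype.card (O ⧸ mI) = q ^ 2
  res_frob : ∀ x : O, Ideal.Quotient.mk mI ⟨conj x, conj_O x x.2⟩ = (Ideal.Quotient.mk mI x) ^ q
  complete : ∀ a : ℕ → E,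
    (∀ k : ℕ, ∃ N, ∀ m ≥ N, ∀ n ≥ N, ∃ w ∈ O, a m - a n = ϖ ^ k * w) →
    ∃ L : E, ∀ k : ℕ, ∃ N, ∀ n ≥ N, ∃ w ∈ O, a n - L = ϖ ^ k * w

attribute [instance] Setting.fieldE Setting.fin_res

namespace Setting

variable (S : Setting)

/-- 3×3 matrices over `E`. -/
abbrev M3 := Matrix (Fin 3) (Fin 3) S.E

/-- The antidiagonal matrix `β` of the Hermitian form. -/
def betaM : S.M3 := !![0,0,1;0,1,0;1,0,0]

/-- The fractional ideal `p_E ^ k ⊆ E` (for `k : ℤ`). -/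
def pE (k : ℤ) : Set S.E := {z | ∃ w ∈ S.O, z = S.ϖ ^ k * w}

/-- The unramified unitary group `G = U(2,1)(E/F)`, as a subgroup of `GL₃(E)`:
`g ∈ G` iff `g.transpose * β * conj g = β`. -/
def Gsub : Subgroup (Matrix.GeneralLinearGroup (Fin 3) S.E) where
  carrier := {g | ((g : S.M3)).transpose * S.betaM * ((g : S.M3).map S.conj) = S.betaM}
  one_mem' := by
    simp [Matrix.map_one (⇑S.conj) (map_zero S.conj) (map_one S.conj)]
  mul_mem' := by
    intro a b ha hb
    simp only [Set.mem_setOf_eq, Units.val_mul, Matrix.transpose_mul, Matrix.map_mul] at ha hb ⊢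
    calc ((b : S.M3)).transpose * ((a : S.M3)).transpose * S.betaM * ((a : S.M3).map S.conj * (b : S.M3).map S.conj)
        = ((b : S.M3)).transpose * (((a : S.M3)).transpose * S.betaM * (a : S.M3).map S.conj) * ((b : S.M3).map S.conj) := by
          simp only [mul_assoc]
      _ = S.betaM := by rw [ha]; exact hb
  inv_mem' := by
    intro a ha
    simp only [Set.mem_setOf_eq] at ha ⊢
    have hA : IsUnit ((a : S.M3)) := a.isUnit
    have hdet : IsUnit ((a : S.M3)).det := (Matrix.isUnit_iff_isUnit_det _).mp hA
    have hAc : IsUnit (((a : S.M3)).map ⇑S.conj) := by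
      rw [← RingHom.mapMatrix_apply]; exact hA.map _
    have hdetc : IsUnit ((((a : S.M3)).map ⇑S.conj).det) := (Matrix.isUnit_iff_isUnit_det _).mp hAc
    have hdetT : IsUnit ((((a : S.M3)).transpose).det) := by rw [Matrix.det_transpose]; exact hdet
    have hmapinv : ((a : S.M3)⁻¹).map ⇑S.conj = (((a : S.M3)).map ⇑S.conj)⁻¹ := by
      symm
      apply Matrix.inv_eq_left_inv
      rw [← Matrix.map_mul, Matrix.nonsing_inv_mul _ hdet,
        Matrix.map_one (⇑S.conj) (map_zero S.conj) (map_one S.conj)]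
    rw [Matrix.coe_units_inv, Matrix.transpose_nonsing_inv, hmapinv]
    conv_lhs => rw [← ha]
    calc (((a:S.M3)).transpose)⁻¹ * (((a:S.M3)).transpose * S.betaM * ((a:S.M3)).map ⇑S.conj) * (((a:S.M3)).map ⇑S.conj)⁻¹
        = (((a:S.M3)).transpose)⁻¹ * ((a:S.M3)).transpose * S.betaM *
            (((a:S.M3)).map ⇑S.conj * (((a:S.M3)).map ⇑S.conj)⁻¹) := by simp only [mul_assoc]
      _ = S.betaM := by
          rw [Matrix.nonsing_inv_mul _ hdetT, Matrix.mul_nonsing_inv _ hdetc, one_mul, mul_one]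

/-- The group `G = U(2,1)(E/F)`. -/
abbrev GG := ↥S.Gsub

/-- The matrix of an element of `G`. -/
def mat (g : S.GG) : S.M3 := ((g : Matrix.GeneralLinearGroup (Fin 3) S.E) : S.M3)

/-- The upper unipotent matrix `n(x,y)`. -/
def nM (x y : S.E) : S.M3 := !![1, x, y; 0, 1, -S.conj x; 0, 0, 1]

/-- The lower unipotent matrix `n'(x,y)`. -/
def n'M (x y : S.E) : S.M3 := !![1, 0, 0; x, 1, 0; y, -S.conj x, 1]

/-- The diagonal matrix `h(x) = diag(x, -x̄x⁻¹, x̄⁻¹)`. -/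
def hM (x : S.E) : S.M3 := !![x, 0, 0; 0, -S.conj x * x⁻¹, 0; 0, 0, (S.conj x)⁻¹]

/-- The subgroup `N` of `G` (unipotent radical of the upper triangular Borel), as a set. -/
def Nset : Set S.GG := {g | ∃ x y : S.E, x * S.conj x + y + S.conj y = 0 ∧ S.mat g = S.nM x y}

/-- The subgroup `N_k = {n(x,y) : y ∈ p_E^k}`, as a set. -/
def Nk (k : ℤ) : Set S.GG :=
  {g | ∃ x y : S.E, x * S.conj x + y + S.conj y = 0 ∧ y ∈ S.pE k ∧ S.mat g = S.nM x y}

/-- The subgroup `N'` of `G`, as a set. -/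
def N'set : Set S.GG := {g | ∃ x y : S.E, x * S.conj x + y + S.conj y = 0 ∧ S.mat g = S.n'M x y}

/-- The subgroup `N'_k = {n'(x,y) : y ∈ p_E^k}`, as a set. -/
def N'k (k : ℤ) : Set S.GG :=
  {g | ∃ x y : S.E, x * S.conj x + y + S.conj y = 0 ∧ y ∈ S.pE k ∧ S.mat g = S.n'M x y}

/-- The diagonal subgroup `H` of `G`, as a set. -/
def Hset : Set S.GG := {g | ∃ a b c : S.E, S.mat g = !![a,0,0;0,b,0;0,0,c]}

/-- The hyperspecial maximal compact subgroup `K₀ = G ∩ GL₃(o_E)`, as a set. -/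
def K0set : Set S.GG := {g | ∀ i j, S.mat g i j ∈ S.O}

/-- The special (non-hyperspecial) maximal compact subgroup `K₁`, as a set. -/
def K1set : Set S.GG :=
  {g | S.mat g 0 0 ∈ S.O ∧ S.mat g 0 1 ∈ S.O ∧ S.mat g 0 2 ∈ S.pE (-1) ∧
       S.mat g 1 0 ∈ S.pE 1 ∧ S.mat g 1 1 ∈ S.O ∧ S.mat g 1 2 ∈ S.O ∧
       S.mat g 2 0 ∈ S.pE 1 ∧ S.mat g 2 1 ∈ S.pE 1 ∧ S.mat g 2 2 ∈ S.O}

/-- The Iwahori subgroup `I_{K₀}` (preimage of the Borel of `Γ_{K₀}`), as a set. -/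
def IK0 : Set S.GG :=
  {g | g ∈ S.K0set ∧ S.mat g 1 0 ∈ S.pE 1 ∧ S.mat g 2 0 ∈ S.pE 1 ∧ S.mat g 2 1 ∈ S.pE 1}

/-- The pro-p Iwahori subgroup `I_{1,K₀}`, as a set. -/
def I1K0 : Set S.GG :=
  {g | g ∈ S.IK0 ∧ S.mat g 0 0 - 1 ∈ S.pE 1 ∧ S.mat g 1 1 - 1 ∈ S.pE 1 ∧ S.mat g 2 2 - 1 ∈ S.pE 1}

/-- The opposite pro-p Iwahori subgroup `I'_{1,K₀}`, as a set. -/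
def I1'K0 : Set S.GG :=
  {g | g ∈ S.K0set ∧ S.mat g 0 1 ∈ S.pE 1 ∧ S.mat g 0 2 ∈ S.pE 1 ∧ S.mat g 1 2 ∈ S.pE 1 ∧
       S.mat g 0 0 - 1 ∈ S.pE 1 ∧ S.mat g 1 1 - 1 ∈ S.pE 1 ∧ S.mat g 2 2 - 1 ∈ S.pE 1}

/-- The maximal normal pro-p subgroup `K₀¹` of `K₀` (principal congruence subgroup), as a set. -/
def Kone0 : Set S.GG := {g | ∀ i j, S.mat g i j - (1 : S.M3) i j ∈ S.pE 1}

/-- The Iwahori subgroup `I_{K₁}`, as a set. -/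
def IK1 : Set S.GG := {g | g ∈ S.K1set ∧ S.mat g 2 0 ∈ S.pE 2}

/-- The pro-p Iwahori subgroup `I_{1,K₁}`, as a set. -/
def I1K1 : Set S.GG :=
  {g | g ∈ S.IK1 ∧ S.mat g 0 0 - 1 ∈ S.pE 1 ∧ S.mat g 1 1 - 1 ∈ S.pE 1 ∧ S.mat g 2 2 - 1 ∈ S.pE 1}

/-- The opposite pro-p Iwahori subgroup `I'_{1,K₁}`, as a set. -/
def I1'K1 : Set S.GG :=
  {g | g ∈ S.K1set ∧ S.mat g 0 2 ∈ S.O ∧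
       S.mat g 0 0 - 1 ∈ S.pE 1 ∧ S.mat g 1 1 - 1 ∈ S.pE 1 ∧ S.mat g 2 2 - 1 ∈ S.pE 1}

/-- The maximal normal pro-p subgroup `K₁¹` of `K₁`, as a set. -/
def Kone1 : Set S.GG :=
  {g | g ∈ S.K1set ∧ S.mat g 0 2 ∈ S.O ∧ S.mat g 2 0 ∈ S.pE 2 ∧
       S.mat g 0 0 - 1 ∈ S.pE 1 ∧ S.mat g 1 1 - 1 ∈ S.pE 1 ∧ S.mat g 2 2 - 1 ∈ S.pE 1}

/-- The congruence subgroup of level `n` (used to express smoothness), as a set. -/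
def cong (n : ℕ) : Set S.GG := {g | ∀ i j, S.mat g i j - (1 : S.M3) i j ∈ S.pE n}

def alphaM : S.M3 := !![S.ϖ⁻¹, 0, 0; 0, 1, 0; 0, 0, S.ϖ]

def alphaMinv : S.M3 := !![S.ϖ, 0, 0; 0, 1, 0; 0, 0, S.ϖ⁻¹]

lemma alpha_mul_inv : S.alphaM * S.alphaMinv = 1 := by
  ext i j
  fin_cases i <;> fin_cases j <;>
    simp [alphaM, alphaMinv, Matrix.mul_apply, Fin.sum_univ_three, Matrix.one_apply,
      Matrix.vecHead, Matrix.vecTail, inv_mul_cancel₀ S.unif_ne, mul_inv_cancel₀ S.unif_ne]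

lemma alpha_inv_mul : S.alphaMinv * S.alphaM = 1 := by
  ext i j
  fin_cases i <;> fin_cases j <;>
    simp [alphaM, alphaMinv, Matrix.mul_apply, Fin.sum_univ_three, Matrix.one_apply,
      Matrix.vecHead, Matrix.vecTail, inv_mul_cancel₀ S.unif_ne, mul_inv_cancel₀ S.unif_ne]

def alphaU : Matrix.GeneralLinearGroup (Fin 3) S.E :=
  ⟨S.alphaM, S.alphaMinv, S.alpha_mul_inv, S.alpha_inv_mul⟩

lemma alphaU_mem : S.alphaU ∈ S.Gsub := by
  show ((S.alphaU : S.M3)).transpose * S.betaM * ((S.alphaU : S.M3).map S.conj) = S.betaM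
  have : (S.alphaU : S.M3) = S.alphaM := rfl
  rw [this]
  ext i j
  fin_cases i <;> fin_cases j <;>
    simp [alphaM, betaM, Matrix.mul_apply, Fin.sum_univ_three, Matrix.map_apply,
      Matrix.transpose_apply, Matrix.vecHead, Matrix.vecTail, map_inv₀, S.unif_conj,
      inv_mul_cancel₀ S.unif_ne, mul_inv_cancel₀ S.unif_ne]

/-- The element `α = diag(ϖ⁻¹, 1, ϖ)` of `G`. -/
def alphaE : S.GG := ⟨S.alphaU, S.alphaU_mem⟩

lemma beta_mul_beta : S.betaM * S.betaM = 1 := by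
  ext i j
  fin_cases i <;> fin_cases j <;>
    simp [betaM, Matrix.mul_apply, Fin.sum_univ_three, Matrix.one_apply,
      Matrix.vecHead, Matrix.vecTail]

def betaU : Matrix.GeneralLinearGroup (Fin 3) S.E :=
  ⟨S.betaM, S.betaM, S.beta_mul_beta, S.beta_mul_beta⟩

lemma betaU_mem : S.betaU ∈ S.Gsub := by
  show ((S.betaU : S.M3)).transpose * S.betaM * ((S.betaU : S.M3).map S.conj) = S.betaM
  have : (S.betaU : S.M3) = S.betaM := rfl
  rw [this]
  ext i j
  fin_cases i <;> fin_cases j <;>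
    simp [betaM, Matrix.mul_apply, Fin.sum_univ_three, Matrix.map_apply, Matrix.transpose_apply,
      Matrix.vecHead, Matrix.vecTail]

/-- The element `β` of `G`. -/
def betaE : S.GG := ⟨S.betaU, S.betaU_mem⟩

/-- The element `β' = β * α⁻¹` of `G`. -/
def betaPr : S.GG := S.betaE * S.alphaE⁻¹

/-- A finite set `U` is a set of representatives for the cosets `A/B`. -/
def IsReps (A B : Set S.GG) (U : Finset S.GG) : Prop :=
  (↑U : Set S.GG) ⊆ A ∧ ∀ a ∈ A, ∃! u, u ∈ U ∧ a⁻¹ * u ∈ B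

/-- The residue field `k_E` of `E`. -/
abbrev kE := S.O ⧸ S.mI

/-- The residue map `o_E → k_E`. -/
def resmap : S.O →+* S.kE := Ideal.Quotient.mk S.mI

/-- The group `L_{q³} = {(x,t) ∈ k_E² : x x̄ + t + t̄ = 0}` (where `x̄ = x^q`). -/
def Lbig : Set (S.kE × S.kE) := {z | z.1 * z.1 ^ S.q + z.2 + z.2 ^ S.q = 0}

/-- The group `L_q = {(0,t) ∈ k_E² : t + t̄ = 0}`. -/
def Lsmall : Set (S.kE × S.kE) := {z | z.1 = 0 ∧ z.2 + z.2 ^ S.q = 0}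

/-- `L_{q^t}` for `t ∈ {1,3}`. -/
def Lof (t : ℕ) : Set (S.kE × S.kE) := if t = 3 then S.Lbig else S.Lsmall

end Setting

/-- A choice of one of the two maximal compact open subgroups `K ∈ {K₀, K₁}` of `G`,
together with its maximal normal pro-p subgroup `K¹`, the (pro-p) Iwahori subgroups
`I_K ⊇ I_{1,K}`, the opposite pro-p Iwahori `I'_{1,K}`, the element
`β_K ∈ K ∩ {β, β'}`, and the integers `n_K, m_K, t_K`. -/
structure Chamber (S : Setting) where
  K : Subgroup S.GG
  KoneS : Set S.GG
  IK : Set S.GG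
  I1 : Set S.GG
  I1' : Set S.GG
  βK : S.GG
  nK : ℤ
  mK : ℤ
  tK : ℕ
  cases :
    ((K : Set S.GG) = S.K0set ∧ KoneS = S.Kone0 ∧ IK = S.IK0 ∧ I1 = S.I1K0 ∧ I1' = S.I1'K0 ∧
      βK = S.betaE ∧ nK = 0 ∧ mK = 1 ∧ tK = 3) ∨
    ((K : Set S.GG) = S.K1set ∧ KoneS = S.Kone1 ∧ IK = S.IK1 ∧ I1 = S.I1K1 ∧ I1' = S.I1'K1 ∧
      βK = S.betaPr ∧ nK = -1 ∧ mK = 2 ∧ tK = 1)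

namespace Chamber

variable {S : Setting} (C : Chamber S)

/-- `H₀ = H ∩ I_K`. -/
def H0 : Set S.GG := S.Hset ∩ C.IK

/-- `H₁ = H ∩ I_{1,K}`. -/
def H1 : Set S.GG := S.Hset ∩ C.I1

end Chamber

section RepTheory

variable {S : Setting} (C : Chamber S)
variable (𝔽 : Type) [Field 𝔽]

section Generic

variable {G₀ : Type} [Monoid G₀] {V : Type} [AddCommGroup V] [Module 𝔽 V]

/-- A submodule is invariant under a representation. -/
def Invt (ρ : Representation 𝔽 G₀ V) (Ssub : Submodule 𝔽 V) : Prop :=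
  ∀ g v, v ∈ Ssub → ρ g v ∈ Ssub

/-- The subrepresentation generated by a vector (the span of its orbit). -/
def orbitSpan (ρ : Representation 𝔽 G₀ V) (v : V) : Submodule 𝔽 V :=
  Submodule.span 𝔽 {w | ∃ g, w = ρ g v}

/-- The subrepresentation generated by a vector under a subset `A` of the group. -/
def orbitSpanOn (ρ : Representation 𝔽 G₀ V) (A : Set G₀) (v : V) : Submodule 𝔽 V :=
  Submodule.span 𝔽 {w | ∃ g ∈ A, w = ρ g v}

/-- The quotient of a representation by an invariant submodule `N` is irreducible:
equivalently (by the lattice correspondence), `N ≠ ⊤` and any invariant submodule lying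
between `N` and `⊤` equals `N` or `⊤`. -/
def QuotientIrreducible (ρ : Representation 𝔽 G₀ V) (N : Submodule 𝔽 V) : Prop :=
  N ≠ ⊤ ∧ ∀ Ssub : Submodule 𝔽 V, Invt 𝔽 ρ Ssub → N ≤ Ssub → Ssub = N ∨ Ssub = ⊤

/-- The submodule of vectors invariant under all elements of the subset `A`. -/
def invariantsOn (ρ : Representation 𝔽 G₀ V) (A : Set G₀) : Submodule 𝔽 V where
  carrier := {v | ∀ g ∈ A, ρ g v = v}
  add_mem' := by
    intro a b ha hb g hg
    rw [map_add, ha g hg, hb g hg]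
  zero_mem' := by
    intro g hg
    rw [map_zero]
  smul_mem' := by
    intro c a ha g hg
    rw [map_smul, ha g hg]

/-- The space `Hom_G(ρ₁, ρ₂)` of equivariant linear maps, as a submodule of the linear maps. -/
def EquivHomSub {V₂ : Type} [AddCommGroup V₂] [Module 𝔽 V₂]
    (ρ₁ : Representation 𝔽 G₀ V) (ρ₂ : Representation 𝔽 G₀ V₂) :
    Submodule 𝔽 (V →ₗ[𝔽] V₂) where
  carrier := {φ | ∀ g x, φ (ρ₁ g x) = ρ₂ g (φ x)}
  add_mem' := by
    intro a b ha hb g x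
    simp only [LinearMap.add_apply, ha g x, hb g x, map_add]
  zero_mem' := by
    intro g x
    simp only [LinearMap.zero_apply, map_zero]
  smul_mem' := by
    intro c a ha g x
    simp only [LinearMap.smul_apply, ha g x, map_smul]

end Generic

section Weight

variable (W : Type) [AddCommGroup W] [Module 𝔽 W]
variable (σ : Representation 𝔽 ↥C.K W)

/-- Extension of `σ` to all of `G` (by `1` outside `K`); used to avoid coercion issues. -/
def sigma' : S.GG → Module.End 𝔽 W := fun g => if h : g ∈ C.K then σ ⟨g, h⟩ else 1

/-- `σ` is a weight of `K`: an irreducible smooth representation of `K` over `𝔽`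
factoring through `Γ_K = K / K¹` (automatically finite dimensional). -/
def IsWeight : Prop :=
  Nontrivial W ∧ FiniteDimensional 𝔽 W ∧
  (∀ Ssub : Submodule 𝔽 W, (∀ (k : ↥C.K) (w : W), w ∈ Ssub → σ k w ∈ Ssub) → Ssub = ⊥ ∨ Ssub = ⊤) ∧
  (∀ (g : S.GG) (hg : g ∈ C.K), g ∈ C.KoneS → σ ⟨g, hg⟩ = LinearMap.id)

/-- `σ` is one dimensional of the form `χ ∘ det`. -/
def IsDetWeight : Prop :=
  Module.finrank 𝔽 W = 1 ∧
  ∃ c : S.E → 𝔽, ∀ (g : S.GG) (hg : g ∈ C.K) (w : W), σ ⟨g, hg⟩ w = c ((S.mat g).det) • w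

/-- `j_σ : σ → σ` is the composition of the coinvariant projection `σ → σ_{I'_{1,K}}`
with the inverse of the natural isomorphism `σ^{I_{1,K}} ≅ σ_{I'_{1,K}}`:
it restricts to the identity on `σ^{I_{1,K}}` and kills the augmentation part of
`σ` with respect to `I'_{1,K}`. -/
def IsJ (jσ : W →ₗ[𝔽] W) : Prop :=
  (∀ w : W, (∀ g ∈ C.I1, sigma' C 𝔽 W σ g w = w) → jσ w = w) ∧
  (∀ (w : W) (g : S.GG), g ∈ C.I1' → jσ (sigma' C 𝔽 W σ g w - w) = 0)

/-- The defining conditions of the compact induction `ind_K^G σ`: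
`K`-equivariance on the left and compact support (finitely many cosets `K g`). -/
def IndCarrier : Set (S.GG → W) :=
  {f | (∀ (k : S.GG) (hk : k ∈ C.K) (g : S.GG), f (k * g) = σ ⟨k, hk⟩ (f g)) ∧
       ∃ s : Finset S.GG, ∀ g : S.GG, f g ≠ 0 → ∃ k ∈ C.K, ∃ t ∈ s, g = k * t}

/-- The compact induction `ind_K^G σ`, as a submodule of `G → W`. -/
def IndSub : Submodule 𝔽 (S.GG → W) where
  carrier := IndCarrier C 𝔽 W σ
  add_mem' := by
    rintro f g ⟨hf1, sf, hf2⟩ ⟨hg1, sg, hg2⟩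
    refine ⟨fun k hk x => by simp [hf1 k hk x, hg1 k hk x], sf ∪ sg, fun x hx => ?_⟩
    by_cases h : f x ≠ 0
    · obtain ⟨k, hk, t, ht, rfl⟩ := hf2 x h
      exact ⟨k, hk, t, Finset.mem_union_left _ ht, rfl⟩
    · push_neg at h
      have hgx : g x ≠ 0 := by
        intro h0
        apply hx
        simp [Pi.add_apply, h, h0]
      obtain ⟨k, hk, t, ht, rfl⟩ := hg2 x hgx
      exact ⟨k, hk, t, Finset.mem_union_right _ ht, rfl⟩
  zero_mem' := ⟨fun k hk g => by simp, ∅, fun g hg => absurd rfl hg⟩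
  smul_mem' := by
    rintro c f ⟨hf1, sf, hf2⟩
    refine ⟨fun k hk g => by simp [hf1 k hk g], sf, fun x hx => ?_⟩
    refine hf2 x ?_
    intro h0
    apply hx
    simp [h0]

lemma indAct_mem (g : S.GG) {f : S.GG → W} (hf : f ∈ IndCarrier C 𝔽 W σ) :
    (fun x => f (x * g)) ∈ IndCarrier C 𝔽 W σ := by
  obtain ⟨h1, s, h2⟩ := hf
  refine ⟨fun k hk x => ?_, s.image (· * g⁻¹), ?_⟩
  · show f (k * x * g) = _
    rw [mul_assoc]
    exact h1 k hk (x * g)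
  intro x hx
  obtain ⟨k, hk, t, ht, hxg⟩ := h2 (x * g) hx
  refine ⟨k, hk, t * g⁻¹, Finset.mem_image_of_mem _ ht, ?_⟩
  rw [← mul_assoc, ← hxg, mul_assoc, mul_inv_cancel, mul_one]

/-- The representation of `G` on `ind_K^G σ` by right translation. -/
def indRep : Representation 𝔽 S.GG ↥(IndSub C 𝔽 W σ) where
  toFun g :=
    { toFun := fun f => ⟨fun x => (f : S.GG → W) (x * g), indAct_mem C 𝔽 W σ g f.2⟩
      map_add' := fun f1 f2 => Subtype.ext (funext fun x => rfl)
      map_smul' := fun c f => Subtype.ext (funext fun x => rfl) }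
  map_one' := LinearMap.ext fun f => Subtype.ext (funext fun x => by simp [mul_one])
  map_mul' g h := LinearMap.ext fun f => Subtype.ext (funext fun x => by simp [mul_assoc])

/-- The function `[g, v] ∈ ind_K^G σ`: supported on `K g⁻¹`, with value `v` at `g⁻¹`. -/
def stdFn (g : S.GG) (v : W) : S.GG → W :=
  fun x => if h : x * g ∈ C.K then σ ⟨x * g, h⟩ v else 0

/-- The characterization of the family `f_n` (`n ∈ ℤ`) of `I_{1,K}`-invariant elements of
`ind_K^G σ`: `f_n` is supported on `K α⁻ⁿ I_{1,K}` and has value at `α⁻ⁿ` equal to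
`σ(β_K) v₀` for `n > 0` and `v₀` for `n ≤ 0`, where `v₀` is a fixed nonzero vector of
`σ^{I_{1,K}}`. -/
def IsFFamily (v0 : W) (ff : ℤ → ↥(IndSub C 𝔽 W σ)) : Prop :=
  v0 ≠ 0 ∧ (∀ g ∈ C.I1, sigma' C 𝔽 W σ g v0 = v0) ∧
  (∀ (n : ℤ) (g : S.GG), g ∈ C.I1 → indRep C 𝔽 W σ g (ff n) = ff n) ∧
  (∀ (n : ℤ) (x : S.GG), (ff n : S.GG → W) x ≠ 0 →
    ∃ k ∈ C.K, ∃ i ∈ C.I1, x = k * S.alphaE ^ (-n) * i) ∧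
  (∀ n : ℤ, 0 < n → (ff n : S.GG → W) (S.alphaE ^ (-n)) = sigma' C 𝔽 W σ C.βK v0) ∧
  (∀ n : ℤ, n ≤ 0 → (ff n : S.GG → W) (S.alphaE ^ (-n)) = v0)

/-- The characterization of the Hecke operator `T ∈ End_G(ind_K^G σ)`:
it is `G`-equivariant and satisfies
`T [1, v] = ∑_{u ∈ N_{n_K}/N_{n_K+2}} [u α⁻¹, j_σ σ(u⁻¹) v]
  + ∑_{u ∈ N_{n_K+1}/N_{n_K+2}} [β_K u α⁻¹, j_σ σ(β_K) v]`. -/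
def IsHeckeT (jσ : W →ₗ[𝔽] W) (T : Module.End 𝔽 ↥(IndSub C 𝔽 W σ)) : Prop :=
  (∀ (g : S.GG) (x : ↥(IndSub C 𝔽 W σ)),
    T (indRep C 𝔽 W σ g x) = indRep C 𝔽 W σ g (T x)) ∧
  (∀ (v : W) (x : ↥(IndSub C 𝔽 W σ)), (x : S.GG → W) = stdFn C 𝔽 W σ 1 v →
    ∀ (U2 U1 : Finset S.GG),
      S.IsReps (S.Nk C.nK) (S.Nk (C.nK + 2)) U2 →
      S.IsReps (S.Nk (C.nK + 1)) (S.Nk (C.nK + 2)) U1 →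
      ((T x : S.GG → W)) =
        (∑ u ∈ U2, stdFn C 𝔽 W σ (u * S.alphaE⁻¹) (jσ (sigma' C 𝔽 W σ u⁻¹ v))) +
        ∑ u ∈ U1, stdFn C 𝔽 W σ (C.βK * u * S.alphaE⁻¹) (jσ (sigma' C 𝔽 W σ C.βK v)))

/-- The eigencharacter `χ_σ` of `H₀/H₁` afforded by the (one-dimensional) space
`σ^{I_{1,K}}` with chosen basis vector `v₀`. -/
def IsChi (v0 : W) (χ : S.GG → 𝔽) : Prop :=
  (∀ h ∈ C.H0, sigma' C 𝔽 W σ h v0 = χ h • v0)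

/-- Right translation on functions `K → 𝔽` (the action on a (finite) principal series). -/
def PSact (k : ↥C.K) (f : ↥C.K → 𝔽) : ↥C.K → 𝔽 := fun x => f (x * k)

/-- The (inflation to `K` of the) finite principal series `Ind_𝔹^{Γ_K} χ`:
functions on `K`, invariant under right translation by `K¹`, left `I_{1,K}`-invariant and
left `(H₀, χ)`-equivariant. -/
def PSchiSub (χ : S.GG → 𝔽) : Submodule 𝔽 (↥C.K → 𝔽) where
  carrier := {f | (∀ b : ↥C.K, (b : S.GG) ∈ C.I1 → ∀ x, f (b * x) = f x) ∧
                  (∀ h : ↥C.K, (h : S.GG) ∈ C.H0 → ∀ x, f (h * x) = χ (h : S.GG) * f x) ∧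
                  (∀ z : ↥C.K, (z : S.GG) ∈ C.KoneS → ∀ x, f (x * z) = f x)}
  add_mem' := by
    rintro f g ⟨hf1, hf2, hf3⟩ ⟨hg1, hg2, hg3⟩
    exact ⟨fun b hb x => by simp [hf1 b hb x, hg1 b hb x],
           fun h hh x => by simp [hf2 h hh x, hg2 h hh x, mul_add],
           fun z hz x => by simp [hf3 z hz x, hg3 z hz x]⟩
  zero_mem' := ⟨fun b hb x => rfl, fun h hh x => by simp, fun z hz x => rfl⟩
  smul_mem' := by
    rintro c f ⟨hf1, hf2, hf3⟩
    refine ⟨fun b hb x => by simp [hf1 b hb x], fun h hh x => ?_, fun z hz x => by simp [hf3 z hz x]⟩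
    simp only [Pi.smul_apply, hf2 h hh x, smul_eq_mul]
    ring

/-- The principal series `Ind_𝔹^{Γ_K} 1` for the trivial character. -/
def PS1sub : Submodule 𝔽 (↥C.K → 𝔽) := PSchiSub C 𝔽 (fun _ => 1)

/-- `σ_{st}` is the Steinberg weight `st = (Ind_𝔹^{Γ_K} 1)/1`: there is a surjective
`K`-equivariant linear map from `Ind_𝔹^{Γ_K} 1` to it whose kernel is exactly the
constant functions. -/
def IsSteinberg {Wst : Type} [AddCommGroup Wst] [Module 𝔽 Wst]
    (σst : Representation 𝔽 ↥C.K Wst) : Prop :=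
  ∃ φ : ↥(PS1sub C 𝔽) →ₗ[𝔽] Wst, Function.Surjective φ ∧
    (∀ f : ↥(PS1sub C 𝔽), φ f = 0 ↔ ∃ c : 𝔽, (f : ↥C.K → 𝔽) = fun _ => c) ∧
    (∀ (k : ↥C.K) (f f' : ↥(PS1sub C 𝔽)),
      (f' : ↥C.K → 𝔽) = PSact C 𝔽 k (f : ↥C.K → 𝔽) → φ f' = σst k (φ f))

/-- `σ` is isomorphic to a twist of the Steinberg weight by a character. -/
def IsTwistSteinberg : Prop :=
  ∃ (c : ↥C.K →* 𝔽ˣ) (φ : ↥(PS1sub C 𝔽) →ₗ[𝔽] W), Function.Surjective φ ∧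
    (∀ f : ↥(PS1sub C 𝔽), φ f = 0 ↔ ∃ cc : 𝔽, (f : ↥C.K → 𝔽) = fun _ => cc) ∧
    (∀ (k : ↥C.K) (f f' : ↥(PS1sub C 𝔽)),
      (f' : ↥C.K → 𝔽) = PSact C 𝔽 k (f : ↥C.K → 𝔽) →
        φ f' = (c k : 𝔽) • σ k (φ f))


/-- The `K`-subrepresentation of the quotient `(ind_K^G σ) / (range T)` generated by the
image of a vector `v`. -/
def genQuot (T : Module.End 𝔽 ↥(IndSub C 𝔽 W σ)) (v : ↥(IndSub C 𝔽 W σ)) :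
    Submodule 𝔽 (↥(IndSub C 𝔽 W σ) ⧸ LinearMap.range T) :=
  Submodule.span 𝔽 {w | ∃ k ∈ C.K, w = Submodule.Quotient.mk (indRep C 𝔽 W σ k v)}

end Weight

/-- Smoothness of a representation of `G`: every vector is fixed by some congruence
subgroup (equivalently, has open stabilizer). -/
def SmoothRep {V : Type} [AddCommGroup V] [Module 𝔽 V] (ρ : Representation 𝔽 S.GG V) : Prop :=
  ∀ v : V, ∃ n : ℕ, ∀ g ∈ S.cong n, ρ g v = v

end RepTheory

end U21

namespace U21

namespace Setting

variable (S : Setting)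

section Valuation

variable {S}

lemma pE_zero_eq : S.pE 0 = S.O := by
  ext z; constructor
  · rintro ⟨w, hw, rfl⟩; simpa using hw
  · intro h; exact ⟨z, h, by simp⟩

lemma mem_pE_iff {k : ℤ} {x : S.E} : x ∈ S.pE k ↔ S.ϖ ^ (-k) * x ∈ S.O := by
  constructor
  · rintro ⟨w, hw, rfl⟩
    rwa [← mul_assoc, ← zpow_add₀ S.unif_ne, neg_add_cancel, zpow_zero, one_mul]
  · intro h
    refine ⟨_, h, ?_⟩
    rw [← mul_assoc, ← zpow_add₀ S.unif_ne, add_neg_cancel, zpow_zero, one_mul]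

lemma zero_mem_pE (k : ℤ) : (0 : S.E) ∈ S.pE k := by
  rw [mem_pE_iff]; simp [S.O.zero_mem]

lemma add_mem_pE {k : ℤ} {x y : S.E} (hx : x ∈ S.pE k) (hy : y ∈ S.pE k) : x + y ∈ S.pE k := by
  rw [mem_pE_iff] at *; rw [mul_add]; exact S.O.add_mem hx hy

lemma neg_mem_pE {k : ℤ} {x : S.E} (hx : x ∈ S.pE k) : -x ∈ S.pE k := by
  rw [mem_pE_iff] at *; rw [mul_neg]; exact S.O.neg_mem hx

lemma sub_mem_pE {k : ℤ} {x y : S.E} (hx : x ∈ S.pE k) (hy : y ∈ S.pE k) : x - y ∈ S.pE k := by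
  rw [sub_eq_add_neg]; exact add_mem_pE hx (neg_mem_pE hy)

lemma mul_mem_pE {k l : ℤ} {x y : S.E} (hx : x ∈ S.pE k) (hy : y ∈ S.pE l) :
    x * y ∈ S.pE (k + l) := by
  obtain ⟨a, ha, rfl⟩ := hx
  obtain ⟨b, hb, rfl⟩ := hy
  exact ⟨a * b, S.O.mul_mem ha hb, by rw [zpow_add₀ S.unif_ne]; ring⟩

lemma unif_zpow_mem (k : ℤ) : S.ϖ ^ k ∈ S.pE k := ⟨1, S.O.one_mem, by simp⟩

lemma pE_mono {k l : ℤ} (h : l ≤ k) {x : S.E} (hx : x ∈ S.pE k) : x ∈ S.pE l := by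
  obtain ⟨a, ha, rfl⟩ := hx
  obtain ⟨n, rfl⟩ := Int.exists_add_of_le h
  refine ⟨S.ϖ ^ n * a, S.O.mul_mem (S.O.pow_mem S.unif_mem n) ha, ?_⟩
  rw [zpow_add₀ S.unif_ne, zpow_natCast]; ring

lemma mul_mem_pE_of_le {k l m : ℤ} {x y : S.E} (hx : x ∈ S.pE k) (hy : y ∈ S.pE l)
    (h : m ≤ k + l) : x * y ∈ S.pE m := pE_mono h (mul_mem_pE hx hy)

lemma conj_mem_pE {k : ℤ} {x : S.E} (hx : x ∈ S.pE k) : S.conj x ∈ S.pE k := by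
  obtain ⟨a, ha, rfl⟩ := hx
  exact ⟨S.conj a, S.conj_O a ha, by simp [map_zpow₀, S.unif_conj]⟩

lemma conj_mem_pE_iff {k : ℤ} {x : S.E} : S.conj x ∈ S.pE k ↔ x ∈ S.pE k :=
  ⟨fun h => by simpa [S.conj_invol] using conj_mem_pE h, conj_mem_pE⟩

lemma one_mem_pE : (1 : S.E) ∈ S.pE 0 := ⟨1, S.O.one_mem, by simp⟩

lemma sum_mem_pE {ι : Type*} {k : ℤ} (s : Finset ι) (f : ι → S.E) (h : ∀ i ∈ s, f i ∈ S.pE k) :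
    ∑ i ∈ s, f i ∈ S.pE k :=
  Finset.sum_induction f (· ∈ S.pE k) (fun _ _ => add_mem_pE) (zero_mem_pE k) h

lemma one_notMem_pE : (1 : S.E) ∉ S.pE 1 := by
  rintro ⟨w, hw, h⟩
  apply S.unif_not_unit
  refine IsUnit.of_mul_eq_one ⟨w, hw⟩ (Subtype.ext ?_)
  simpa using h.symm

lemma exists_val {x : S.E} (hx : x ≠ 0) : ∃ n : ℤ, x ∈ S.pE n ∧ x⁻¹ ∈ S.pE (-n) := by
  obtain ⟨n, u, rfl⟩ := S.disc x hx
  refine ⟨n, ⟨_, (u : S.O).2, mul_comm _ _⟩, ⟨_, ((u⁻¹ : S.Oˣ) : S.O).2, ?_⟩⟩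
  have : ((u : S.O) : S.E) * ((u⁻¹ : S.Oˣ) : S.O) = 1 := by
    rw [← Subring.coe_mul, Units.mul_inv]; rfl
  have h2 := eq_inv_of_mul_eq_one_right this
  rw [h2, mul_inv, zpow_neg, mul_comm]

lemma ne_zero_of_notMem {k : ℤ} {x : S.E} (h : x ∉ S.pE k) : x ≠ 0 := by
  rintro rfl; exact h (zero_mem_pE k)

lemma inv_mem_of_notMem {k : ℤ} {x : S.E} (h : x ∉ S.pE (k + 1)) : x⁻¹ ∈ S.pE (-k) := by
  obtain ⟨n, h1, h2⟩ := exists_val (ne_zero_of_notMem h)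
  refine pE_mono ?_ h2
  by_contra hc
  exact h (pE_mono (by omega) h1)

lemma mem_pE_of_mul_conj {k : ℤ} {x : S.E} (h : x * S.conj x ∈ S.pE (2 * k - 1)) :
    x ∈ S.pE k := by
  by_contra hc
  have h1 : x⁻¹ ∈ S.pE (-(k - 1)) := inv_mem_of_notMem (by simpa using hc)
  have hx := ne_zero_of_notMem hc
  have h2 : (S.conj x)⁻¹ ∈ S.pE (-(k - 1)) := by rw [← map_inv₀]; exact conj_mem_pE h1
  have h3 := mul_mem_pE h (mul_mem_pE h1 h2)
  apply one_notMem_pE (S := S)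
  have hx' : S.conj x ≠ 0 := by simpa using hx
  have : x * S.conj x * (x⁻¹ * (S.conj x)⁻¹) = 1 := by field_simp
  rw [this] at h3
  exact pE_mono (by omega) h3

lemma mem_mI_iff (x : S.O) : x ∈ S.mI ↔ (x : S.E) ∈ S.pE 1 := by
  rw [S.hmI]
  constructor
  · rintro ⟨y, hy, h⟩; exact ⟨y, hy, by simpa using h⟩
  · rintro ⟨y, hy, h⟩; exact ⟨y, hy, by simpa using h⟩

/-- The residue of an element of `E`, with value `0` outside `o_E`. -/
def res (S : Setting) (x : S.E) : S.kE := if h : x ∈ S.O then S.resmap ⟨x, h⟩ else 0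

lemma res_eq_iff {x y : S.E} (hx : x ∈ S.pE 0) (hy : y ∈ S.pE 0) :
    S.res x = S.res y ↔ x - y ∈ S.pE 1 := by
  rw [pE_zero_eq] at hx hy
  have hx' : x ∈ S.O := hx
  have hy' : y ∈ S.O := hy
  simp only [res, hx', hy', dif_pos]
  rw [resmap, Ideal.Quotient.eq, mem_mI_iff]
  rfl

lemma mI_ne_top : S.mI ≠ ⊤ := by
  rw [Ideal.ne_top_iff_one, mem_mI_iff]
  exact one_notMem_pE

lemma mI_isPrime : S.mI.IsPrime := by
  refine ⟨mI_ne_top, fun {x y} h => ?_⟩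
  by_contra hc
  push Not at hc
  obtain ⟨h1, h2⟩ := hc
  rw [mem_mI_iff] at h h1 h2
  have h3 := inv_mem_of_notMem (k := 0) (by simpa using h1)
  have h4 := inv_mem_of_notMem (k := 0) (by simpa using h2)
  have h5 := mul_mem_pE h (mul_mem_pE h3 h4)
  have hx := ne_zero_of_notMem h1
  have hy := ne_zero_of_notMem h2
  apply one_notMem_pE (S := S)
  have : ((x * y : S.O) : S.E) * ((x : S.E)⁻¹ * (y : S.E)⁻¹) = 1 := by
    push_cast; field_simp
  rw [this] at h5
  simpa using h5

lemma p_mem_pE : (S.p : S.E) ∈ S.pE 1 := by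
  have := mI_isPrime (S := S)
  have h : ((S.p : S.O) : S.E) ∈ S.pE 1 := by
    rw [← mem_mI_iff, ← Ideal.Quotient.eq_zero_iff_mem]
    have : ((S.p : S.kE)) ^ (S.fdeg * 2) = 0 := by
      have := Nat.cast_card_eq_zero (S.O ⧸ S.mI)
      rw [S.card_res, S.hq, ← pow_mul] at this
      simpa using this
    simpa using pow_eq_zero_iff (n := S.fdeg * 2) (by have := S.hfdeg; omega) |>.1 this
  simpa using h

lemma card_le_of_pow_eq_self {R : Type*} [CommRing R] [IsDomain R] [Fintype R] {q : ℕ}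
    (hq : 1 < q) (h : ∀ a : R, a ^ q = a) : Fintype.card R ≤ q := by
  let P : Polynomial R := Polynomial.X ^ q - Polynomial.X
  have hdeg : P.natDegree = q := by
    rw [Polynomial.natDegree_sub_eq_left_of_natDegree_lt] <;> simp [hq]
  have hne : P ≠ 0 := by
    intro h; rw [h] at hdeg; simp at hdeg; omega
  have h2 : (Finset.univ : Finset R).card ≤ P.roots.toFinset.card := by
    apply Finset.card_le_card
    intro a _
    rw [Multiset.mem_toFinset, Polynomial.mem_roots hne]
    simp [P, Polynomial.IsRoot, h a]
  have h1 := Polynomial.card_roots' P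
  have h3 := Multiset.toFinset_card_le P.roots
  rw [Finset.card_univ] at h2
  omega

lemma exists_skew : ∃ e : S.E, e ∈ S.pE 0 ∧ e + S.conj e = 0 ∧ e ∉ S.pE 1 := by
  have := mI_isPrime (S := S)
  by_contra hc
  push Not at hc
  have hq : 1 < S.q := by
    rw [S.hq]; exact Nat.one_lt_pow S.hfdeg.ne' S.hp.one_lt
  have key : ∀ a : S.kE, a ^ S.q = a := by
    intro a
    obtain ⟨x, rfl⟩ := Ideal.Quotient.mk_surjective a
    rw [← S.res_frob, Ideal.Quotient.eq, mem_mI_iff]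
    have hx : (x : S.E) ∈ S.pE 0 := by rw [pE_zero_eq]; exact x.2
    exact hc (S.conj x - x) (sub_mem_pE (conj_mem_pE hx) hx) (by simp [S.conj_invol])
  have h := card_le_of_pow_eq_self hq key
  rw [S.card_res] at h
  nlinarith

lemma unit_of_mul {x y : S.E} (hy : y ∈ S.pE 0) (h : x * y - 1 ∈ S.pE 1) :
    x ∉ S.pE 1 := by
  intro hc
  have := mul_mem_pE_of_le hc hy (m := 1) (by simp)
  exact one_notMem_pE (by simpa using sub_mem_pE this h)

end Valuation

section Matrices

variable {S}

@[simp] lemma mat_mul (g h : S.GG) : S.mat (g * h) = S.mat g * S.mat h := rfl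

@[simp] lemma mat_one : S.mat 1 = 1 := rfl

lemma mat_ext {g h : S.GG} (e : S.mat g = S.mat h) : g = h := Subtype.ext (Units.ext e)

lemma mat_inv_apply (g : S.GG) (i j : Fin 3) :
    S.mat g⁻¹ i j = S.conj (S.mat g j.rev i.rev) := by
  have hg : (S.mat g).transpose * S.betaM * (S.mat g).map S.conj = S.betaM := g.2
  have hg' : ((S.mat g).map S.conj).transpose * S.betaM * S.mat g = S.betaM := by
    have := congrArg (fun M => Matrix.map M S.conj) hg
    simp only [Matrix.map_mul] at this
    have hb : S.betaM.map S.conj = S.betaM := by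
      ext i j; fin_cases i <;> fin_cases j <;> simp [betaM]
    have hi : ((S.mat g).map S.conj).map S.conj = S.mat g := by
      ext i j; simp [S.conj_invol]
    rw [hb, hi] at this
    exact this
  have h1 : (S.betaM * ((S.mat g).map S.conj).transpose * S.betaM) * S.mat g = 1 := by
    rw [mul_assoc, mul_assoc, ← mul_assoc _ S.betaM, hg', beta_mul_beta]
  have h2 : S.mat g * S.mat g⁻¹ = 1 := by rw [← mat_mul, mul_inv_cancel, mat_one]
  have h3 : S.mat g⁻¹ = S.betaM * ((S.mat g).map S.conj).transpose * S.betaM := by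
    calc S.mat g⁻¹ = 1 * S.mat g⁻¹ := (one_mul _).symm
      _ = _ := by rw [← h1, mul_assoc, h2, mul_one]
  rw [h3]
  fin_cases i <;> fin_cases j <;>
    simp [betaM, Matrix.mul_apply, Fin.sum_univ_three, Fin.rev, Matrix.vecMul, dotProduct]

lemma mat_mul_apply (g h : S.GG) (i j : Fin 3) :
    S.mat (g * h) i j = S.mat g i 0 * S.mat h 0 j + S.mat g i 1 * S.mat h 1 j +
      S.mat g i 2 * S.mat h 2 j := by
  rw [mat_mul, Matrix.mul_apply, Fin.sum_univ_three]

/-- The subgroup of `g ∈ G` with `g - 1` having `(i, j)` entry in `p_E ^ (D i j)`. -/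
def conSub (S : Setting) (D : Fin 3 → Fin 3 → ℤ) (h1 : ∀ i j k, D i k ≤ D i j + D j k)
    (h2 : ∀ i j, D j.rev i.rev = D i j) : Subgroup S.GG where
  carrier := {g | ∀ i j, S.mat g i j - (1 : S.M3) i j ∈ S.pE (D i j)}
  one_mem' := fun i j => by simpa using zero_mem_pE _
  mul_mem' := by
    intro a b ha hb i j
    have : S.mat (a * b) - 1 = (S.mat a - 1) * (S.mat b - 1) + (S.mat a - 1) + (S.mat b - 1) := by
      rw [mat_mul]; noncomm_ring
    have h := congrFun (congrFun this i) j
    simp only [Matrix.sub_apply, Matrix.add_apply, Matrix.mul_apply] at h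
    rw [h]
    exact add_mem_pE (add_mem_pE (sum_mem_pE _ _ fun k _ =>
      mul_mem_pE_of_le (ha i k) (hb k j) (h1 i k j)) (ha i j)) (hb i j)
  inv_mem' := by
    intro a ha i j
    rw [mat_inv_apply]
    have : (1 : S.M3) i j = S.conj ((1 : S.M3) j.rev i.rev) := by
      simp [Matrix.one_apply, apply_ite S.conj, Fin.rev_inj, eq_comm]
    rw [this, ← map_sub, ← h2 i j]
    exact conj_mem_pE (ha _ _)

lemma mem_conSub {D : Fin 3 → Fin 3 → ℤ} {h1 h2} {g : S.GG} :
    g ∈ conSub S D h1 h2 ↔ ∀ i j, S.mat g i j - (1 : S.M3) i j ∈ S.pE (D i j) := Iff.rfl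

end Matrices

end Setting

namespace Setting

section Elements

variable {S : Setting}

lemma forall_three {P : Fin 3 → Fin 3 → Prop} : (∀ i j, P i j) ↔
    (P 0 0 ∧ P 0 1 ∧ P 0 2) ∧ (P 1 0 ∧ P 1 1 ∧ P 1 2) ∧ (P 2 0 ∧ P 2 1 ∧ P 2 2) := by
  constructor
  · intro h; simp [h]
  · rintro ⟨⟨h1, h2, h3⟩, ⟨h4, h5, h6⟩, h7, h8, h9⟩ i j
    fin_cases i <;> fin_cases j <;> assumption

lemma col_rel (g : S.GG) (i j : Fin 3) :
    S.conj (S.mat g 2 i) * S.mat g 0 j + S.conj (S.mat g 1 i) * S.mat g 1 j +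
      S.conj (S.mat g 0 i) * S.mat g 2 j = if i.rev = j then 1 else 0 := by
  have h := mat_mul_apply g⁻¹ g i.rev j
  rw [inv_mul_cancel, mat_one, Matrix.one_apply] at h
  rw [h]
  simp only [mat_inv_apply, Fin.rev_rev]
  rfl

lemma row_rel (g : S.GG) (i j : Fin 3) :
    S.mat g i 0 * S.conj (S.mat g j 2) + S.mat g i 1 * S.conj (S.mat g j 1) +
      S.mat g i 2 * S.conj (S.mat g j 0) = if i = j.rev then 1 else 0 := by
  have h := mat_mul_apply g g⁻¹ i j.rev
  rw [mul_inv_cancel, mat_one, Matrix.one_apply] at h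
  rw [h]
  simp only [mat_inv_apply, Fin.rev_rev]
  rfl

lemma exists_mat_eq (M : S.M3) (h : M.transpose * S.betaM * M.map S.conj = S.betaM) :
    ∃ g : S.GG, S.mat g = M := by
  have h1 : (S.betaM * M.transpose * S.betaM) * M.map S.conj = 1 := by
    rw [mul_assoc, mul_assoc, ← mul_assoc _ S.betaM, h, beta_mul_beta]
  have h2 : IsUnit (M.map S.conj).det := by
    rw [← Matrix.isUnit_iff_isUnit_det]
    exact IsUnit.of_mul_eq_one_right _ h1
  have h3 : M.det ≠ 0 := by
    intro h0
    have : (M.map S.conj).det = S.conj M.det := by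
      rw [RingHom.map_det]; rfl
    rw [this, h0, map_zero] at h2
    exact not_isUnit_zero h2
  exact ⟨⟨Matrix.GeneralLinearGroup.mkOfDetNeZero M h3, h⟩, rfl⟩

lemma exists_lower (x y : S.E) (h : x * S.conj x + y + S.conj y = 0) :
    ∃ g : S.GG, S.mat g = S.n'M x y := by
  refine exists_mat_eq _ ?_
  ext i j
  fin_cases i <;> fin_cases j <;>
    simp [n'M, betaM, Matrix.mul_apply, Fin.sum_univ_three, Matrix.map_apply,
      S.conj_invol]; linear_combination h

lemma exists_upper (x y : S.E) (h : x * S.conj x + y + S.conj y = 0) :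
    ∃ g : S.GG, S.mat g = S.nM x y := by
  refine exists_mat_eq _ ?_
  ext i j
  fin_cases i <;> fin_cases j <;>
    simp [nM, betaM, Matrix.mul_apply, Fin.sum_univ_three, Matrix.map_apply,
      S.conj_invol]; linear_combination h

lemma exists_diag (a b : S.E) (ha : a ≠ 0) (hb : b * S.conj b = 1) :
    ∃ g : S.GG, S.mat g = !![a, 0, 0; 0, b, 0; 0, 0, (S.conj a)⁻¹] := by
  have ha' : S.conj a ≠ 0 := by simpa using ha
  refine exists_mat_eq _ ?_
  ext i j
  fin_cases i <;> fin_cases j <;>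
    simp [betaM, Matrix.mul_apply, Fin.sum_univ_three, Matrix.map_apply,
      S.conj_invol, hb, ha, ha']

/-- Upper triangular elements. -/
def IsUpper (g : S.GG) : Prop := S.mat g 1 0 = 0 ∧ S.mat g 2 0 = 0 ∧ S.mat g 2 1 = 0

lemma IsUpper.mul {g h : S.GG} (hg : IsUpper g) (hh : IsUpper h) : IsUpper (g * h) := by
  obtain ⟨h1, h2, h3⟩ := hg
  obtain ⟨h4, h5, h6⟩ := hh
  simp [IsUpper, mat_mul_apply, -mat_mul, *]

lemma IsUpper.inv {g : S.GG} (hg : IsUpper g) : IsUpper g⁻¹ := by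
  obtain ⟨h1, h2, h3⟩ := hg
  simp [IsUpper, mat_inv_apply, Fin.rev, *]

lemma isUpper_of_row {b : S.GG} (h0 : S.mat b 2 0 = 0) (h1 : S.mat b 2 1 = 0) : IsUpper b := by
  refine ⟨?_, h0, h1⟩
  have h := row_rel b 1 2
  have h' := row_rel b 0 2
  rw [h0, h1] at h h'
  simp [Fin.rev] at h h'
  rcases h with h | h
  · exact h
  · rw [h] at h'; simp at h'

/-- An element whose `(2, 2)` entry is nonzero is the product of an upper triangular element
and a lower unipotent one. -/
lemma exists_upper_mul_lower (g : S.GG) (hg : S.mat g 2 2 ≠ 0) :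
    ∃ x y : S.E, x * S.conj x + y + S.conj y = 0 ∧ y = S.mat g 2 0 / S.mat g 2 2 ∧
      ∃ b n : S.GG, IsUpper b ∧ S.mat n = S.n'M x y ∧ g = b * n := by
  have hg' : S.conj (S.mat g 2 2) ≠ 0 := by simpa using hg
  set y := S.mat g 2 0 / S.mat g 2 2 with hy
  set x := - S.conj (S.mat g 2 1 / S.mat g 2 2) with hx
  have h : x * S.conj x + y + S.conj y = 0 := by
    have := row_rel g 2 2
    simp [Fin.rev] at this
    rw [hx, hy]
    simp only [map_neg, S.conj_invol, map_div₀]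
    field_simp
    linear_combination this
  obtain ⟨n, hn⟩ := exists_lower x y h
  refine ⟨x, y, h, rfl, g * n⁻¹, n, ?_, hn, by simp⟩
  have e1 : S.mat g 2 0 = S.mat g 2 2 * y := by rw [hy]; field_simp
  have e2 : S.mat g 2 1 = - (S.mat g 2 2 * S.conj x) := by
    rw [hx]; simp only [map_neg, S.conj_invol]; field_simp
  apply isUpper_of_row
  · rw [mat_mul_apply]
    simp only [mat_inv_apply, hn]
    simp [n'M, Fin.rev, e1, e2, S.conj_invol]
    linear_combination (S.mat g 2 2) * h
  · rw [mat_mul_apply]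
    simp only [mat_inv_apply, hn]
    simp [n'M, Fin.rev, e2]

lemma mem_pE_of_isotropic {x y : S.E} (h : x * S.conj x + y + S.conj y = 0) {k : ℤ}
    (hy : y ∈ S.pE (2 * k - 1)) : x ∈ S.pE k := by
  apply mem_pE_of_mul_conj
  have : x * S.conj x = -(y + S.conj y) := by linear_combination h
  rw [this]
  exact neg_mem_pE (add_mem_pE hy (conj_mem_pE hy))

lemma alpha_apply (i j : Fin 3) : S.mat S.alphaE i j = S.alphaM i j := rfl
lemma alpha_inv_apply (i j : Fin 3) : S.mat S.alphaE⁻¹ i j = S.alphaMinv i j := rfl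
lemma beta_apply (i j : Fin 3) : S.mat S.betaE i j = S.betaM i j := rfl

lemma betaE_mul_betaE : S.betaE * S.betaE = 1 := mat_ext (by
  rw [mat_mul]; exact S.beta_mul_beta)

lemma betaE_inv : S.betaE⁻¹ = S.betaE := inv_eq_of_mul_eq_one_left betaE_mul_betaE

lemma mat_betaPr : S.mat S.betaPr = !![0, 0, S.ϖ⁻¹; 0, 1, 0; S.ϖ, 0, 0] := by
  ext i j
  rw [betaPr, mat_mul_apply]
  simp only [alpha_inv_apply, beta_apply]
  fin_cases i <;> fin_cases j <;> simp [betaM, alphaMinv]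

lemma betaPr_mul_betaPr : S.betaPr * S.betaPr = 1 := mat_ext (by
  rw [mat_mul, mat_betaPr]
  ext i j
  fin_cases i <;> fin_cases j <;> simp [Matrix.mul_apply, Fin.sum_univ_three, S.unif_ne])

lemma betaPr_inv : S.betaPr⁻¹ = S.betaPr := inv_eq_of_mul_eq_one_left betaPr_mul_betaPr

lemma betaE_eq : S.betaE = S.betaPr * S.alphaE := by simp [betaPr]

lemma alphaE_eq : S.alphaE = S.betaPr * S.betaE := by
  rw [betaE_eq, ← mul_assoc, betaPr_mul_betaPr, one_mul]

/-- Conjugation by `β` reverses rows and columns. -/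
lemma beta_conj_apply (g : S.GG) (i j : Fin 3) :
    S.mat (S.betaE * g * S.betaE) i j = S.mat g i.rev j.rev := by
  rw [mat_mul_apply, mat_mul_apply, mat_mul_apply, mat_mul_apply]
  simp only [beta_apply]
  fin_cases i <;> fin_cases j <;> simp [betaM, Fin.rev]

lemma mul_beta_apply (g : S.GG) (i j : Fin 3) :
    S.mat (g * S.betaE) i j = S.mat g i j.rev := by
  rw [mat_mul_apply]
  simp only [beta_apply]
  fin_cases j <;> simp [betaM, Fin.rev]

/-- The weights with which conjugation by `α` scales the matrix entries. -/
def wt : Fin 3 → ℤ := ![-1, 0, 1]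

lemma alpha_conj_apply (g : S.GG) (i j : Fin 3) :
    S.mat (S.alphaE * g * S.alphaE⁻¹) i j = S.ϖ ^ (wt i - wt j) * S.mat g i j := by
  have := S.unif_ne
  rw [mat_mul_apply, mat_mul_apply, mat_mul_apply, mat_mul_apply]
  simp only [alpha_apply, alpha_inv_apply]
  fin_cases i <;> fin_cases j <;> simp [alphaM, alphaMinv, wt] <;> field_simp

lemma betaPr_conj_apply (g : S.GG) (i j : Fin 3) :
    S.mat (S.betaPr * g * S.betaPr) i j = S.ϖ ^ (wt i - wt j) * S.mat g i.rev j.rev := by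
  have h : S.betaPr * g * S.betaPr = S.alphaE * (S.betaE * g * S.betaE) * S.alphaE⁻¹ := by
    rw [alphaE_eq, mul_inv_rev, betaPr_inv, betaE_inv]
    simp only [mul_assoc]
    rw [← mul_assoc S.betaE S.betaE, betaE_mul_betaE, one_mul,
      ← mul_assoc S.betaE S.betaE, betaE_mul_betaE, one_mul]
  rw [h, alpha_conj_apply, beta_conj_apply]

lemma unif_zpow_mul_mem {k : ℤ} {x : S.E} (n : ℤ) :
    S.ϖ ^ n * x ∈ S.pE k ↔ x ∈ S.pE (k - n) := by
  rw [mem_pE_iff, mem_pE_iff, ← mul_assoc, ← zpow_add₀ S.unif_ne]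
  ring_nf

end Elements

section Subgroups

variable {S : Setting}

/-- The subgroup `K₀`. -/
def gK0 (S : Setting) : Subgroup S.GG :=
  conSub S ![![0, 0, 0], ![0, 0, 0], ![0, 0, 0]] (by decide) (by decide)
/-- The subgroup `K₁`. -/
def gK1 (S : Setting) : Subgroup S.GG :=
  conSub S ![![0, 0, -1], ![1, 0, 0], ![1, 1, 0]] (by decide) (by decide)
/-- The Iwahori subgroup of `K₁`. -/
def gI (S : Setting) : Subgroup S.GG :=
  conSub S ![![0, 0, -1], ![1, 0, 0], ![2, 1, 0]] (by decide) (by decide)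
/-- The pro-`p` Iwahori subgroup of `K₁`. -/
def gI1 (S : Setting) : Subgroup S.GG :=
  conSub S ![![1, 0, -1], ![1, 1, 0], ![2, 1, 1]] (by decide) (by decide)
/-- The opposite pro-`p` Iwahori subgroup of `K₁`, which is also the
pro-`p` Iwahori subgroup of `K₀`. -/
def gI' (S : Setting) : Subgroup S.GG :=
  conSub S ![![1, 0, 0], ![1, 1, 0], ![1, 1, 1]] (by decide) (by decide)
/-- The maximal normal pro-`p` subgroup of `K₁`. -/
def gK1one (S : Setting) : Subgroup S.GG :=
  conSub S ![![1, 0, 0], ![1, 1, 0], ![2, 1, 1]] (by decide) (by decide)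
/-- The Iwahori subgroup of `K₀`. -/
def gJ (S : Setting) : Subgroup S.GG :=
  conSub S ![![0, 0, 0], ![1, 0, 0], ![1, 1, 0]] (by decide) (by decide)
/-- The conjugate `α⁻¹ K₁ α`. -/
def gK1conj (S : Setting) : Subgroup S.GG :=
  conSub S ![![0, 1, 1], ![0, 0, 1], ![-1, 0, 0]] (by decide) (by decide)

lemma conSub_mono {D D' : Fin 3 → Fin 3 → ℤ} {h1 h2 h1' h2'} (h : ∀ i j, D' i j ≤ D i j) :
    conSub S D h1 h2 ≤ conSub S D' h1' h2' := fun _ hg i j => pE_mono (h i j) (hg i j)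

lemma mem_conSub_of_nonpos {D : Fin 3 → Fin 3 → ℤ} {h1 h2} (h : ∀ i, D i i ≤ 0) {g : S.GG} :
    g ∈ conSub S D h1 h2 ↔ ∀ i j, S.mat g i j ∈ S.pE (D i j) := by
  have hd : ∀ i j, (1 : S.M3) i j ∈ S.pE (D i j) := by
    intro i j
    rw [Matrix.one_apply]
    split_ifs with hij
    · subst hij; exact pE_mono (h i) one_mem_pE
    · exact zero_mem_pE _
  rw [mem_conSub]
  refine forall₂_congr fun i j => ⟨fun h => ?_, fun h => sub_mem_pE h (hd i j)⟩
  simpa using add_mem_pE h (hd i j)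

lemma mem_gK0 {g : S.GG} : g ∈ gK0 S ↔ ∀ i j, S.mat g i j ∈ S.pE 0 := by
  rw [gK0, mem_conSub_of_nonpos (by decide), forall_three, forall_three]
  simp

lemma mem_gK1 {g : S.GG} : g ∈ gK1 S ↔
    (S.mat g 0 0 ∈ S.pE 0 ∧ S.mat g 0 1 ∈ S.pE 0 ∧ S.mat g 0 2 ∈ S.pE (-1)) ∧
    (S.mat g 1 0 ∈ S.pE 1 ∧ S.mat g 1 1 ∈ S.pE 0 ∧ S.mat g 1 2 ∈ S.pE 0) ∧
    (S.mat g 2 0 ∈ S.pE 1 ∧ S.mat g 2 1 ∈ S.pE 1 ∧ S.mat g 2 2 ∈ S.pE 0) := by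
  rw [gK1, mem_conSub_of_nonpos (by decide), forall_three]
  simp

lemma mem_gI {g : S.GG} : g ∈ gI S ↔
    (S.mat g 0 0 ∈ S.pE 0 ∧ S.mat g 0 1 ∈ S.pE 0 ∧ S.mat g 0 2 ∈ S.pE (-1)) ∧
    (S.mat g 1 0 ∈ S.pE 1 ∧ S.mat g 1 1 ∈ S.pE 0 ∧ S.mat g 1 2 ∈ S.pE 0) ∧
    (S.mat g 2 0 ∈ S.pE 2 ∧ S.mat g 2 1 ∈ S.pE 1 ∧ S.mat g 2 2 ∈ S.pE 0) := by
  rw [gI, mem_conSub_of_nonpos (by decide), forall_three]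
  simp

lemma mem_gJ {g : S.GG} : g ∈ gJ S ↔
    (S.mat g 0 0 ∈ S.pE 0 ∧ S.mat g 0 1 ∈ S.pE 0 ∧ S.mat g 0 2 ∈ S.pE 0) ∧
    (S.mat g 1 0 ∈ S.pE 1 ∧ S.mat g 1 1 ∈ S.pE 0 ∧ S.mat g 1 2 ∈ S.pE 0) ∧
    (S.mat g 2 0 ∈ S.pE 1 ∧ S.mat g 2 1 ∈ S.pE 1 ∧ S.mat g 2 2 ∈ S.pE 0) := by
  rw [gJ, mem_conSub_of_nonpos (by decide), forall_three]
  simp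

lemma mem_gK1conj {g : S.GG} : g ∈ gK1conj S ↔
    (S.mat g 0 0 ∈ S.pE 0 ∧ S.mat g 0 1 ∈ S.pE 1 ∧ S.mat g 0 2 ∈ S.pE 1) ∧
    (S.mat g 1 0 ∈ S.pE 0 ∧ S.mat g 1 1 ∈ S.pE 0 ∧ S.mat g 1 2 ∈ S.pE 1) ∧
    (S.mat g 2 0 ∈ S.pE (-1) ∧ S.mat g 2 1 ∈ S.pE 0 ∧ S.mat g 2 2 ∈ S.pE 0) := by
  rw [gK1conj, mem_conSub_of_nonpos (by decide), forall_three]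
  simp

lemma mem_gI1 {g : S.GG} : g ∈ gI1 S ↔
    (S.mat g 0 0 - 1 ∈ S.pE 1 ∧ S.mat g 0 1 ∈ S.pE 0 ∧ S.mat g 0 2 ∈ S.pE (-1)) ∧
    (S.mat g 1 0 ∈ S.pE 1 ∧ S.mat g 1 1 - 1 ∈ S.pE 1 ∧ S.mat g 1 2 ∈ S.pE 0) ∧
    (S.mat g 2 0 ∈ S.pE 2 ∧ S.mat g 2 1 ∈ S.pE 1 ∧ S.mat g 2 2 - 1 ∈ S.pE 1) := by
  rw [gI1, mem_conSub, forall_three]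
  simp

lemma mem_gI' {g : S.GG} : g ∈ gI' S ↔
    (S.mat g 0 0 - 1 ∈ S.pE 1 ∧ S.mat g 0 1 ∈ S.pE 0 ∧ S.mat g 0 2 ∈ S.pE 0) ∧
    (S.mat g 1 0 ∈ S.pE 1 ∧ S.mat g 1 1 - 1 ∈ S.pE 1 ∧ S.mat g 1 2 ∈ S.pE 0) ∧
    (S.mat g 2 0 ∈ S.pE 1 ∧ S.mat g 2 1 ∈ S.pE 1 ∧ S.mat g 2 2 - 1 ∈ S.pE 1) := by
  rw [gI', mem_conSub, forall_three]
  simp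

lemma mem_gK1one {g : S.GG} : g ∈ gK1one S ↔
    (S.mat g 0 0 - 1 ∈ S.pE 1 ∧ S.mat g 0 1 ∈ S.pE 0 ∧ S.mat g 0 2 ∈ S.pE 0) ∧
    (S.mat g 1 0 ∈ S.pE 1 ∧ S.mat g 1 1 - 1 ∈ S.pE 1 ∧ S.mat g 1 2 ∈ S.pE 0) ∧
    (S.mat g 2 0 ∈ S.pE 2 ∧ S.mat g 2 1 ∈ S.pE 1 ∧ S.mat g 2 2 - 1 ∈ S.pE 1) := by
  rw [gK1one, mem_conSub, forall_three]
  simp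

lemma mem_pE_zero_of_sub_one {x : S.E} (h : x - 1 ∈ S.pE 1) : x ∈ S.pE 0 := by
  simpa using add_mem_pE (pE_mono (by norm_num : (0 : ℤ) ≤ 1) h) one_mem_pE

lemma mem_O_iff {x : S.E} : x ∈ S.O ↔ x ∈ S.pE 0 := by rw [pE_zero_eq]; rfl

lemma gK1_eq : (gK1 S : Set S.GG) = S.K1set := by
  ext g
  simp only [SetLike.mem_coe, mem_gK1, K1set, mem_O_iff, Set.mem_ofPred_eq]
  tauto

lemma gI1_eq : (gI1 S : Set S.GG) = S.I1K1 := by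
  ext g
  simp only [SetLike.mem_coe, mem_gI1, I1K1, IK1, K1set, mem_O_iff, Set.mem_ofPred_eq]
  constructor
  · rintro ⟨⟨h1, h2, h3⟩, ⟨h4, h5, h6⟩, h7, h8, h9⟩
    exact ⟨⟨⟨mem_pE_zero_of_sub_one h1, h2, h3, h4, mem_pE_zero_of_sub_one h5, h6,
      pE_mono (by norm_num) h7, h8, mem_pE_zero_of_sub_one h9⟩, h7⟩, h1, h5, h9⟩
  · tauto

lemma gI'_eq : (gI' S : Set S.GG) = S.I1'K1 := by
  ext g
  simp only [SetLike.mem_coe, mem_gI', I1'K1, K1set, mem_O_iff, Set.mem_ofPred_eq]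
  constructor
  · rintro ⟨⟨h1, h2, h3⟩, ⟨h4, h5, h6⟩, h7, h8, h9⟩
    exact ⟨⟨mem_pE_zero_of_sub_one h1, h2, pE_mono (by norm_num) h3, h4,
      mem_pE_zero_of_sub_one h5, h6, h7, h8, mem_pE_zero_of_sub_one h9⟩, h3, h1, h5, h9⟩
  · tauto

lemma gK1one_eq : (gK1one S : Set S.GG) = S.Kone1 := by
  ext g
  simp only [SetLike.mem_coe, mem_gK1one, Kone1, K1set, mem_O_iff, Set.mem_ofPred_eq]
  constructor
  · rintro ⟨⟨h1, h2, h3⟩, ⟨h4, h5, h6⟩, h7, h8, h9⟩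
    exact ⟨⟨mem_pE_zero_of_sub_one h1, h2, pE_mono (by norm_num) h3, h4,
      mem_pE_zero_of_sub_one h5, h6, pE_mono (by norm_num) h7, h8,
      mem_pE_zero_of_sub_one h9⟩, h3, h7, h1, h5, h9⟩
  · tauto

lemma gI_eq : (gI S : Set S.GG) = S.IK1 := by
  ext g
  simp only [SetLike.mem_coe, mem_gI, IK1, K1set, mem_O_iff, Set.mem_ofPred_eq]
  constructor
  · rintro ⟨⟨h1, h2, h3⟩, ⟨h4, h5, h6⟩, h7, h8, h9⟩
    exact ⟨⟨h1, h2, h3, h4, h5, h6, pE_mono (by norm_num) h7, h8, h9⟩, h7⟩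
  · tauto

lemma gI1_le_gK1 : gI1 S ≤ gK1 S := conSub_mono (by decide)
lemma gI'_le_gK1 : gI' S ≤ gK1 S := conSub_mono (by decide)
lemma gI'_le_gJ : gI' S ≤ gJ S := conSub_mono (by decide)
lemma gJ_le_gK1 : gJ S ≤ gK1 S := conSub_mono (by decide)
lemma gJ_le_gK0 : gJ S ≤ gK0 S := conSub_mono (by decide)
lemma gK1one_le_gK1 : gK1one S ≤ gK1 S := conSub_mono (by decide)
lemma gK1one_le_gI' : gK1one S ≤ gI' S := conSub_mono (by decide)

lemma mul_mem_pE_sum {D D' D'' : Fin 3 → Fin 3 → ℤ} (h : ∀ i j k, D'' i k ≤ D i j + D' j k)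
    {A B : S.M3} (hA : ∀ i j, A i j ∈ S.pE (D i j)) (hB : ∀ i j, B i j ∈ S.pE (D' i j))
    (i j : Fin 3) : (A * B) i j ∈ S.pE (D'' i j) := by
  rw [Matrix.mul_apply]
  exact sum_mem_pE _ _ fun k _ => mul_mem_pE_of_le (hA i k) (hB k j) (h i k j)

/-- `K₁¹` is normal in `K₁`. -/
lemma conj_mem_gK1one {k g : S.GG} (hk : k ∈ gK1 S) (hg : g ∈ gK1one S) :
    k * g * k⁻¹ ∈ gK1one S := by
  have hk' := (gK1 S).inv_mem hk
  rw [gK1, mem_conSub_of_nonpos (by decide)] at hk hk'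
  intro i j
  have e : S.mat (k * g * k⁻¹) - 1 = S.mat k * (S.mat g - 1) * S.mat k⁻¹ := by
    have : S.mat k * S.mat k⁻¹ = 1 := by rw [← mat_mul, mul_inv_cancel, mat_one]
    rw [mat_mul, mat_mul, mul_sub, sub_mul, mul_one, this]
  rw [← Matrix.sub_apply, e]
  exact mul_mem_pE_sum (D := ![![1, 0, 0], ![1, 1, 0], ![2, 1, 1]]) (by decide)
    (mul_mem_pE_sum (D'' := ![![1, 0, 0], ![1, 1, 0], ![2, 1, 1]]) (by decide) hk
    (fun i j => hg i j)) hk' i j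

lemma alpha_conj_mem_gK1 {g : S.GG} : S.alphaE * g * S.alphaE⁻¹ ∈ gK1 S ↔ g ∈ gK1conj S := by
  rw [gK1, gK1conj, mem_conSub_of_nonpos (by decide), mem_conSub_of_nonpos (by decide)]
  simp only [alpha_conj_apply, unif_zpow_mul_mem]
  simp [forall_three, wt]

lemma betaPr_conj_mem_gI1 {g : S.GG} (hg : g ∈ gI' S) : S.betaPr * g * S.betaPr ∈ gI1 S := by
  intro i j
  have h1 : (1 : S.M3) i j = S.ϖ ^ (wt i - wt j) * (1 : S.M3) i.rev j.rev := by
    fin_cases i <;> fin_cases j <;> simp [wt, Fin.rev]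
  rw [betaPr_conj_apply, h1, ← mul_sub, unif_zpow_mul_mem]
  refine pE_mono ?_ (hg _ _)
  clear h1; revert i j; decide

lemma betaPr_mem : S.betaPr ∈ gK1 S := by
  rw [mem_gK1, mat_betaPr]
  simp only [zero_mem_pE, one_mem_pE, Matrix.of_apply, Matrix.cons_val', Matrix.cons_val_zero,
    Matrix.cons_val_fin_one, Matrix.cons_val_one, Matrix.cons_val, true_and, and_true]
  constructor
  · simpa using unif_zpow_mem (S := S) (-1)
  · simpa using unif_zpow_mem (S := S) 1

lemma betaE_mem : S.betaE ∈ gK0 S := by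
  rw [mem_gK0, forall_three]
  simp [beta_apply, betaM, zero_mem_pE, one_mem_pE]

end Subgroups

end Setting

namespace Setting

section Unipotent

variable {S : Setting}

lemma mem_Nk_iff {k : ℤ} {g : S.GG} : g ∈ S.Nk k ↔
    IsUpper g ∧ (S.mat g 0 0 = 1 ∧ S.mat g 1 1 = 1 ∧ S.mat g 2 2 = 1) ∧ S.mat g 0 2 ∈ S.pE k := by
  constructor
  · rintro ⟨x, y, h, hy, e⟩
    simp [IsUpper, e, nM, hy]
  · rintro ⟨⟨h1, h2, h3⟩, ⟨h4, h5, h6⟩, h7⟩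
    have r1 := row_rel g 0 0
    have r2 := row_rel g 0 1
    simp [Fin.rev, *] at r1 r2
    refine ⟨S.mat g 0 1, S.mat g 0 2, by linear_combination r1, h7, ?_⟩
    have h8 : S.mat g 1 2 = -S.conj (S.mat g 0 1) := by
      have := congrArg S.conj r2
      simp [S.conj_invol] at this
      linear_combination this
    ext i j
    fin_cases i <;> fin_cases j <;> simp [nM, *]

lemma entry_of_mem_Nk {k : ℤ} {g : S.GG} (hg : g ∈ S.Nk k) :
    S.mat g 1 2 = - S.conj (S.mat g 0 1) ∧
      S.mat g 0 1 * S.conj (S.mat g 0 1) + S.mat g 0 2 + S.conj (S.mat g 0 2) = 0 := by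
  obtain ⟨x, y, h, hy, e⟩ := hg
  simp [e, nM, h]

lemma mul_conj_mem {k : ℤ} {x x' y y' : S.E} (h : x * S.conj x + y + S.conj y = 0)
    (h' : x' * S.conj x' + y' + S.conj y' = 0) (hy : y ∈ S.pE k) (hy' : y' ∈ S.pE k) :
    x * S.conj x' ∈ S.pE k := by
  obtain ⟨m, rfl | rfl⟩ := k.even_or_odd'
  · have h1 := mem_pE_of_isotropic (k := m) h (pE_mono (by omega) hy)
    have h2 := mem_pE_of_isotropic (k := m) h' (pE_mono (by omega) hy')
    exact mul_mem_pE_of_le h1 (conj_mem_pE h2) (by omega)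
  · have h1 := mem_pE_of_isotropic (k := m + 1) h (pE_mono (by omega) hy)
    have h2 := mem_pE_of_isotropic (k := m + 1) h' (pE_mono (by omega) hy')
    exact mul_mem_pE_of_le h1 (conj_mem_pE h2) (by omega)

/-- The subgroup `N_k`. -/
def gN (S : Setting) (k : ℤ) : Subgroup S.GG where
  carrier := S.Nk k
  one_mem' := by
    rw [mem_Nk_iff]
    simp [IsUpper, zero_mem_pE]
  mul_mem' := by
    intro a b ha hb
    obtain ⟨a1, a2⟩ := entry_of_mem_Nk ha
    obtain ⟨b1, b2⟩ := entry_of_mem_Nk hb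
    rw [mem_Nk_iff] at *
    obtain ⟨ua, ⟨a4, a5, a6⟩, a7⟩ := ha
    obtain ⟨ub, ⟨b4, b5, b6⟩, b7⟩ := hb
    have hm := mul_conj_mem a2 b2 a7 b7
    refine ⟨ua.mul ub, ?_, ?_⟩
    · obtain ⟨u1, u2, u3⟩ := ua
      obtain ⟨v1, v2, v3⟩ := ub
      simp [mat_mul_apply, -mat_mul, *]
    · rw [mat_mul_apply, a4, b1, b6]
      have : 1 * S.mat b 0 2 + S.mat a 0 1 * -S.conj (S.mat b 0 1) + S.mat a 0 2 * 1 =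
        S.mat b 0 2 + S.mat a 0 2 - S.mat a 0 1 * S.conj (S.mat b 0 1) := by ring
      rw [this]
      exact sub_mem_pE (add_mem_pE b7 a7) hm
  inv_mem' := by
    intro a ha
    rw [mem_Nk_iff] at *
    obtain ⟨ua, ⟨a4, a5, a6⟩, a7⟩ := ha
    refine ⟨ua.inv, ?_, ?_⟩
    · simp [mat_inv_apply, Fin.rev, *]
    · rw [mat_inv_apply]
      exact conj_mem_pE a7

lemma mem_gN {k : ℤ} {g : S.GG} : g ∈ gN S k ↔
    IsUpper g ∧ (S.mat g 0 0 = 1 ∧ S.mat g 1 1 = 1 ∧ S.mat g 2 2 = 1) ∧ S.mat g 0 2 ∈ S.pE k :=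
  mem_Nk_iff

lemma gN_mono {k l : ℤ} (h : l ≤ k) : gN S k ≤ gN S l := by
  intro g hg
  rw [mem_gN] at *
  exact ⟨hg.1, hg.2.1, pE_mono h hg.2.2⟩

lemma gN_mul_apply {k l : ℤ} {a b : S.GG} (ha : a ∈ gN S k) (hb : b ∈ gN S l) :
    S.mat (a * b) 0 1 = S.mat a 0 1 + S.mat b 0 1 ∧
    S.mat (a * b) 0 2 = S.mat a 0 2 + S.mat b 0 2 - S.mat a 0 1 * S.conj (S.mat b 0 1) := by
  obtain ⟨b1, b2⟩ := entry_of_mem_Nk hb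
  rw [mem_gN] at *
  obtain ⟨⟨u1, u2, u3⟩, ⟨a4, a5, a6⟩, a7⟩ := ha
  obtain ⟨⟨v1, v2, v3⟩, ⟨b4, b5, b6⟩, b7⟩ := hb
  constructor <;> simp [mat_mul_apply, -mat_mul, *] <;> ring

lemma entry_mem_of_gN {k : ℤ} {g : S.GG} (hg : g ∈ gN S (2 * k - 1)) :
    S.mat g 0 1 ∈ S.pE k ∧ S.mat g 1 2 ∈ S.pE k := by
  obtain ⟨h1, h2⟩ := entry_of_mem_Nk hg
  rw [mem_gN] at hg
  have h := mem_pE_of_isotropic h2 hg.2.2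
  rw [h1]
  exact ⟨h, neg_mem_pE (conj_mem_pE h)⟩

lemma gN_neg_one_le_gI1 : gN S (-1) ≤ gI1 S := by
  intro g hg
  have h := entry_mem_of_gN (k := 0) (by simpa using hg)
  rw [mem_gN] at hg
  obtain ⟨⟨u1, u2, u3⟩, ⟨a4, a5, a6⟩, a7⟩ := hg
  rw [mem_gI1]
  simp [*, zero_mem_pE]

lemma gN_zero_le_gK1one : gN S 0 ≤ gK1one S := by
  intro g hg
  have h := gN_neg_one_le_gI1 (gN_mono (by norm_num) hg)
  rw [mem_gN] at hg
  rw [mem_gI1] at h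
  rw [mem_gK1one]
  exact ⟨⟨h.1.1, h.1.2.1, hg.2.2⟩, h.2⟩

lemma gN_neg_one_le_gK1 : gN S (-1) ≤ gK1 S := gN_neg_one_le_gI1.trans gI1_le_gK1
lemma gN_zero_le : gN S 0 ≤ gN S (-1) := gN_mono (by norm_num)
lemma gN_one_le : gN S 1 ≤ gN S 0 := gN_mono (by norm_num)
lemma gN_zero_le_gJ : gN S 0 ≤ gJ S :=
  gN_zero_le_gK1one.trans (gK1one_le_gI'.trans gI'_le_gJ)
lemma gN_zero_le_gK0 : gN S 0 ≤ gK0 S := gN_zero_le_gJ.trans gJ_le_gK0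

lemma gN_one_iff {g : S.GG} (hg : g ∈ gN S (-1)) : g ∈ gN S 1 ↔ g ∈ gK1conj S := by
  constructor
  · intro h
    have h2 := entry_mem_of_gN (k := 1) (by simpa using h)
    rw [mem_gN] at h
    obtain ⟨⟨u1, u2, u3⟩, ⟨a4, a5, a6⟩, a7⟩ := h
    rw [mem_gK1conj]
    simp [*, zero_mem_pE, one_mem_pE]
  · intro h
    rw [mem_gK1conj] at h
    rw [mem_gN] at *
    exact ⟨hg.1, hg.2.1, h.1.2.2⟩

lemma alpha_conj_gN_one {g : S.GG} (hg : g ∈ gN S 1) : S.alphaE * g * S.alphaE⁻¹ ∈ gN S (-1) := by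
  have h := hg
  rw [mem_gN] at hg ⊢
  obtain ⟨⟨u1, u2, u3⟩, ⟨a4, a5, a6⟩, a7⟩ := hg
  refine ⟨⟨?_, ?_, ?_⟩, ⟨?_, ?_, ?_⟩, ?_⟩ <;> rw [alpha_conj_apply]
  all_goals first | (simp [*]) | (rw [unif_zpow_mul_mem]; simpa [wt] using a7)

lemma isUpper_of_gN {k : ℤ} {g : S.GG} (hg : g ∈ gN S k) : IsUpper g := (mem_gN.1 hg).1

/-- `N_0` is normal in `N_{-1}`. -/
lemma conj_mem_gN_zero {k g : S.GG} (hk : k ∈ gN S (-1)) (hg : g ∈ gN S 0) :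
    k * g * k⁻¹ ∈ gN S 0 := by
  have h1 := (gN S (-1)).mul_mem ((gN S (-1)).mul_mem hk (gN_zero_le hg)) ((gN S (-1)).inv_mem hk)
  have h2 := conj_mem_gK1one (gN_neg_one_le_gK1 hk) (gN_zero_le_gK1one hg)
  rw [mem_gN] at *
  exact ⟨h1.1, h1.2.1, (mem_gK1one.1 h2).1.2.2⟩

lemma inv_mul_apply_gN {k l : ℤ} {a b : S.GG} (ha : a ∈ gN S k) (hb : b ∈ gN S l) :
    S.mat (a⁻¹ * b) 0 1 = S.mat b 0 1 - S.mat a 0 1 ∧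
    S.mat (a⁻¹ * b) 0 2 = S.mat b 0 2 - S.mat a 0 2 -
      S.mat a 0 1 * (S.conj (S.mat a 0 1) - S.conj (S.mat b 0 1)) := by
  obtain ⟨h1, h2⟩ := gN_mul_apply ((gN S k).inv_mem ha) hb
  obtain ⟨a1, a2⟩ := entry_of_mem_Nk ha
  have e1 : S.mat a⁻¹ 0 1 = -S.mat a 0 1 := by
    refine (mat_inv_apply a 0 1).trans (show S.conj (S.mat a 1 2) = _ from ?_)
    rw [a1, map_neg, S.conj_invol]
  have e2 : S.mat a⁻¹ 0 2 = S.conj (S.mat a 0 2) := mat_inv_apply a 0 2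
  rw [h1, h2, e1, e2]
  exact ⟨by ring, by linear_combination a2⟩

end Unipotent

section Factorization

variable {S : Setting}

/-- Diagonal elements with integral entries, i.e. `H ∩ K₁ = H ∩ I_{K₁}`. -/
def gH (S : Setting) : Subgroup S.GG :=
  conSub S ![![0, 0, 0], ![0, 0, 0], ![0, 0, 0]] (by decide) (by decide) ⊓
  { carrier := {g | ∀ i j, i ≠ j → S.mat g i j = 0}
    one_mem' := fun i j h => by simp [h]
    mul_mem' := by
      intro a b ha hb i j h
      rw [mat_mul, Matrix.mul_apply]
      refine Finset.sum_eq_zero fun k _ => ?_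
      by_cases hk : i = k
      · subst hk; rw [hb _ _ h, mul_zero]
      · rw [ha _ _ hk, zero_mul]
    inv_mem' := by
      intro a ha i j h
      rw [mat_inv_apply, ha _ _ (by simpa [Fin.rev_inj] using h.symm), map_zero] }

lemma mem_gH {g : S.GG} : g ∈ gH S ↔ g ∈ gK0 S ∧ ∀ i j, i ≠ j → S.mat g i j = 0 := Iff.rfl

lemma gH_le_gJ : gH S ≤ gJ S := by
  intro g hg
  obtain ⟨h1, h2⟩ := mem_gH.1 hg
  rw [mem_gK0] at h1
  rw [mem_gJ, h2 1 0 (by decide), h2 2 0 (by decide), h2 2 1 (by decide)]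
  simp [h1, zero_mem_pE]

lemma gH_le_gK1 : gH S ≤ gK1 S := gH_le_gJ.trans gJ_le_gK1
lemma gH_le_gI : gH S ≤ gI S := by
  intro g hg
  have h := mem_gK1.1 (gH_le_gK1 hg)
  rw [mem_gI, (mem_gH.1 hg).2 2 0 (by decide)]
  exact ⟨h.1, h.2.1, zero_mem_pE _, h.2.2.2⟩

lemma gH_eq : (gH S : Set S.GG) = S.Hset ∩ S.IK1 := by
  ext g
  rw [← gI_eq]
  constructor
  · intro h
    refine ⟨⟨S.mat g 0 0, S.mat g 1 1, S.mat g 2 2, ?_⟩, gH_le_gI h⟩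
    have h2 := (mem_gH.1 h).2
    ext i j
    fin_cases i <;> fin_cases j <;> simp [h2]
  · rintro ⟨⟨a, b, c, e⟩, h⟩
    have h := mem_gI.1 h
    refine mem_gH.2 ⟨?_, ?_⟩
    · rw [e] at h
      rw [mem_gK0, e, forall_three]
      simp at h
      simp [h]
    · intro i j hij
      rw [e]
      fin_cases i <;> fin_cases j <;> simp at hij ⊢

lemma beta_conj_mem_gH {g : S.GG} (hg : g ∈ gH S) : S.betaE * g * S.betaE ∈ gH S := by
  obtain ⟨h1, h2⟩ := mem_gH.1 hg
  refine mem_gH.2 ⟨(gK0 S).mul_mem ((gK0 S).mul_mem betaE_mem h1) betaE_mem, ?_⟩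
  intro i j hij
  rw [beta_conj_apply]
  exact h2 _ _ (by simpa [Fin.rev_inj] using hij)

lemma gH_mul_apply {h g : S.GG} (hh : h ∈ gH S) (i j : Fin 3) :
    S.mat (h * g) i j = S.mat h i i * S.mat g i j := by
  rw [mat_mul, Matrix.mul_apply]
  rw [Finset.sum_eq_single i]
  · intro k _ hk
    rw [(mem_gH.1 hh).2 i k (Ne.symm hk), zero_mul]
  · simp

lemma alpha_conj_gH {h : S.GG} (hh : h ∈ gH S) : S.alphaE * h * S.alphaE⁻¹ = h := by
  apply mat_ext
  ext i j
  rw [alpha_conj_apply]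
  by_cases hij : i = j
  · subst hij; simp
  · rw [(mem_gH.1 hh).2 i j hij, mul_zero]

lemma alpha_comm_gH {h : S.GG} (hh : h ∈ gH S) : S.alphaE * h = h * S.alphaE := by
  have := alpha_conj_gH hh
  rwa [mul_inv_eq_iff_eq_mul] at this

lemma betaPr_conj_gH {h : S.GG} (hh : h ∈ gH S) :
    S.betaPr * h * S.betaPr = S.betaE * h * S.betaE := by
  have h1 := alpha_conj_gH (beta_conj_mem_gH hh)
  rw [← h1, alphaE_eq, mul_inv_rev, betaPr_inv, betaE_inv]
  simp only [mul_assoc]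
  rw [← mul_assoc S.betaE S.betaE, betaE_mul_betaE, one_mul,
    ← mul_assoc S.betaE S.betaE, betaE_mul_betaE, one_mul]

/-- Splitting off an integral diagonal element so that the diagonal becomes pro-`p`. -/
lemma exists_torus {D : Fin 3 → Fin 3 → ℤ} (hD : ∀ i, D i i = 0)
    (h1 : 1 ≤ D 1 2 + D 1 0) (h2 : 1 ≤ D 0 2 + D 2 0) (h3 : 1 ≤ D 2 1 + D 0 1)
    {g : S.GG} (hg : ∀ i j, S.mat g i j ∈ S.pE (D i j)) :
    ∃ h ∈ gH S, ∀ i j, S.mat (h⁻¹ * g) i j - (1 : S.M3) i j ∈ S.pE (if i = j then 1 else D i j) := by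
  have r0 := col_rel g 2 0
  have r1 := col_rel g 1 1
  simp [Fin.rev] at r0 r1
  have g00 : S.mat g 0 0 ∈ S.pE 0 := by simpa [hD] using hg 0 0
  have g11 : S.mat g 1 1 ∈ S.pE 0 := by simpa [hD] using hg 1 1
  have g22 : S.mat g 2 2 ∈ S.pE 0 := by simpa [hD] using hg 2 2
  have e0 : S.mat g 0 0 * S.conj (S.mat g 2 2) - 1 ∈ S.pE 1 := by
    have : S.mat g 0 0 * S.conj (S.mat g 2 2) - 1 =
      -(S.conj (S.mat g 1 2) * S.mat g 1 0 + S.conj (S.mat g 0 2) * S.mat g 2 0) := by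
      linear_combination r0
    rw [this]
    exact neg_mem_pE (add_mem_pE (mul_mem_pE_of_le (conj_mem_pE (hg _ _)) (hg _ _) h1)
      (mul_mem_pE_of_le (conj_mem_pE (hg _ _)) (hg _ _) h2))
  have e1 : S.mat g 1 1 * S.conj (S.mat g 1 1) - 1 ∈ S.pE 1 := by
    have : S.mat g 1 1 * S.conj (S.mat g 1 1) - 1 =
      -(S.conj (S.mat g 2 1) * S.mat g 0 1 + S.conj (S.mat g 0 1) * S.mat g 2 1) := by
      linear_combination r1
    rw [this]
    exact neg_mem_pE (add_mem_pE (mul_mem_pE_of_le (conj_mem_pE (hg _ _)) (hg _ _) h3)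
      (mul_mem_pE_of_le (conj_mem_pE (hg _ _)) (hg _ _) (by omega)))
  have hu := unit_of_mul (conj_mem_pE g22) e0
  have ha := ne_zero_of_notMem hu
  have hai : (S.mat g 0 0)⁻¹ ∈ S.pE 0 := by simpa using inv_mem_of_notMem (k := 0) (by simpa using hu)
  obtain ⟨b, hb, hbO, hb1⟩ : ∃ b : S.E, b * S.conj b = 1 ∧ b ∈ S.pE 0 ∧
      S.conj b * S.mat g 1 1 - 1 ∈ S.pE 1 := by
    set z := S.mat g 1 1 with hz
    by_cases hc : 1 + z ∈ S.pE 1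
    · refine ⟨-1, by simp, neg_mem_pE one_mem_pE, ?_⟩
      have : S.conj (-1) * z - 1 = -(1 + z) := by simp; ring
      rw [this]; exact neg_mem_pE hc
    · have hne := ne_zero_of_notMem hc
      have hne' : 1 + S.conj z ≠ 0 := by
        intro h0
        apply hne
        have := congrArg S.conj h0
        simpa [S.conj_invol] using this
      have hi : (1 + z)⁻¹ ∈ S.pE 0 := by simpa using inv_mem_of_notMem (k := 0) (by simpa using hc)
      have hi' : (1 + S.conj z)⁻¹ ∈ S.pE 0 := by
        have := conj_mem_pE hi
        simpa using this
      refine ⟨(1 + z) * (1 + S.conj z)⁻¹, ?_, ?_, ?_⟩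
      · simp [S.conj_invol]; field_simp
      · simpa using mul_mem_pE (add_mem_pE one_mem_pE g11) hi'
      · have : S.conj ((1 + z) * (1 + S.conj z)⁻¹) * z - 1 = (z * S.conj z - 1) * (1 + z)⁻¹ := by
          simp [S.conj_invol]; field_simp; ring
        rw [this]
        exact mul_mem_pE_of_le e1 hi (by simp)
  obtain ⟨h, hh⟩ := exists_diag _ b ha hb
  have hH : h ∈ gH S := by
    refine mem_gH.2 ⟨?_, ?_⟩
    · rw [mem_gK0, hh, forall_three]
      have := conj_mem_pE hai
      rw [map_inv₀] at this
      simp [zero_mem_pE, *]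
    · intro i j hij
      rw [hh]
      fin_cases i <;> fin_cases j <;> simp at hij ⊢
  refine ⟨h, hH, ?_⟩
  have hH' := (gH S).inv_mem hH
  have hi0 := (mem_gK0.1 (mem_gH.1 hH').1)
  intro i j
  rw [gH_mul_apply hH']
  have off : ∀ i j, i ≠ j → S.mat h⁻¹ i i * S.mat g i j - (1 : S.M3) i j ∈
      S.pE (if i = j then 1 else D i j) := by
    intro i j hij
    rw [if_neg hij, Matrix.one_apply_ne hij, sub_zero]
    exact mul_mem_pE_of_le (hi0 i i) (hg i j) (by simp)
  by_cases hij : i = j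
  · subst hij
    rw [if_pos rfl, Matrix.one_apply_eq, mat_inv_apply, hh]
    fin_cases i <;> simp [Fin.rev]
    · simp [ha, S.conj_invol, zero_mem_pE]
    · exact hb1
    · have := conj_mem_pE e0
      simpa [S.conj_invol] using this
  · exact off i j hij

lemma exists_torus_gI {g : S.GG} (hg : g ∈ gI S) : ∃ h ∈ gH S, ∃ i ∈ gI1 S, g = h * i := by
  rw [gI, mem_conSub_of_nonpos (by decide)] at hg
  obtain ⟨h, hh, hi⟩ := exists_torus (by decide) (by decide) (by decide) (by decide) hg
  refine ⟨h, hh, h⁻¹ * g, fun i j => pE_mono ?_ (hi i j), by simp⟩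
  clear hi; revert i j; decide

lemma exists_torus_gJ {g : S.GG} (hg : g ∈ gJ S) : ∃ h ∈ gH S, ∃ i ∈ gI' S, g = h * i := by
  rw [gJ, mem_conSub_of_nonpos (by decide)] at hg
  obtain ⟨h, hh, hi⟩ := exists_torus (by decide) (by decide) (by decide) (by decide) hg
  refine ⟨h, hh, h⁻¹ * g, fun i j => pE_mono ?_ (hi i j), by simp⟩
  clear hi; revert i j; decide

end Factorization

end Setting

namespace Setting

section Decompositions

variable {S : Setting}

lemma betaPr_mul_apply (g : S.GG) (j : Fin 3) :
    S.mat (S.betaPr * g) 0 j = S.ϖ⁻¹ * S.mat g 2 j ∧ S.mat (S.betaPr * g) 1 j = S.mat g 1 j ∧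
      S.mat (S.betaPr * g) 2 j = S.ϖ * S.mat g 0 j := by
  simp [mat_mul_apply, mat_betaPr, -mat_mul]

lemma mul_betaPr_apply (g : S.GG) (i : Fin 3) :
    S.mat (g * S.betaPr) i 0 = S.mat g i 2 * S.ϖ ∧ S.mat (g * S.betaPr) i 1 = S.mat g i 1 ∧
      S.mat (g * S.betaPr) i 2 = S.mat g i 0 * S.ϖ⁻¹ := by
  simp [mat_mul_apply, mat_betaPr, -mat_mul]

lemma lower_mem_gI' {n : S.GG} {x y : S.E} (hn : S.mat n = S.n'M x y)
    (h : x * S.conj x + y + S.conj y = 0) (hy : y ∈ S.pE 1) : n ∈ gI' S := by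
  have hx : x ∈ S.pE 1 := mem_pE_of_isotropic h (by simpa using hy)
  rw [mem_gI', hn]
  simp [n'M, zero_mem_pE, *, neg_mem_pE (conj_mem_pE hx)]

lemma lower_mem_gK0 {n : S.GG} {x y : S.E} (hn : S.mat n = S.n'M x y)
    (h : x * S.conj x + y + S.conj y = 0) (hy : y ∈ S.pE 0) : n ∈ gK0 S := by
  have hx : x ∈ S.pE 0 := mem_pE_of_isotropic h (pE_mono (by norm_num) hy)
  rw [mem_gK0, hn, forall_three]
  simp [n'M, zero_mem_pE, one_mem_pE, *, neg_mem_pE (conj_mem_pE hx)]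

lemma beta_conj_lower_mem_gN {n : S.GG} {x y : S.E} {k : ℤ} (hn : S.mat n = S.n'M x y)
    (hy : y ∈ S.pE k) : S.betaE * n * S.betaE ∈ gN S k := by
  rw [mem_gN]
  simp only [IsUpper, beta_conj_apply, hn]
  simp [n'M, Fin.rev, hy]

lemma row_ne_zero (g : S.GG) (h : S.mat g 2 2 = 0) : S.mat g 2 0 ≠ 0 := by
  intro h0
  have r := row_rel g 2 2
  have r' := row_rel g 2 0
  rw [h, h0] at r r'
  simp [Fin.rev] at r
  rw [r] at r'
  simp [Fin.rev] at r'

lemma exists_upper_mul_K1 (g : S.GG) : ∃ b : S.GG, ∃ k ∈ gK1 S, IsUpper b ∧ g = b * k := by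
  have key : ∀ g : S.GG, S.mat g 2 2 ≠ 0 → S.mat g 2 0 / S.mat g 2 2 ∈ S.pE 1 →
      ∃ b : S.GG, ∃ k ∈ gK1 S, IsUpper b ∧ g = b * k := by
    intro g hg hy
    obtain ⟨x, y, h, rfl, b, n, hb, hn, e⟩ := exists_upper_mul_lower g hg
    exact ⟨b, n, gI'_le_gK1 (lower_mem_gI' hn h hy), hb, e⟩
  by_cases hc : S.mat g 2 2 ≠ 0 ∧ S.mat g 2 0 / S.mat g 2 2 ∈ S.pE 1
  · exact key g hc.1 hc.2
  obtain ⟨b, k, hk, hb, e⟩ := key (g * S.betaPr) (by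
      rw [(mul_betaPr_apply g 2).2.2]
      refine mul_ne_zero ?_ (inv_ne_zero S.unif_ne)
      intro h0
      by_cases h : S.mat g 2 2 = 0
      · exact row_ne_zero g h h0
      · exact hc ⟨h, by rw [h0, zero_div]; exact zero_mem_pE _⟩) (by
      rw [(mul_betaPr_apply g 2).2.2, (mul_betaPr_apply g 2).1]
      by_cases h : S.mat g 2 2 = 0
      · rw [h, zero_mul, zero_div]; exact zero_mem_pE _
      have h1 : S.mat g 2 0 / S.mat g 2 2 ∉ S.pE (0 + 1) := by
        intro h1; exact hc ⟨h, by simpa using h1⟩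
      have h2 := inv_mem_of_notMem h1
      have := S.unif_ne
      have h3 : S.mat g 2 2 * S.ϖ / (S.mat g 2 0 * S.ϖ⁻¹) =
          S.ϖ ^ (2 : ℤ) * (S.mat g 2 0 / S.mat g 2 2)⁻¹ := by
        rw [inv_div]; norm_cast; field_simp
      rw [h3]
      exact mul_mem_pE_of_le (unif_zpow_mem 2) h2 (by norm_num))
  refine ⟨b, k * S.betaPr, (gK1 S).mul_mem hk betaPr_mem, hb, ?_⟩
  rw [← mul_assoc, ← e, mul_assoc, betaPr_mul_betaPr, mul_one]

lemma exists_upper_mul_K0 (g : S.GG) : ∃ b : S.GG, ∃ k ∈ gK0 S, IsUpper b ∧ g = b * k := by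
  have key : ∀ g : S.GG, S.mat g 2 2 ≠ 0 → S.mat g 2 0 / S.mat g 2 2 ∈ S.pE 0 →
      ∃ b : S.GG, ∃ k ∈ gK0 S, IsUpper b ∧ g = b * k := by
    intro g hg hy
    obtain ⟨x, y, h, rfl, b, n, hb, hn, e⟩ := exists_upper_mul_lower g hg
    exact ⟨b, n, lower_mem_gK0 hn h hy, hb, e⟩
  by_cases hc : S.mat g 2 2 ≠ 0 ∧ S.mat g 2 0 / S.mat g 2 2 ∈ S.pE 0
  · exact key g hc.1 hc.2
  have e0 : S.mat (g * S.betaE) 2 0 = S.mat g 2 2 := mul_beta_apply g 2 0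
  have e2 : S.mat (g * S.betaE) 2 2 = S.mat g 2 0 := mul_beta_apply g 2 2
  obtain ⟨b, k, hk, hb, e⟩ := key (g * S.betaE) (by
      rw [e2]
      intro h0
      by_cases h : S.mat g 2 2 = 0
      · exact row_ne_zero g h h0
      · exact hc ⟨h, by rw [h0, zero_div]; exact zero_mem_pE _⟩) (by
      rw [e0, e2]
      by_cases h : S.mat g 2 2 = 0
      · rw [h, zero_div]; exact zero_mem_pE _
      have h1 : S.mat g 2 0 / S.mat g 2 2 ∉ S.pE (-1 + 1) := by
        intro h1; exact hc ⟨h, by simpa using h1⟩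
      have h2 := inv_mem_of_notMem h1
      rw [inv_div] at h2
      exact pE_mono (by norm_num) h2)
  refine ⟨b, k * S.betaE, (gK0 S).mul_mem hk betaE_mem, hb, ?_⟩
  rw [← mul_assoc, ← e, mul_assoc, betaE_mul_betaE, mul_one]

lemma upper_mem_gI {b : S.GG} (hb : IsUpper b) (hk : b ∈ gK1 S) : b ∈ gI S := by
  rw [mem_gK1] at hk
  rw [mem_gI, hb.2.1]
  exact ⟨hk.1, hk.2.1, zero_mem_pE _, hk.2.2.2⟩

lemma upper_mem_gJ {b : S.GG} (hb : IsUpper b) (hk : b ∈ gK0 S) : b ∈ gJ S := by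
  rw [mem_gK0] at hk
  rw [mem_gJ, hb.1, hb.2.1, hb.2.2]
  simp [hk, zero_mem_pE]

/-- The big cell of `K₁`. -/
lemma exists_big_cell {k : S.GG} (hk : k ∈ gK1 S) (h : S.mat k 0 0 ∉ S.pE 1) :
    ∃ i' ∈ gI' S, ∃ t ∈ gH S, ∃ i ∈ gI1 S, k = i' * t * i := by
  have e : S.mat k⁻¹ 2 2 = S.conj (S.mat k 0 0) := mat_inv_apply k 2 2
  have hne : S.mat k⁻¹ 2 2 ∉ S.pE 1 := by rwa [e, conj_mem_pE_iff]
  obtain ⟨x, y, hxy, hy, b, n, hb, hn, e2⟩ := exists_upper_mul_lower k⁻¹ (ne_zero_of_notMem hne)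
  have hki := (gK1 S).inv_mem hk
  have hy1 : y ∈ S.pE 1 := by
    rw [hy, div_eq_mul_inv]
    have h0 := inv_mem_of_notMem (k := 0) (by simpa using hne)
    exact mul_mem_pE_of_le (mem_gK1.1 hki).2.2.1 h0 (by norm_num)
  have hn' := lower_mem_gI' hn hxy hy1
  have hbK : b ∈ gK1 S := by
    have : b = k⁻¹ * n⁻¹ := by rw [e2]; group
    rw [this]
    exact (gK1 S).mul_mem hki ((gK1 S).inv_mem (gI'_le_gK1 hn'))
  obtain ⟨t, ht, i, hi, e3⟩ := exists_torus_gI ((gI S).inv_mem (upper_mem_gI hb hbK))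
  refine ⟨n⁻¹, (gI' S).inv_mem hn', t, ht, i, hi, ?_⟩
  rw [mul_assoc, ← e3, ← mul_inv_rev, ← e2, inv_inv]

/-- The small cell of `K₁`. -/
lemma exists_small_cell {k : S.GG} (hk : k ∈ gK1 S) (h : S.mat k 0 0 ∈ S.pE 1) :
    ∃ t ∈ gH S, ∃ i ∈ gI1 S, k = S.betaPr * t * i := by
  have hm := mem_gK1.1 ((gK1 S).mul_mem betaPr_mem hk)
  have : S.betaPr * k ∈ gI S := by
    rw [mem_gI]
    refine ⟨hm.1, hm.2.1, ?_, hm.2.2.2⟩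
    rw [(betaPr_mul_apply k 0).2.2]
    exact mul_mem_pE_of_le (by simpa using unif_zpow_mem (S := S) 1) h (by norm_num)
  obtain ⟨t, ht, i, hi, e⟩ := exists_torus_gI this
  refine ⟨t, ht, i, hi, ?_⟩
  rw [mul_assoc, ← e, ← mul_assoc, betaPr_mul_betaPr, one_mul]

lemma gI_column_false {k : S.GG} (hk : k ∈ gK1 S) (h0 : S.mat k 0 0 ∈ S.pE 1)
    (h2 : S.mat k 2 0 ∈ S.pE 2) : False := by
  have r := col_rel k 2 0
  rw [mem_gK1] at hk
  simp [Fin.rev] at r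
  apply one_notMem_pE (S := S)
  rw [← r]
  refine add_mem_pE (add_mem_pE ?_ ?_) ?_
  · exact mul_mem_pE_of_le (conj_mem_pE hk.2.2.2.2) h0 (by norm_num)
  · exact mul_mem_pE_of_le (conj_mem_pE hk.2.1.2.2) hk.2.1.1 (by norm_num)
  · exact mul_mem_pE_of_le (conj_mem_pE hk.1.2.2) h2 (by norm_num)

/-- `I₁ = N_{-1} K₁¹`. -/
lemma exists_gN_mul_gK1one {i : S.GG} (hi : i ∈ gI1 S) :
    ∃ n ∈ gN S (-1), ∃ k ∈ gK1one S, i = n * k := by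
  have hii := (gI1 S).inv_mem hi
  have e : S.mat (S.betaE * i⁻¹ * S.betaE) 2 2 = S.mat i⁻¹ 0 0 := beta_conj_apply _ _ _
  have e' : S.mat (S.betaE * i⁻¹ * S.betaE) 2 0 = S.mat i⁻¹ 0 2 := beta_conj_apply _ _ _
  have hm := mem_gI1.1 hii
  have h00 : S.mat i⁻¹ 0 0 ∉ S.pE 1 := by
    intro hc
    exact one_notMem_pE (by simpa using sub_mem_pE hc hm.1.1)
  obtain ⟨x, y, hxy, hy, b, n, hb, hn, e2⟩ := exists_upper_mul_lower (S.betaE * i⁻¹ * S.betaE)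
    (by rw [e]; exact ne_zero_of_notMem h00)
  rw [e, e', div_eq_mul_inv] at hy
  have hy1 : y ∈ S.pE (-1) := by
    rw [hy]
    exact mul_mem_pE_of_le hm.1.2.2 (inv_mem_of_notMem (k := 0) (by simpa using h00)) (by norm_num)
  set m := S.betaE * n * S.betaE with hmdef
  have hmN : m ∈ gN S (-1) := beta_conj_lower_mem_gN hn hy1
  have e3 : S.betaE * b * S.betaE = i⁻¹ * m⁻¹ := by
    have : b = S.betaE * i⁻¹ * S.betaE * n⁻¹ := by rw [e2]; group
    rw [this, hmdef]
    simp only [mul_inv_rev, betaE_inv, mul_assoc]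
    rw [← mul_assoc S.betaE S.betaE, betaE_mul_betaE, one_mul]
  have hL : i⁻¹ * m⁻¹ ∈ gI1 S :=
    (gI1 S).mul_mem hii ((gI1 S).inv_mem (gN_neg_one_le_gI1 hmN))
  have hL2 : i⁻¹ * m⁻¹ ∈ gK1one S := by
    have h := mem_gI1.1 hL
    rw [mem_gK1one]
    refine ⟨⟨h.1.1, h.1.2.1, ?_⟩, h.2⟩
    rw [← e3, beta_conj_apply]
    have := hb.2.1
    show S.mat b 2 0 ∈ _
    rw [this]; exact zero_mem_pE _
  refine ⟨m⁻¹, (gN S (-1)).inv_mem hmN, (i⁻¹ * m⁻¹)⁻¹, (gK1one S).inv_mem hL2, by group⟩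

/-- For `n ∈ N_{-1} \ N_0`, the element `n β_K` lies in the big cell, with nontrivial
right-hand factor. -/
lemma exists_gN_mul_betaPr {n : S.GG} (hn : n ∈ gN S (-1)) (hn0 : n ∉ gN S 0) :
    ∃ i' ∈ gI' S, ∃ t ∈ gH S, ∃ n2 ∈ gN S (-1), n2 ∉ gN S 0 ∧ ∃ k ∈ gK1one S,
      n * S.betaPr = i' * t * n2 * k := by
  have h00 : S.mat (n * S.betaPr) 0 0 ∉ S.pE 1 := by
    rw [(mul_betaPr_apply n 0).1]
    intro hc
    apply hn0
    rw [mem_gN] at hn ⊢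
    refine ⟨hn.1, hn.2.1, ?_⟩
    have := mul_mem_pE hc (unif_zpow_mem (S := S) (-1))
    rw [mul_assoc, zpow_neg_one, mul_inv_cancel₀ S.unif_ne, mul_one] at this
    exact this
  obtain ⟨i', hi', t, ht, i, hi, e⟩ :=
    exists_big_cell ((gK1 S).mul_mem (gN_neg_one_le_gK1 hn) betaPr_mem) h00
  obtain ⟨n2, hn2, k, hk, rfl⟩ := exists_gN_mul_gK1one hi
  refine ⟨i', hi', t, ht, n2, hn2, ?_, k, hk, by rw [e]; group⟩
  intro hc
  have hJ : n * S.betaPr ∈ gJ S := by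
    rw [e]
    exact (gJ S).mul_mem ((gJ S).mul_mem (gI'_le_gJ hi') (gH_le_gJ ht))
      ((gJ S).mul_mem (gN_zero_le_gJ hc) (gI'_le_gJ (gK1one_le_gI' hk)))
  have h02 := (mem_gJ.1 hJ).1.2.2
  rw [(mul_betaPr_apply n 0).2.2, (mem_gN.1 hn).2.1.1, one_mul] at h02
  have := mul_mem_pE h02 (unif_zpow_mem (S := S) 1)
  rw [zpow_one, inv_mul_cancel₀ S.unif_ne] at this
  exact one_notMem_pE (by simpa using this)

/-- The big cell of `K₀`. -/
lemma exists_big_cell_K0 {k : S.GG} (hk : k ∈ gK0 S) (h : S.mat k 2 0 ∉ S.pE 1) :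
    ∃ u, IsUpper u ∧ u ∈ gJ S ∧ ∃ n ∈ gN S 0, k = u * S.betaE * n := by
  have e : S.mat (k * S.betaE) 2 2 = S.mat k 2 0 := mul_beta_apply k 2 2
  have e' : S.mat (k * S.betaE) 2 0 = S.mat k 2 2 := mul_beta_apply k 2 0
  obtain ⟨x, y, hxy, hy, b, n, hb, hn, e2⟩ := exists_upper_mul_lower (k * S.betaE)
    (by rw [e]; exact ne_zero_of_notMem h)
  rw [e, e', div_eq_mul_inv] at hy
  have hy1 : y ∈ S.pE 0 := by
    rw [hy]
    exact mul_mem_pE_of_le (mem_gK0.1 hk _ _) (inv_mem_of_notMem (k := 0) (by simpa using h))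
      (by norm_num)
  have hbK : b ∈ gK0 S := by
    have : b = k * S.betaE * n⁻¹ := by rw [e2]; group
    rw [this]
    exact (gK0 S).mul_mem ((gK0 S).mul_mem hk betaE_mem)
      ((gK0 S).inv_mem (lower_mem_gK0 hn hxy hy1))
  refine ⟨b, hb, upper_mem_gJ hb hbK, _, beta_conj_lower_mem_gN hn hy1, ?_⟩
  rw [← mul_assoc, ← mul_assoc, mul_assoc b, betaE_mul_betaE, mul_one, ← e2, mul_assoc,
    betaE_mul_betaE, mul_one]

lemma small_cell_K0 {k : S.GG} (hk : k ∈ gK0 S) (h : S.mat k 2 0 ∈ S.pE 1) : k ∈ gJ S := by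
  have r := row_rel k 2 2
  simp [Fin.rev] at r
  have h0 := mem_gK0.1 hk
  have h21 : S.mat k 2 1 ∈ S.pE 1 := by
    apply mem_pE_of_mul_conj
    have : S.mat k 2 1 * S.conj (S.mat k 2 1) =
      -(S.mat k 2 0 * S.conj (S.mat k 2 2) + S.mat k 2 2 * S.conj (S.mat k 2 0)) := by
      linear_combination r
    rw [this]
    exact neg_mem_pE (add_mem_pE (mul_mem_pE_of_le h (conj_mem_pE (h0 _ _)) (by norm_num))
      (mul_mem_pE_of_le (h0 _ _) (conj_mem_pE h) (by norm_num)))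
  have r' := row_rel k 0 2
  have r1 := row_rel k 1 2
  simp [Fin.rev] at r' r1
  have hu : S.mat k 0 0 * S.conj (S.mat k 2 2) - 1 ∈ S.pE 1 := by
    have : S.mat k 0 0 * S.conj (S.mat k 2 2) - 1 =
      -(S.mat k 0 1 * S.conj (S.mat k 2 1) + S.mat k 0 2 * S.conj (S.mat k 2 0)) := by
      linear_combination r'
    rw [this]
    exact neg_mem_pE (add_mem_pE (mul_mem_pE_of_le (h0 _ _) (conj_mem_pE h21) (by norm_num))
      (mul_mem_pE_of_le (h0 _ _) (conj_mem_pE h) (by norm_num)))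
  have h22 : S.conj (S.mat k 2 2) ∉ S.pE 1 :=
    unit_of_mul (h0 0 0) (by rwa [mul_comm])
  have h10 : S.mat k 1 0 ∈ S.pE 1 := by
    have hi := inv_mem_of_notMem (k := 0) (by simpa using h22)
    have hne := ne_zero_of_notMem h22
    have : S.mat k 1 0 = -(S.mat k 1 1 * S.conj (S.mat k 2 1) + S.mat k 1 2 * S.conj (S.mat k 2 0))
        * (S.conj (S.mat k 2 2))⁻¹ := by
      field_simp
      linear_combination r1
    rw [this]
    refine mul_mem_pE_of_le (neg_mem_pE (add_mem_pE (k := 1) ?_ ?_)) hi (by norm_num)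
    · exact mul_mem_pE_of_le (h0 _ _) (conj_mem_pE h21) (by norm_num)
    · exact mul_mem_pE_of_le (h0 _ _) (conj_mem_pE h) (by norm_num)
  rw [mem_gJ]
  simp [*]

end Decompositions

section Representatives

variable {S : Setting}

lemma IsReps.exists {A B : Set S.GG} {U : Finset S.GG} (hU : S.IsReps A B U) {a : S.GG}
    (ha : a ∈ A) : ∃ u ∈ U, a⁻¹ * u ∈ B := by
  obtain ⟨u, ⟨h1, h2⟩, -⟩ := hU.2 a ha
  exact ⟨u, h1, h2⟩

lemma IsReps.mem {A B : Set S.GG} {U : Finset S.GG} (hU : S.IsReps A B U) {u : S.GG}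
    (hu : u ∈ U) : u ∈ A := hU.1 hu

lemma IsReps.eq {A B : Subgroup S.GG} {U : Finset S.GG} (hU : S.IsReps A B U) {u v : S.GG}
    (hu : u ∈ U) (hv : v ∈ U) (h : u⁻¹ * v ∈ B) : u = v :=
  (hU.2 u (hU.mem hu)).unique ⟨hu, by simp⟩ ⟨hv, h⟩

lemma exists_isReps (A B : Subgroup S.GG) {τ : Type*} [Finite τ] (f : S.GG → τ)
    (h : ∀ a ∈ A, ∀ b ∈ A, f a = f b → a⁻¹ * b ∈ B) : ∃ U : Finset S.GG, S.IsReps A B U := by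
  let Q := A ⧸ B.subgroupOf A
  have hinj : Function.Injective fun q : Q => f (q.out : A) := by
    intro q q' e
    have h1 := h _ q.out.2 _ q'.out.2 e
    rw [← q.out_eq, ← q'.out_eq]
    refine QuotientGroup.eq.2 ?_
    rw [Subgroup.mem_subgroupOf]
    exact h1
  have : Finite Q := Finite.of_injective _ hinj
  have := Fintype.ofFinite Q
  refine ⟨Finset.univ.image fun q : Q => ((q.out : A) : S.GG), ?_, ?_⟩
  · intro x hx
    simp only [Finset.coe_image, Set.mem_image] at hx
    obtain ⟨q, -, rfl⟩ := hx
    exact q.out.2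
  · intro a ha
    have key : ∀ q : Q, a⁻¹ * ((q.out : A) : S.GG) ∈ B ↔ (QuotientGroup.mk ⟨a, ha⟩ : Q) = q := by
      intro q
      conv_rhs => rw [← q.out_eq]
      refine Iff.trans ?_ QuotientGroup.eq.symm
      rw [Subgroup.mem_subgroupOf]
      rfl
    refine ⟨_, ⟨Finset.mem_image_of_mem _ (Finset.mem_univ (QuotientGroup.mk ⟨a, ha⟩ : Q)),
      (key _).2 rfl⟩, ?_⟩
    rintro u ⟨hu, hu2⟩
    obtain ⟨q, -, rfl⟩ := Finset.mem_image.1 hu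
    rw [(key q).1 hu2]

lemma IsReps.sum_comp {A B : Subgroup S.GG} {U : Finset S.GG} (hU : S.IsReps A B U)
    {V : Type*} [AddCommMonoid V] (φ : S.GG → S.GG) (hφ : ∀ a ∈ A, φ a ∈ A)
    (hinj : ∀ a ∈ A, ∀ b ∈ A, (φ a)⁻¹ * φ b ∈ B → a⁻¹ * b ∈ B)
    (f : S.GG → V) (hf : ∀ a ∈ A, ∀ b ∈ B, f (a * b) = f a) :
    ∑ u ∈ U, f (φ u) = ∑ u ∈ U, f u := by
  have hr : ∀ u ∈ U, ∃ v ∈ U, (φ u)⁻¹ * v ∈ B := fun u hu => hU.exists (hφ u (hU.mem hu))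
  choose! r hr1 hr2 using hr
  have hrinj : ∀ u ∈ U, ∀ v ∈ U, r u = r v → u = v := by
    intro u hu v hv e
    refine hU.eq hu hv (hinj u (hU.mem hu) v (hU.mem hv) ?_)
    have := B.mul_mem (hr2 u hu) (B.inv_mem (hr2 v hv))
    rw [e] at this
    simpa [mul_assoc] using this
  refine Finset.sum_bij (fun u _ => r u) hr1 (fun u hu v hv => hrinj u hu v hv) ?_ ?_
  · intro b hb
    have himg : U.image r = U := by
      refine Finset.eq_of_subset_of_card_le (Finset.image_subset_iff.2 hr1) ?_
      rw [Finset.card_image_of_injOn fun u hu v hv => hrinj u hu v hv]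
    rw [← himg] at hb
    obtain ⟨u, hu, e⟩ := Finset.mem_image.1 hb
    exact ⟨u, hu, e⟩
  · intro u hu
    have := hf (φ u) (hφ u (hU.mem hu)) _ (hr2 u hu)
    rw [← this]; simp

lemma IsReps.mul {A B D : Subgroup S.GG} (hBA : B ≤ A) {U V : Finset S.GG}
    (hU : S.IsReps A B U) (hV : S.IsReps B D V) (hDB : D ≤ B) :
    S.IsReps A D ((U ×ˢ V).image fun z => z.1 * z.2) ∧
      Set.InjOn (fun z : S.GG × S.GG => z.1 * z.2) (U ×ˢ V : Finset (S.GG × S.GG)) := by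
  have key : ∀ u ∈ U, ∀ v ∈ V, ∀ u' ∈ U, ∀ v' ∈ V, (u * v)⁻¹ * (u' * v') ∈ D →
      u = u' ∧ v = v' := by
    intro u hu v hv u' hu' v' hv' h
    have : u = u' := by
      refine hU.eq hu hu' ?_
      have := B.mul_mem (B.mul_mem (hV.mem hv) (hDB h)) (B.inv_mem (hV.mem hv'))
      simpa [mul_assoc] using this
    subst this
    exact ⟨rfl, hV.eq hv hv' (by simpa [mul_assoc] using h)⟩
  refine ⟨⟨?_, ?_⟩, ?_⟩
  · intro x hx
    obtain ⟨⟨u, v⟩, huv, rfl⟩ := Finset.mem_image.1 hx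
    rw [Finset.mem_product] at huv
    exact A.mul_mem (hU.mem huv.1) (hBA (hV.mem huv.2))
  · intro a ha
    obtain ⟨u, hu, h1⟩ := hU.exists ha
    obtain ⟨v, hv, h2⟩ := hV.exists (B.inv_mem h1)
    refine ⟨u * v, ⟨Finset.mem_image.2 ⟨(u, v), Finset.mem_product.2 ⟨hu, hv⟩, rfl⟩, ?_⟩, ?_⟩
    · simpa [mul_assoc] using h2
    · rintro w ⟨hw, hw2⟩
      obtain ⟨⟨u', v'⟩, huv, rfl⟩ := Finset.mem_image.1 hw
      rw [Finset.mem_product] at huv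
      have h3 : (u * v)⁻¹ * (u' * v') ∈ D := by
        have h4 : (a⁻¹ * (u * v)) ∈ D := by simpa [mul_assoc] using h2
        have := D.mul_mem (D.inv_mem h4) hw2
        simpa [mul_assoc] using this
      obtain ⟨rfl, rfl⟩ := key u hu v hv u' huv.1 v' huv.2 h3
      rfl
  · rintro ⟨u, v⟩ huv ⟨u', v'⟩ huv' e
    simp only [Finset.coe_product, Set.mem_prod, Finset.mem_coe] at huv huv'
    simp only at e
    obtain ⟨rfl, rfl⟩ := key u huv.1 v huv.2 u' huv'.1 v' huv'.2 (by rw [e]; simp [D.one_mem])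
    rfl

lemma exists_isReps_gN_neg_one (S : Setting) :
    ∃ U : Finset S.GG, S.IsReps (gN S (-1)) (gN S 0) U := by
  refine exists_isReps _ _ (fun g => S.res (S.ϖ * S.mat g 0 2)) ?_
  intro a ha b hb e
  have hu : ∀ g ∈ gN S (-1), S.ϖ * S.mat g 0 2 ∈ S.pE 0 := fun g hg =>
    mul_mem_pE_of_le (by simpa using unif_zpow_mem (S := S) 1) (mem_gN.1 hg).2.2 (by norm_num)
  rw [res_eq_iff (hu a ha) (hu b hb), ← mul_sub] at e
  have e2 := mul_mem_pE (unif_zpow_mem (S := S) (-1)) e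
  rw [← mul_assoc, zpow_neg_one, inv_mul_cancel₀ S.unif_ne, one_mul] at e2
  have hab := (gN S (-1)).mul_mem ((gN S (-1)).inv_mem ha) hb
  rw [mem_gN] at hab ⊢
  refine ⟨hab.1, hab.2.1, ?_⟩
  rw [(inv_mul_apply_gN ha hb).2]
  have h1 := (entry_mem_of_gN (k := 0) (by simpa using ha)).1
  have h2 := (entry_mem_of_gN (k := 0) (by simpa using hb)).1
  refine sub_mem_pE ?_ (mul_mem_pE_of_le h1 (sub_mem_pE (conj_mem_pE h1) (conj_mem_pE h2))
    (by norm_num))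
  simpa using neg_mem_pE e2

lemma exists_isReps_gN_zero (S : Setting) :
    ∃ U : Finset S.GG, S.IsReps (gN S 0) (gN S 1) U := by
  refine exists_isReps _ _ (fun g => (S.res (S.mat g 0 1), S.res (S.mat g 0 2))) ?_
  intro a ha b hb e
  have h1 := (entry_mem_of_gN (k := 0) (gN_mono (by norm_num) ha)).1
  have h2 := (entry_mem_of_gN (k := 0) (gN_mono (by norm_num) hb)).1
  simp only [Prod.mk.injEq] at e
  rw [res_eq_iff h1 h2, res_eq_iff (mem_gN.1 ha).2.2 (mem_gN.1 hb).2.2] at e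
  have hab := (gN S 0).mul_mem ((gN S 0).inv_mem ha) hb
  rw [mem_gN] at hab ⊢
  refine ⟨hab.1, hab.2.1, ?_⟩
  rw [(inv_mul_apply_gN ha hb).2, ← map_sub]
  refine sub_mem_pE ?_ (mul_mem_pE_of_le h1 (conj_mem_pE e.1) (by norm_num))
  simpa using neg_mem_pE e.2

/-- The index of `N_{k+1}` in `N_k` is divisible by `p`. -/
lemma IsReps.dvd_card {k : ℤ} {U : Finset S.GG} (hU : S.IsReps (gN S k) (gN S (k + 1)) U) :
    S.p ∣ U.card := by
  obtain ⟨e, he0, he1, he2⟩ := exists_skew (S := S)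
  set z := S.ϖ ^ k * e with hz
  have hzs : z + S.conj z = 0 := by
    rw [hz, map_mul, map_zpow₀, S.unif_conj, ← mul_add, he1, mul_zero]
  obtain ⟨c, hc⟩ := exists_upper 0 z (by linear_combination hzs)
  have hcN : c ∈ gN S k := by
    rw [mem_gN, IsUpper, hc]
    simp [nM, hz]
    simpa using mul_mem_pE (unif_zpow_mem k) he0
  have hc01 : S.mat c 0 1 = 0 := by rw [hc]; simp [nM]
  have hc02 : S.mat c 0 2 = z := by rw [hc]; simp [nM]
  have hcc : ∀ a ∈ gN S k, c * a = a * c := by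
    intro a ha
    obtain ⟨h1, h2⟩ := gN_mul_apply hcN ha
    obtain ⟨h3, h4⟩ := gN_mul_apply ha hcN
    have h5 := (gN S k).mul_mem hcN ha
    have h6 := (gN S k).mul_mem ha hcN
    obtain ⟨x, y, -, -, hxy⟩ := h5
    obtain ⟨x', y', -, -, hxy'⟩ := h6
    rw [hxy] at h1 h2
    rw [hxy'] at h3 h4
    simp [nM, hc01] at h1 h2 h3 h4
    apply mat_ext
    rw [hxy, hxy', h1, h2, h3, h4, add_comm]
  have hpow : ∀ m : ℕ, S.mat (c ^ m) 0 1 = 0 ∧ S.mat (c ^ m) 0 2 = m * z := by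
    intro m
    induction m with
    | zero => simp
    | succ m ih =>
      obtain ⟨h1, h2⟩ := gN_mul_apply ((gN S k).pow_mem hcN m) hcN
      rw [pow_succ, h1, h2, ih.1, ih.2, hc01, hc02]
      refine ⟨by ring, by push_cast; ring⟩
  have hcp : c ^ S.p ∈ gN S (k + 1) := by
    have := (gN S k).pow_mem hcN S.p
    rw [mem_gN] at this ⊢
    refine ⟨this.1, this.2.1, ?_⟩
    rw [(hpow _).2, hz]
    exact mul_mem_pE_of_le p_mem_pE (mul_mem_pE (unif_zpow_mem k) he0) (by omega)
  have hcn : c ∉ gN S (k + 1) := by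
    intro h
    have := (mem_gN.1 h).2.2
    rw [hc02, hz, unif_zpow_mul_mem] at this
    exact he2 (by simpa using this)
  have hex : ∀ u : U, ∃ v : U, (c * u)⁻¹ * v ∈ gN S (k + 1) := by
    rintro ⟨u, hu⟩
    obtain ⟨v, hv, h⟩ := hU.exists ((gN S k).mul_mem hcN (hU.mem hu))
    exact ⟨⟨v, hv⟩, h⟩
  choose r hr using hex
  have hiter : ∀ (m : ℕ) (u : U), (c ^ m * u)⁻¹ * (r^[m] u : U) ∈ gN S (k + 1) := by
    intro m u
    induction m with
    | zero => simp [(gN S (k + 1)).one_mem]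
    | succ m ih =>
      rw [Function.iterate_succ_apply']
      have h1 := hr (r^[m] u)
      have := (gN S (k + 1)).mul_mem ih h1
      have e1 : ((c ^ m * u)⁻¹ * (r^[m] u : S.GG)) * ((c * (r^[m] u))⁻¹ * r (r^[m] u)) =
        (c ^ (m + 1) * u)⁻¹ * r (r^[m] u) := by
        rw [pow_succ']
        group
      rwa [e1] at this
  have hrp : r^[S.p] = id := by
    funext u
    refine Subtype.ext (hU.eq (r^[S.p] u).2 u.2 ?_)
    have h1 := hiter S.p u
    have h2 := hcp
    have hcomm : c ^ S.p * u = u * c ^ S.p := (Commute.pow_left (hcc _ (hU.mem u.2)) _)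
    rw [hcomm] at h1
    have := (gN S (k + 1)).mul_mem h2 h1
    have h3 := (gN S (k + 1)).inv_mem this
    simpa [mul_assoc] using h3
  have hend : ∀ m : ℕ, (show Function.End U from r) ^ m = r^[m] := by
    intro m
    induction m with
    | zero => rfl
    | succ m ih => rw [pow_succ, ih]; rfl
  have := Fact.mk S.hp
  have h1 := Equiv.Perm.card_fixedPoints_modEq (p := S.p) (n := 1)
    (f := (show Function.End U from r)) (by rw [pow_one, hend, hrp]; rfl)
  have h2 : Fintype.card (Function.fixedPoints r) = 0 := by
    rw [Fintype.card_eq_zero_iff]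
    refine ⟨fun ⟨u, hu⟩ => hcn ?_⟩
    have hu' : r u = u := hu
    have h3 := hr u
    rw [hu', hcc _ (hU.mem u.2)] at h3
    have := (gN S (k + 1)).inv_mem h3
    simpa [mul_assoc] using this
  rw [Fintype.card_coe, h2] at h1
  exact (Nat.modEq_zero_iff_dvd).1 h1

end Representatives

end Setting

namespace Setting

variable {S : Setting}

section TorusConj

lemma gH_conj_apply {h : S.GG} (hh : h ∈ gH S) (g : S.GG) (i j : Fin 3) :
    S.mat (h * g * h⁻¹) i j = S.mat h i i * S.mat g i j * S.mat h⁻¹ j j := by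
  have h1 := mem_gH.1 ((gH S).inv_mem hh)
  rw [mat_mul, Matrix.mul_apply, Finset.sum_eq_single j, ← gH_mul_apply hh]
  · intro l _ hl
    rw [h1.2 l j hl, mul_zero]
  · simp

lemma gH_mul_inv_apply {h : S.GG} (hh : h ∈ gH S) (i : Fin 3) :
    S.mat h i i * S.mat h⁻¹ i i = 1 := by
  have := gH_conj_apply hh 1 i i
  simpa using this.symm

lemma gH_entry_mem {h : S.GG} (hh : h ∈ gH S) (i j : Fin 3) : S.mat h i j ∈ S.pE 0 :=
  mem_gK0.1 (mem_gH.1 hh).1 i j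

lemma gH_conj_entry_mem {h : S.GG} (hh : h ∈ gH S) {g : S.GG} {k : ℤ} {i j : Fin 3}
    (hg : S.mat g i j ∈ S.pE k) : S.mat (h * g * h⁻¹) i j ∈ S.pE k := by
  rw [gH_conj_apply hh]
  exact mul_mem_pE_of_le (mul_mem_pE_of_le (gH_entry_mem hh i i) hg (by omega : k ≤ 0 + k))
    (gH_entry_mem ((gH S).inv_mem hh) j j) (by omega)

lemma gH_conj_mem_gN {h : S.GG} (hh : h ∈ gH S) {g : S.GG} {k : ℤ} (hg : g ∈ gN S k) :
    h * g * h⁻¹ ∈ gN S k := by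
  obtain ⟨h1, ⟨h2, h3, h4⟩, h5⟩ := mem_gN.1 hg
  refine mem_gN.2 ⟨?_, ⟨?_, ?_, ?_⟩, gH_conj_entry_mem hh h5⟩
  · obtain ⟨a, b, c⟩ := h1
    refine ⟨?_, ?_, ?_⟩ <;> simp [gH_conj_apply hh, a, b, c]
  all_goals simp [gH_conj_apply hh, h2, h3, h4, gH_mul_inv_apply hh]

lemma gH_conj_mem_gI' {h : S.GG} (hh : h ∈ gH S) {g : S.GG} (hg : g ∈ gI' S) :
    h * g * h⁻¹ ∈ gI' S := by
  have key : ∀ i, S.mat g i i - 1 ∈ S.pE 1 → S.mat (h * g * h⁻¹) i i - 1 ∈ S.pE 1 := by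
    intro i hi
    have e : S.mat (h * g * h⁻¹) i i = S.mat g i i := by
      rw [gH_conj_apply hh]
      linear_combination S.mat g i i * gH_mul_inv_apply hh i
    rw [e]
    exact hi
  obtain ⟨⟨a, b, c⟩, ⟨d, e, f⟩, ⟨k, l, m⟩⟩ := mem_gI'.1 hg
  exact mem_gI'.2 ⟨⟨key 0 a, gH_conj_entry_mem hh b, gH_conj_entry_mem hh c⟩,
    ⟨gH_conj_entry_mem hh d, key 1 e, gH_conj_entry_mem hh f⟩,
    ⟨gH_conj_entry_mem hh k, gH_conj_entry_mem hh l, key 2 m⟩⟩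

end TorusConj

/-- A weight of `K₁` with regular highest weight character, extended arbitrarily to a function
on `G`, together with its projection `j` onto the line of `I_{1,K}`-invariants. -/
structure WeightData (S : Setting) (𝔽 : Type) [Field 𝔽] (W : Type) [AddCommGroup W]
    [Module 𝔽 W] where
  ρ : S.GG → Module.End 𝔽 W
  one : ρ 1 = 1
  mul : ∀ a ∈ gK1 S, ∀ b ∈ gK1 S, ρ (a * b) = ρ a * ρ b
  triv : ∀ a ∈ gK1one S, ρ a = 1
  irr : ∀ P : Submodule 𝔽 W, (∀ k ∈ gK1 S, ∀ w ∈ P, ρ k w ∈ P) → P = ⊥ ∨ P = ⊤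
  v0 : W
  v0_ne : v0 ≠ 0
  v0_inv : ∀ g ∈ gI1 S, ρ g v0 = v0
  χ : S.GG → 𝔽
  v0_eig : ∀ h ∈ gH S, ρ h v0 = χ h • v0
  reg : ∃ h ∈ gH S, χ h ≠ χ (S.betaE * h * S.betaE)
  j : W →ₗ[𝔽] W
  j_inv : ∀ w, (∀ g ∈ gI1 S, ρ g w = w) → j w = w
  j_aug : ∀ w, ∀ g ∈ gI' S, j (ρ g w) = j w
  char : (S.p : 𝔽) = 0

namespace WeightData

variable {𝔽 : Type} [Field 𝔽] {W : Type} [AddCommGroup W] [Module 𝔽 W] (D : WeightData S 𝔽 W)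

lemma mul_apply {a b : S.GG} (ha : a ∈ gK1 S) (hb : b ∈ gK1 S) (w : W) :
    D.ρ (a * b) w = D.ρ a (D.ρ b w) := by
  rw [D.mul a ha b hb]; rfl

lemma one_apply (w : W) : D.ρ 1 w = w := by
  rw [D.one]; rfl

lemma triv_apply {a : S.GG} (ha : a ∈ gK1one S) (w : W) : D.ρ a w = w := by
  rw [D.triv a ha]; rfl

lemma inv_apply {a : S.GG} (ha : a ∈ gK1 S) (w : W) : D.ρ a⁻¹ (D.ρ a w) = w := by
  rw [← D.mul_apply ((gK1 S).inv_mem ha) ha, inv_mul_cancel, D.one_apply]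

lemma apply_eq_zero {a : S.GG} (ha : a ∈ gK1 S) {w : W} (h : D.ρ a w = 0) : w = 0 := by
  rw [← D.inv_apply ha w, h, map_zero]

lemma beta_apply_torus {h : S.GG} (hh : h ∈ gH S) (w : W) :
    D.ρ S.betaPr (D.ρ h w) = D.ρ (S.betaE * h * S.betaE) (D.ρ S.betaPr w) := by
  rw [← D.mul_apply betaPr_mem (gH_le_gK1 hh),
    ← D.mul_apply (gH_le_gK1 (beta_conj_mem_gH hh)) betaPr_mem, ← betaPr_conj_gH hh,
    mul_assoc _ S.betaPr S.betaPr, betaPr_mul_betaPr, mul_one]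

lemma beta_beta (w : W) : D.ρ S.betaPr (D.ρ S.betaPr w) = w := by
  rw [← D.mul_apply betaPr_mem betaPr_mem, betaPr_mul_betaPr, D.one_apply]

/-- `v` is a highest weight vector of weight `ψ`. -/
def IsEig (v : W) (ψ : S.GG → 𝔽) : Prop :=
  (∀ g ∈ gI1 S, D.ρ g v = v) ∧ ∀ h ∈ gH S, D.ρ h v = ψ h • v

lemma isEig_v0 : D.IsEig D.v0 D.χ := ⟨D.v0_inv, D.v0_eig⟩

lemma exists_gN {g : S.GG} (hg : g ∈ gI1 S) : ∃ n ∈ gN S (-1), D.ρ g = D.ρ n := by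
  obtain ⟨n, hn, k, hk, rfl⟩ := exists_gN_mul_gK1one hg
  refine ⟨n, hn, ?_⟩
  rw [D.mul _ (gN_neg_one_le_gK1 hn) _ (gK1one_le_gK1 hk), D.triv k hk, mul_one]

variable {U : Finset S.GG}

/-- The averaging operator over `N ∩ K` modulo `N ∩ K¹`. -/
def avg (U : Finset S.GG) : Module.End 𝔽 W := ∑ u ∈ U, D.ρ u

lemma avg_apply (U : Finset S.GG) (w : W) : D.avg U w = ∑ u ∈ U, D.ρ u w := by
  simp [avg]


section Average

lemma rho_mul_triv {a b : S.GG} (ha : a ∈ gN S (-1)) (hb : b ∈ gN S 0) (w : W) :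
    D.ρ (a * b) w = D.ρ a w := by
  rw [D.mul_apply (gN_neg_one_le_gK1 ha) (gN_neg_one_le_gK1 (gN_zero_le hb)),
    D.triv_apply (gN_zero_le_gK1one hb)]

lemma apply_avg (hU : S.IsReps (gN S (-1)) (gN S 0) U) {g : S.GG} (hg : g ∈ gI1 S) (w : W) :
    D.ρ g (D.avg U w) = D.avg U w := by
  obtain ⟨n, hn, e⟩ := D.exists_gN hg
  rw [e, avg_apply, map_sum, ← hU.sum_comp (fun u => n * u) (fun a ha => (gN S _).mul_mem hn ha)
    (fun a _ b _ h => by simpa [mul_assoc] using h) (fun u => D.ρ u w)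
    (fun a ha b hb => D.rho_mul_triv ha hb w)]
  exact Finset.sum_congr rfl fun u hu =>
    (D.mul_apply (gN_neg_one_le_gK1 hn) (gN_neg_one_le_gK1 (hU.mem hu)) w).symm

lemma avg_apply_gI1 (hU : S.IsReps (gN S (-1)) (gN S 0) U) {g : S.GG} (hg : g ∈ gI1 S) (w : W) :
    D.avg U (D.ρ g w) = D.avg U w := by
  obtain ⟨n, hn, e⟩ := D.exists_gN hg
  rw [e, avg_apply, avg_apply, ← hU.sum_comp (fun u => u * n) (fun a ha => (gN S _).mul_mem ha hn)
    (fun a _ b _ h => ?_) (fun u => D.ρ u w) (fun a ha b hb => D.rho_mul_triv ha hb w)]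
  · exact Finset.sum_congr rfl fun u hu =>
      (D.mul_apply (gN_neg_one_le_gK1 (hU.mem hu)) (gN_neg_one_le_gK1 hn) w).symm
  · have := conj_mem_gN_zero hn h
    simpa [mul_assoc] using this

lemma avg_torus (hU : S.IsReps (gN S (-1)) (gN S 0) U) {h : S.GG} (hh : h ∈ gH S) (w : W) :
    D.ρ h (D.avg U w) = D.avg U (D.ρ h w) := by
  have hh' := (gH S).inv_mem hh
  rw [avg_apply, avg_apply, map_sum, ← hU.sum_comp (fun u => h * u * h⁻¹)
    (fun a ha => gH_conj_mem_gN hh ha) (fun a _ b _ hab => ?_) (fun u => D.ρ u (D.ρ h w))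
    (fun a ha b hb => D.rho_mul_triv ha hb _)]
  · refine Finset.sum_congr rfl fun u hu => ?_
    have h1 := gN_neg_one_le_gK1 (hU.mem hu)
    rw [← D.mul_apply (gN_neg_one_le_gK1 (gH_conj_mem_gN hh (hU.mem hu))) (gH_le_gK1 hh),
      ← D.mul_apply (gH_le_gK1 hh) h1]
    simp
  · have := gH_conj_mem_gN hh' hab
    simpa [mul_assoc] using this

lemma avg_eq_zero (hU : S.IsReps (gN S (-1)) (gN S 0) U) {v : W}
    (hv : ∀ g ∈ gI1 S, D.ρ g v = v) : D.avg U v = 0 := by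
  have h1 : (U.card : 𝔽) = 0 := by
    have : S.p ∣ U.card := IsReps.dvd_card (k := -1) hU
    obtain ⟨m, hm⟩ := this
    rw [hm, Nat.cast_mul, D.char, zero_mul]
  rw [avg_apply, Finset.sum_congr rfl fun u hu => hv u (gN_neg_one_le_gI1 (hU.mem hu)),
    Finset.sum_const, ← Nat.cast_smul_eq_nsmul 𝔽, h1, zero_smul]

/-- The action of `n β_K` on a highest weight vector, up to the opposite unipotent. -/
lemma exists_rho_mul_beta {v : W} {ψ : S.GG → 𝔽} (hv : D.IsEig v ψ) {n : S.GG}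
    (hn : n ∈ gN S (-1)) (hn0 : n ∉ gN S 0) :
    ∃ i' ∈ gI' S, ∃ c : 𝔽, D.ρ n (D.ρ S.betaPr v) = c • D.ρ i' v := by
  obtain ⟨i', hi', t, ht, n2, hn2, -, k, hk, e⟩ := exists_gN_mul_betaPr hn hn0
  refine ⟨i', hi', ψ t, ?_⟩
  have hi := gI'_le_gK1 hi'
  have ht' := gH_le_gK1 ht
  rw [← D.mul_apply (gN_neg_one_le_gK1 hn) betaPr_mem, e,
    D.mul_apply ((gK1 S).mul_mem ((gK1 S).mul_mem hi ht') (gN_neg_one_le_gK1 hn2))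
      (gK1one_le_gK1 hk), D.triv_apply hk,
    D.mul_apply ((gK1 S).mul_mem hi ht') (gN_neg_one_le_gK1 hn2), hv.1 n2 (gN_neg_one_le_gI1 hn2),
    D.mul_apply hi ht', hv.2 t ht, map_smul]

lemma IsEig.avg_beta (hU : S.IsReps (gN S (-1)) (gN S 0) U) {v : W} {ψ : S.GG → 𝔽}
    (hv : D.IsEig v ψ) :
    D.IsEig (D.avg U (D.ρ S.betaPr v)) fun h => ψ (S.betaE * h * S.betaE) := by
  refine ⟨fun g hg => D.apply_avg hU hg _, fun h hh => ?_⟩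
  have h1 := D.beta_apply_torus (beta_conj_mem_gH hh) v
  have e : S.betaE * (S.betaE * h * S.betaE) * S.betaE = h := by
    simp only [mul_assoc, betaE_mul_betaE, mul_one]
    rw [← mul_assoc, betaE_mul_betaE, one_mul]
  rw [e, hv.2 _ (beta_conj_mem_gH hh), map_smul] at h1
  rw [D.avg_torus hU hh, ← h1, map_smul]

lemma exists_avg_avg (hU : S.IsReps (gN S (-1)) (gN S 0) U) {v : W} {ψ : S.GG → 𝔽}
    (hv : D.IsEig v ψ) : ∃ c : 𝔽, D.avg U (D.ρ S.betaPr (D.avg U (D.ρ S.betaPr v))) =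
      c • D.avg U (D.ρ S.betaPr v) := by
  suffices h : ∀ u ∈ U, ∃ c : 𝔽, D.avg U (D.ρ S.betaPr (D.ρ u (D.ρ S.betaPr v))) =
      c • D.avg U (D.ρ S.betaPr v) by
    choose! c hc using h
    refine ⟨∑ u ∈ U, c u, ?_⟩
    rw [D.avg_apply U (D.ρ S.betaPr v), map_sum, map_sum, Finset.sum_smul]
    rw [D.avg_apply U (D.ρ S.betaPr v)] at hc
    exact Finset.sum_congr rfl hc
  intro u hu
  by_cases h0 : u ∈ gN S 0
  · refine ⟨0, ?_⟩
    rw [D.triv_apply (gN_zero_le_gK1one h0), D.beta_beta, D.avg_eq_zero hU hv.1, zero_smul]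
  · obtain ⟨i', hi', c, e⟩ := D.exists_rho_mul_beta hv (hU.mem hu) h0
    refine ⟨c, ?_⟩
    have h2 : D.ρ S.betaPr (D.ρ i' v) =
        D.ρ (S.betaPr * i' * S.betaPr) (D.ρ S.betaPr v) := by
      rw [← D.mul_apply betaPr_mem (gI'_le_gK1 hi'),
        ← D.mul_apply (gI1_le_gK1 (betaPr_conj_mem_gI1 hi')) betaPr_mem,
        mul_assoc _ S.betaPr S.betaPr, betaPr_mul_betaPr, mul_one]
    rw [e, map_smul, map_smul, h2, D.avg_apply_gI1 hU (betaPr_conj_mem_gI1 hi')]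

lemma avg_avg_eq_zero (hU : S.IsReps (gN S (-1)) (gN S 0) U) {v : W} {ψ : S.GG → 𝔽}
    (hv : D.IsEig v ψ) (hψ : ∃ h ∈ gH S, ψ h ≠ ψ (S.betaE * h * S.betaE)) :
    D.avg U (D.ρ S.betaPr (D.avg U (D.ρ S.betaPr v))) = 0 := by
  obtain ⟨c, hc⟩ := D.exists_avg_avg hU hv
  obtain ⟨h, hh, hne⟩ := hψ
  have h1 := (IsEig.avg_beta D hU hv).2 h hh
  have h2 := (IsEig.avg_beta D hU (IsEig.avg_beta D hU hv)).2 h hh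
  have e : S.betaE * (S.betaE * h * S.betaE) * S.betaE = h := by
    simp only [mul_assoc, betaE_mul_betaE, mul_one]
    rw [← mul_assoc, betaE_mul_betaE, one_mul]
  simp only [e] at h2
  rw [hc, map_smul, h1, smul_comm, ← hc, ← sub_eq_zero, ← sub_smul, smul_eq_zero] at h2
  exact h2.resolve_left (sub_ne_zero.2 hne.symm)

end Average

section Projection

lemma eq_top_of_aug (hU : S.IsReps (gN S (-1)) (gN S 0) U) {v : W} {ψ : S.GG → 𝔽}
    (hv : D.IsEig v ψ) (hv0 : v ≠ 0) (hz : D.avg U (D.ρ S.betaPr v) = 0)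
    {P : Submodule 𝔽 W} (hvP : v ∈ P) (hP : ∀ w, ∀ g ∈ gI' S, D.ρ g w - w ∈ P) : P = ⊤ := by
  have hP' : ∀ w ∈ P, ∀ g ∈ gI' S, D.ρ g w ∈ P := fun w hw g hg => by
    simpa using P.add_mem (hP w g hg) hw
  have hβ : D.ρ S.betaPr v ∈ P := by
    obtain ⟨u, hu, hu0⟩ := hU.exists (gN S (-1)).one_mem
    rw [inv_one, one_mul] at hu0
    rw [avg_apply, ← Finset.add_sum_erase _ _ hu, D.triv_apply (gN_zero_le_gK1one hu0)] at hz
    rw [eq_neg_of_add_eq_zero_left hz]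
    refine P.neg_mem (P.sum_mem fun u' hu' => ?_)
    have hu'U := Finset.mem_of_mem_erase hu'
    obtain ⟨i', hi', c, e⟩ := D.exists_rho_mul_beta hv (hU.mem hu'U) (fun h =>
      Finset.ne_of_mem_erase hu' (hU.eq hu'U hu ((gN S 0).mul_mem ((gN S 0).inv_mem h) hu0)))
    rw [e]
    exact P.smul_mem _ (hP' v hvP i' hi')
  have hk : ∀ k ∈ gK1 S, D.ρ k v ∈ P := by
    intro k hk
    by_cases h : S.mat k 0 0 ∈ S.pE 1
    · obtain ⟨t, ht, i, hi, rfl⟩ := exists_small_cell hk h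
      rw [D.mul_apply ((gK1 S).mul_mem betaPr_mem (gH_le_gK1 ht)) (gI1_le_gK1 hi), hv.1 i hi,
        D.mul_apply betaPr_mem (gH_le_gK1 ht), hv.2 t ht, map_smul]
      exact P.smul_mem _ hβ
    · obtain ⟨i', hi', t, ht, i, hi, rfl⟩ := exists_big_cell hk h
      rw [D.mul_apply ((gK1 S).mul_mem (gI'_le_gK1 hi') (gH_le_gK1 ht)) (gI1_le_gK1 hi), hv.1 i hi,
        D.mul_apply (gI'_le_gK1 hi') (gH_le_gK1 ht), hv.2 t ht, map_smul]
      exact P.smul_mem _ (hP' v hvP i' hi')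
  let Q : Submodule 𝔽 W := Submodule.span 𝔽 {w | ∃ k ∈ gK1 S, w = D.ρ k v}
  have hQ : ∀ k ∈ gK1 S, ∀ w ∈ Q, D.ρ k w ∈ Q := by
    intro k hk w hw
    induction hw using Submodule.span_induction with
    | mem x hx =>
      obtain ⟨k', hk', rfl⟩ := hx
      rw [← D.mul_apply hk hk']
      exact Submodule.subset_span ⟨_, (gK1 S).mul_mem hk hk', rfl⟩
    | zero => simp
    | add x y _ _ hx hy => rw [map_add]; exact Q.add_mem hx hy
    | smul a x _ hx => rw [map_smul]; exact Q.smul_mem a hx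
  have hvQ : v ∈ Q := Submodule.subset_span ⟨1, (gK1 S).one_mem, (D.one_apply v).symm⟩
  have hQP : Q ≤ P := Submodule.span_le.2 (by rintro _ ⟨k, hk', rfl⟩; exact hk k hk')
  rcases D.irr Q hQ with h | h
  · rw [h, Submodule.mem_bot] at hvQ
    exact absurd hvQ hv0
  · rw [h] at hQP
    exact top_le_iff.1 hQP

lemma exists_j_eq (hU : S.IsReps (gN S (-1)) (gN S 0) U) {v : W} {ψ : S.GG → 𝔽}
    (hv : D.IsEig v ψ) (hv0 : v ≠ 0) (hz : D.avg U (D.ρ S.betaPr v) = 0) (w : W) :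
    ∃ c : 𝔽, c • v = D.j w := by
  have := D.eq_top_of_aug hU hv hv0 hz (P := (Submodule.span 𝔽 {v}).comap D.j)
    (by rw [Submodule.mem_comap, D.j_inv v hv.1]; exact Submodule.mem_span_singleton_self v)
    (fun w g hg => by rw [Submodule.mem_comap, map_sub, D.j_aug w g hg, sub_self]; simp)
  have hw : w ∈ (Submodule.span 𝔽 {v}).comap D.j := this ▸ Submodule.mem_top
  exact Submodule.mem_span_singleton.1 hw

lemma j_v0 : D.j D.v0 = D.v0 := D.j_inv _ D.v0_inv

lemma eq_zero_of_smul {h : S.GG} (hne : D.χ h ≠ D.χ (S.betaE * h * S.betaE)) {w : W}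
    (h1 : D.χ h • w = D.χ (S.betaE * h * S.betaE) • w) : w = 0 := by
  rw [← sub_eq_zero, ← sub_smul, smul_eq_zero] at h1
  exact h1.resolve_left (sub_ne_zero.2 hne)

lemma avg_beta_v0 (hU : S.IsReps (gN S (-1)) (gN S 0) U) : D.avg U (D.ρ S.betaPr D.v0) = 0 := by
  by_contra hne
  have h1 := IsEig.avg_beta D hU D.isEig_v0
  obtain ⟨c, hc⟩ := D.exists_j_eq hU h1 hne (D.avg_avg_eq_zero hU D.isEig_v0 D.reg) D.v0
  rw [D.j_v0] at hc
  obtain ⟨h, hh, hχ⟩ := D.reg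
  refine D.v0_ne (D.eq_zero_of_smul hχ ?_)
  conv_lhs => rw [← D.v0_eig h hh, ← hc, map_smul, h1.2 h hh]
  rw [smul_comm, hc]

lemma ker_eq_top {V : Type*} [AddCommGroup V] [Module 𝔽 V] (L : W →ₗ[𝔽] V)
    (h0 : L D.v0 = 0) (hL : ∀ w, ∀ g ∈ gI' S, L (D.ρ g w) = L w) (w : W) : L w = 0 := by
  obtain ⟨U, hU⟩ := exists_isReps_gN_neg_one S
  have := D.eq_top_of_aug hU D.isEig_v0 D.v0_ne (D.avg_beta_v0 hU) (P := LinearMap.ker L) h0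
    (fun w g hg => by rw [LinearMap.mem_ker, map_sub, hL w g hg, sub_self])
  exact LinearMap.mem_ker.1 (this ▸ Submodule.mem_top)

lemma exists_smul_v0 (w : W) : ∃ c : 𝔽, c • D.v0 = D.j w := by
  obtain ⟨U, hU⟩ := exists_isReps_gN_neg_one S
  exact D.exists_j_eq hU D.isEig_v0 D.v0_ne (D.avg_beta_v0 hU) w

lemma j_torus {h : S.GG} (hh : h ∈ gH S) (w : W) : D.j (D.ρ h w) = D.χ h • D.j w := by
  have := D.ker_eq_top (D.j ∘ₗ D.ρ h - D.χ h • D.j) (by simp [D.v0_eig h hh])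
    (fun w g hg => ?_) w
  · simpa [sub_eq_zero] using this
  · simp only [LinearMap.sub_apply, LinearMap.comp_apply, LinearMap.smul_apply, D.j_aug w g hg]
    congr 1
    have e : D.ρ h (D.ρ g w) = D.ρ (h * g * h⁻¹) (D.ρ h w) := by
      rw [← D.mul_apply (gH_le_gK1 hh) (gI'_le_gK1 hg),
        ← D.mul_apply (gI'_le_gK1 (gH_conj_mem_gI' hh hg)) (gH_le_gK1 hh)]
      simp
    rw [e, D.j_aug _ _ (gH_conj_mem_gI' hh hg)]

/-- The functional `w ↦ ∑ j (u⁻¹ β_K w)`. -/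
def coavg (U : Finset S.GG) : W →ₗ[𝔽] W := ∑ u ∈ U, D.j ∘ₗ D.ρ u⁻¹ ∘ₗ D.ρ S.betaPr

lemma coavg_apply (U : Finset S.GG) (w : W) :
    D.coavg U w = ∑ u ∈ U, D.j (D.ρ u⁻¹ (D.ρ S.betaPr w)) := by
  simp [coavg]

lemma rho_inv_mul_triv {a b : S.GG} (ha : a ∈ gN S (-1)) (hb : b ∈ gN S 0) (w : W) :
    D.ρ (a * b)⁻¹ w = D.ρ a⁻¹ w := by
  rw [mul_inv_rev, D.mul_apply ((gK1 S).inv_mem (gN_neg_one_le_gK1 (gN_zero_le hb)))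
    ((gK1 S).inv_mem (gN_neg_one_le_gK1 ha)),
    D.triv_apply ((gK1one S).inv_mem (gN_zero_le_gK1one hb))]

lemma coavg_eq_zero (hU : S.IsReps (gN S (-1)) (gN S 0) U) (w : W) : D.coavg U w = 0 := by
  refine D.ker_eq_top (D.coavg U) ?_ ?_ w
  · obtain ⟨h, hh, hχ⟩ := D.reg
    refine D.eq_zero_of_smul hχ ?_
    have hh' := beta_conj_mem_gH hh
    have h1 : D.coavg U (D.ρ h D.v0) = D.χ (S.betaE * h * S.betaE) • D.coavg U D.v0 := by
      set t := S.betaE * h * S.betaE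
      have ht' := (gH S).inv_mem hh'
      rw [coavg_apply, coavg_apply, ← hU.sum_comp (fun u => t⁻¹ * u * t)
        (fun a ha => by simpa using gH_conj_mem_gN ht' ha)
        (fun a _ b _ hab => ?_) (fun u => D.j (D.ρ u⁻¹ (D.ρ S.betaPr D.v0)))
        (fun a ha b hb => by rw [D.rho_inv_mul_triv ha hb]), Finset.smul_sum]
      · refine Finset.sum_congr rfl fun u hu => ?_
        have hu1 := (gK1 S).inv_mem (gN_neg_one_le_gK1 (hU.mem hu))
        have hu2 : t⁻¹ * u⁻¹ * t ∈ gK1 S :=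
          (gK1 S).mul_mem ((gK1 S).mul_mem (gH_le_gK1 ht') hu1) (gH_le_gK1 hh')
        rw [D.beta_apply_torus hh, ← D.j_torus hh',
          ← D.mul_apply hu1 (gH_le_gK1 hh'), show (t⁻¹ * u * t)⁻¹ = t⁻¹ * u⁻¹ * t by group,
          ← D.mul_apply (gH_le_gK1 hh') hu2]
        simp [mul_assoc]
      · have := gH_conj_mem_gN hh' hab
        simpa [mul_assoc] using this
    rw [← h1, D.v0_eig h hh, map_smul]
  · intro w g hg
    have hg1 := betaPr_conj_mem_gI1 hg
    have e : D.ρ S.betaPr (D.ρ g w) = D.ρ (S.betaPr * g * S.betaPr) (D.ρ S.betaPr w) := by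
      rw [← D.mul_apply betaPr_mem (gI'_le_gK1 hg), ← D.mul_apply (gI1_le_gK1 hg1) betaPr_mem,
        mul_assoc _ S.betaPr S.betaPr, betaPr_mul_betaPr, mul_one]
    obtain ⟨n, hn, en⟩ := D.exists_gN hg1
    rw [coavg_apply, coavg_apply, e, en, ← hU.sum_comp (fun u => n⁻¹ * u)
      (fun a ha => (gN S _).mul_mem ((gN S _).inv_mem hn) ha)
      (fun a _ b _ hab => by simpa [mul_assoc] using hab)
      (fun u => D.j (D.ρ u⁻¹ (D.ρ S.betaPr w)))
      (fun a ha b hb => by rw [D.rho_inv_mul_triv ha hb])]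
    refine Finset.sum_congr rfl fun u hu => ?_
    rw [← D.mul_apply ((gK1 S).inv_mem (gN_neg_one_le_gK1 (hU.mem hu))) (gN_neg_one_le_gK1 hn)]
    simp

lemma exists_j_rho_mul_beta {n : S.GG} (hn : n ∈ gN S (-1)) (hn0 : n ∉ gN S 0) :
    ∃ n2 ∈ gN S (-1), n2 ∉ gN S 0 ∧ ∃ c : 𝔽, ∀ w,
      D.j (D.ρ n (D.ρ S.betaPr w)) = c • D.j (D.ρ n2 w) := by
  obtain ⟨i', hi', t, ht, n2, hn2, hn20, k, hk, e⟩ := exists_gN_mul_betaPr hn hn0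
  refine ⟨n2, hn2, hn20, D.χ t, fun w => ?_⟩
  have hi := gI'_le_gK1 hi'
  have ht' := gH_le_gK1 ht
  have hn2' := gN_neg_one_le_gK1 hn2
  rw [← D.mul_apply (gN_neg_one_le_gK1 hn) betaPr_mem, e,
    D.mul_apply ((gK1 S).mul_mem ((gK1 S).mul_mem hi ht') hn2')
      (gK1one_le_gK1 hk), D.triv_apply hk,
    D.mul_apply ((gK1 S).mul_mem hi ht') hn2', D.mul_apply hi ht', D.j_aug _ _ hi', D.j_torus ht]

lemma j_beta_eq_zero {y : W} (hy : ∀ n ∈ gN S (-1), D.j (D.ρ n y) = 0) :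
    D.j (D.ρ S.betaPr y) = 0 := by
  obtain ⟨U, hU⟩ := exists_isReps_gN_neg_one S
  have h1 := D.coavg_eq_zero hU y
  obtain ⟨u, hu, hu0⟩ := hU.exists (gN S (-1)).one_mem
  rw [inv_one, one_mul] at hu0
  rw [coavg_apply, Finset.sum_eq_single_of_mem u hu,
    D.triv_apply ((gK1one S).inv_mem (gN_zero_le_gK1one hu0))] at h1
  · exact h1
  · intro v hv hvu
    have hv0 : v⁻¹ ∉ gN S 0 := fun h => hvu (hU.eq hv hu ((gN S 0).mul_mem h hu0))
    obtain ⟨n2, hn2, -, c, hc⟩ := D.exists_j_rho_mul_beta ((gN S _).inv_mem (hU.mem hv)) hv0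
    rw [hc, hy n2 hn2, smul_zero]

lemma eq_zero_of_j {y : W} (hy : ∀ n ∈ gN S (-1), D.j (D.ρ n y) = 0) : y = 0 := by
  have hk : ∀ k ∈ gK1 S, D.j (D.ρ k y) = 0 := by
    intro k hk
    by_cases h : S.mat k 0 0 ∈ S.pE 1
    · obtain ⟨t, ht, i, hi, rfl⟩ := exists_small_cell hk h
      obtain ⟨n, hn, e⟩ := D.exists_gN hi
      rw [D.mul_apply ((gK1 S).mul_mem betaPr_mem (gH_le_gK1 ht)) (gI1_le_gK1 hi),
        D.mul_apply betaPr_mem (gH_le_gK1 ht), D.beta_apply_torus ht,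
        D.j_torus (beta_conj_mem_gH ht), e, D.j_beta_eq_zero, smul_zero]
      intro n' hn'
      rw [← D.mul_apply (gN_neg_one_le_gK1 hn') (gN_neg_one_le_gK1 hn)]
      exact hy _ ((gN S _).mul_mem hn' hn)
    · obtain ⟨i', hi', t, ht, i, hi, rfl⟩ := exists_big_cell hk h
      obtain ⟨n, hn, e⟩ := D.exists_gN hi
      rw [D.mul_apply ((gK1 S).mul_mem (gI'_le_gK1 hi') (gH_le_gK1 ht)) (gI1_le_gK1 hi),
        D.mul_apply (gI'_le_gK1 hi') (gH_le_gK1 ht), D.j_aug _ _ hi', D.j_torus ht, e, hy n hn,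
        smul_zero]
  let Q : Submodule 𝔽 W := ⨅ k : gK1 S, LinearMap.ker (D.j ∘ₗ D.ρ k)
  have hQ : ∀ w, w ∈ Q ↔ ∀ k ∈ gK1 S, D.j (D.ρ k w) = 0 := by
    intro w
    simp [Q, Submodule.mem_iInf]
  rcases D.irr Q (fun k hk w hw => (hQ _).2 fun k' hk' => by
    rw [← D.mul_apply hk' hk]; exact (hQ w).1 hw _ ((gK1 S).mul_mem hk' hk)) with h | h
  · exact (Submodule.mem_bot 𝔽).1 (h ▸ (hQ y).2 hk)
  · have h1 := (hQ D.v0).1 (h ▸ Submodule.mem_top) 1 (gK1 S).one_mem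
    rw [D.one_apply, D.j_v0] at h1
    exact absurd h1 D.v0_ne

lemma not_exists_delta {y : W} (h0 : ∀ n ∈ gN S 0, D.j (D.ρ n y) = D.v0)
    (h1 : ∀ n ∈ gN S (-1), n ∉ gN S 0 → D.j (D.ρ n y) = 0) : False := by
  have hh : ∀ h ∈ gH S, D.ρ h y = D.χ h • y := by
    intro h hh
    rw [← sub_eq_zero]
    refine D.eq_zero_of_j fun n hn => ?_
    have hm : h⁻¹ * n * h ∈ gN S (-1) := by
      simpa using gH_conj_mem_gN ((gH S).inv_mem hh) hn
    have e : D.ρ n (D.ρ h y) = D.ρ h (D.ρ (h⁻¹ * n * h) y) := by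
      rw [← D.mul_apply (gN_neg_one_le_gK1 hn) (gH_le_gK1 hh),
        ← D.mul_apply (gH_le_gK1 hh) (gN_neg_one_le_gK1 hm)]
      simp [mul_assoc]
    have hiff : h⁻¹ * n * h ∈ gN S 0 ↔ n ∈ gN S 0 :=
      ⟨fun h2 => by simpa [mul_assoc] using gH_conj_mem_gN hh h2,
        fun h2 => by simpa using gH_conj_mem_gN ((gH S).inv_mem hh) h2⟩
    rw [map_sub, map_sub, e, D.j_torus hh, map_smul, map_smul, sub_eq_zero]
    by_cases hn0 : n ∈ gN S 0
    · rw [h0 n hn0, h0 _ (hiff.2 hn0)]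
    · rw [h1 n hn hn0, h1 _ hm (fun h2 => hn0 (hiff.1 h2))]
  have hβ : D.j (D.ρ S.betaPr y) = 0 := by
    obtain ⟨h, hh', hχ⟩ := D.reg
    refine D.eq_zero_of_smul hχ ?_
    rw [← D.j_torus (beta_conj_mem_gH hh'), ← D.beta_apply_torus hh', hh h hh', map_smul, map_smul]
  have hy : D.ρ S.betaPr y = 0 := by
    refine D.eq_zero_of_j fun n hn => ?_
    by_cases hn0 : n ∈ gN S 0
    · rw [D.triv_apply (gN_zero_le_gK1one hn0), hβ]
    · obtain ⟨n2, hn2, hn20, c, hc⟩ := D.exists_j_rho_mul_beta hn hn0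
      rw [hc, h1 n2 hn2 hn20, smul_zero]
  have h2 := h0 1 (gN S 0).one_mem
  rw [D.apply_eq_zero betaPr_mem hy, map_zero, map_zero] at h2
  exact D.v0_ne h2.symm

end Projection

end WeightData

end Setting

namespace Setting

variable {S : Setting}

section Factorizations

lemma IsUpper.mul_apply_two {a b : S.GG} (ha : IsUpper a) (j : Fin 3) :
    S.mat (a * b) 2 j = S.mat a 2 2 * S.mat b 2 j := by
  obtain ⟨-, h1, h2⟩ := ha
  rw [mat_mul_apply, h1, h2]
  ring

lemma upper_mem_gJ_of_conj {x : S.GG} (hx : IsUpper x)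
    (h : S.alphaE * x * S.alphaE⁻¹ ∈ gK1 S) : x ∈ gJ S := by
  obtain ⟨⟨a, b, c⟩, ⟨-, e, f⟩, ⟨-, -, m⟩⟩ := mem_gK1conj.1 (alpha_conj_mem_gK1.1 h)
  obtain ⟨h1, h2, h3⟩ := hx
  have key : ∀ y : S.E, y ∈ S.pE 1 → y ∈ S.pE 0 := fun y hy => pE_mono (by omega) hy
  exact mem_gJ.2 ⟨⟨a, key _ b, key _ c⟩, ⟨by rw [h1]; exact zero_mem_pE _, e, key _ f⟩,
    ⟨by rw [h2]; exact zero_mem_pE _, by rw [h3]; exact zero_mem_pE _, m⟩⟩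

lemma gI_row_false {k : S.GG} (hk : k ∈ gK1 S) (h0 : S.mat k 2 2 ∈ S.pE 1)
    (h2 : S.mat k 2 0 ∈ S.pE 2) : False := by
  refine gI_column_false ((gK1 S).inv_mem hk) ?_ ?_
  · rw [mat_inv_apply]; exact conj_mem_pE h0
  · rw [mat_inv_apply]; exact conj_mem_pE h2

lemma exists_gH_mul_gN_zero {u : S.GG} (hu : IsUpper u) (hJ : u ∈ gJ S) :
    ∃ h ∈ gH S, ∃ n ∈ gN S 0, u = h * n := by
  obtain ⟨⟨a, b, c⟩, ⟨-, e, f⟩, ⟨-, -, m⟩⟩ := mem_gJ.1 hJ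
  obtain ⟨h1, h2, h3⟩ := hu
  have r1 := col_rel u 1 1
  have r2 := col_rel u 0 2
  simp [h1, h2, h3] at r1 r2
  have ha : S.conj (S.mat u 0 0) ≠ 0 := left_ne_zero_of_mul_eq_one r2
  obtain ⟨h, hh⟩ := exists_diag (S.mat u 0 0) (S.mat u 1 1) (fun h0 => ha (by rw [h0, map_zero]))
    (by rw [mul_comm]; exact r1)
  have hc : (S.conj (S.mat u 0 0))⁻¹ = S.mat u 2 2 := (eq_inv_of_mul_eq_one_right r2).symm
  rw [hc] at hh
  have hH : h ∈ gH S := by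
    refine mem_gH.2 ⟨mem_gK0.2 (forall_three.2 ?_), fun i j hij => ?_⟩
    · simp [hh, a, e, m, zero_mem_pE]
    · rw [hh]
      fin_cases i <;> fin_cases j <;> first | exact absurd rfl hij | rfl
  have hH' := (gH S).inv_mem hH
  have hi : ∀ i, S.mat h⁻¹ i i * S.mat u i i = 1 := by
    intro i
    have h4 := gH_mul_inv_apply hH i
    have h5 : S.mat h i i = S.mat u i i := by
      rw [hh]; fin_cases i <;> rfl
    rw [← h5, mul_comm, h4]
  refine ⟨h, hH, h⁻¹ * u, mem_gN.2 ⟨⟨?_, ?_, ?_⟩, ⟨?_, ?_, ?_⟩, ?_⟩, by simp⟩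
  · rw [gH_mul_apply hH', h1, mul_zero]
  · rw [gH_mul_apply hH', h2, mul_zero]
  · rw [gH_mul_apply hH', h3, mul_zero]
  · rw [gH_mul_apply hH', hi]
  · rw [gH_mul_apply hH', hi]
  · rw [gH_mul_apply hH', hi]
  · rw [gH_mul_apply hH']
    exact mul_mem_pE_of_le (gH_entry_mem hH' 0 0) c (by omega)

lemma exists_alpha_mul {b : S.GG} (hb : b ∈ gI' S) :
    ∃ i ∈ gI1 S, ∃ n ∈ gN S 0, S.alphaE * b = i * S.alphaE * n := by
  have hb' := (gI' S).inv_mem hb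
  obtain ⟨⟨a, -, -⟩, ⟨-, -, -⟩, ⟨k, l, m⟩⟩ := mem_gI'.1 hb'
  have h22 : S.mat b⁻¹ 2 2 ∉ S.pE 1 := fun h => one_notMem_pE (by
    simpa using sub_mem_pE h m)
  have h0 := ne_zero_of_notMem h22
  obtain ⟨x, y, hxy, hy, u, n', hu, hn', e⟩ := exists_upper_mul_lower b⁻¹ h0
  have hy1 : y ∈ S.pE 1 := by
    rw [hy, div_eq_mul_inv]
    exact mul_mem_pE_of_le k (inv_mem_of_notMem (k := 0) h22) (by omega)
  have hx1 : x ∈ S.pE 1 := mem_pE_of_isotropic (k := 1) hxy hy1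
  have hl := lower_mem_gI' hn' hxy hy1
  have hu' : u ∈ gI' S := by
    have : u = b⁻¹ * n'⁻¹ := by rw [e]; group
    rw [this]
    exact (gI' S).mul_mem hb' ((gI' S).inv_mem hl)
  obtain ⟨h, hh, n, hn, rfl⟩ := exists_gH_mul_gN_zero hu (gI'_le_gJ hu')
  have hhI : h ∈ gI1 S := by
    have h1 : h ∈ gI' S := by
      have := (gI' S).mul_mem hu' ((gI' S).inv_mem (gK1one_le_gI' (gN_zero_le_gK1one hn)))
      simpa using this
    obtain ⟨⟨a, -, -⟩, ⟨-, b, -⟩, ⟨-, -, c⟩⟩ := mem_gI'.1 h1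
    have hz := (mem_gH.1 hh).2
    refine mem_gI1.2 ⟨⟨a, ?_, ?_⟩, ⟨?_, b, ?_⟩, ⟨?_, ?_, c⟩⟩ <;>
    · rw [hz _ _ (by decide)]; exact zero_mem_pE _
  have hlI : S.alphaE * n' * S.alphaE⁻¹ ∈ gI1 S := by
    refine mem_gI1.2 ?_
    simp only [alpha_conj_apply, hn', n'M, wt]
    simp [zero_mem_pE, -zpow_natCast]
    refine ⟨mul_mem_pE_of_le (by simpa using unif_zpow_mem 1) hx1 (by omega), ?_,
      neg_mem_pE (mul_mem_pE_of_le (by simpa using unif_zpow_mem 1) (conj_mem_pE hx1) (by omega))⟩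
    exact mul_mem_pE_of_le (by simpa using unif_zpow_mem 2) hy1 (by omega)
  refine ⟨(S.alphaE * n' * S.alphaE⁻¹)⁻¹ * h⁻¹,
    (gI1 S).mul_mem ((gI1 S).inv_mem hlI) ((gI1 S).inv_mem hhI), h * n⁻¹ * h⁻¹,
    gH_conj_mem_gN hh ((gN S 0).inv_mem hn), ?_⟩
  have e2 : b = (h * n * n')⁻¹ := by rw [← e, inv_inv]
  have e3 := alpha_comm_gH ((gH S).inv_mem hh)
  rw [mul_assoc _ h⁻¹, ← e3, e2]
  group

lemma gN_zero_sub_of_conj {a b : S.GG} (ha : a ∈ gN S (-1)) (hb : b ∈ gN S 0)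
    (h : S.alphaE * (a * b⁻¹) * S.alphaE⁻¹ ∈ gK1 S) : a ∈ gN S 0 := by
  have h1 := (gN S (-1)).mul_mem ha ((gN S (-1)).inv_mem (gN_zero_le hb))
  have h2 := gN_one_le ((gN_one_iff h1).2 (alpha_conj_mem_gK1.1 h))
  simpa using (gN S 0).mul_mem h2 hb

end Factorizations

/-- If a nonzero function lies in a sum of subspaces `p i`, and functions in `p i'` vanish on
`low i` whenever `i'` has level at most that of `i`, then it agrees on some `low i` with a nonzero
member of `p i`. -/
lemma exists_eq_on_of_mem_iSup {𝔽 W ι X : Type*} [Field 𝔽] [AddCommGroup W] [Module 𝔽 W]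
    (p : ι → Submodule 𝔽 (X → W)) (lev : ι → ℤ) (low : ι → Set X)
    (hlow : ∀ i i', i ≠ i' → lev i' ≤ lev i → ∀ f ∈ p i', ∀ g ∈ low i, f g = 0)
    {x : X → W} (hx : x ∈ ⨆ i, p i) (hx0 : x ≠ 0) :
    ∃ i, ∃ f ∈ p i, f ≠ 0 ∧ ∀ g ∈ low i, x g = f g := by
  obtain ⟨f, hf, hsum⟩ := (Submodule.mem_iSup_iff_exists_finsupp p x).1 hx
  have hne : f.support.Nonempty := by
    rw [Finset.nonempty_iff_ne_empty]
    rintro h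
    rw [Finsupp.support_eq_empty] at h
    exact hx0 (by rw [← hsum, h]; simp)
  obtain ⟨i, hi, hmax⟩ := Finset.exists_max_image f.support lev hne
  refine ⟨i, f i, hf i, Finsupp.mem_support_iff.1 hi, fun g hg => ?_⟩
  rw [← hsum, Finsupp.sum, Finset.sum_apply, Finset.sum_eq_single_of_mem i hi]
  intro i' hi' hne'
  exact hlow i i' hne'.symm (hmax i' hi') _ (hf i') g hg

end Setting

namespace Setting

section Sections

variable {S : Setting}

lemma IsUpper.inv_mul_apply {a b : S.GG} (ha : IsUpper a) :
    S.mat (a⁻¹ * b) 2 2 = (S.mat a 2 2)⁻¹ * S.mat b 2 2 ∧ S.mat a 2 2 ≠ 0 := by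
  have h1 : S.mat a⁻¹ 2 2 * S.mat a 2 2 = 1 := by
    rw [← IsUpper.mul_apply_two ha.inv, inv_mul_cancel]; simp
  exact ⟨by rw [IsUpper.mul_apply_two ha.inv, eq_inv_of_mul_eq_one_left h1],
    right_ne_zero_of_mul_eq_one h1⟩

/-- Upper triangular coset representatives for a subgroup `L` satisfying an Iwasawa
decomposition, with a level measuring the valuation of the lower right entry. -/
lemma exists_upper_section (L : Subgroup S.GG)
    (hL : ∀ g : S.GG, ∃ b : S.GG, ∃ k ∈ L, IsUpper b ∧ g = b * k) :
    ∃ (b : S.GG ⧸ L → S.GG) (lev : S.GG ⧸ L → ℤ),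
      (∀ z, IsUpper (b z)) ∧ (∀ z, (b z : S.GG ⧸ L) = z) ∧ b ((1 : S.GG) : S.GG ⧸ L) = 1 ∧
      ∀ z z', lev z' ≤ lev z → S.mat ((b z)⁻¹ * b z') 2 2 ∈ S.pE 0 := by
  have h : ∀ z : S.GG ⧸ L, ∃ b : S.GG, IsUpper b ∧ (b : S.GG ⧸ L) = z ∧
      (z = ((1 : S.GG) : S.GG ⧸ L) → b = 1) := by
    intro z
    by_cases hz : z = ((1 : S.GG) : S.GG ⧸ L)
    · exact ⟨1, by simp [IsUpper], hz.symm, fun _ => rfl⟩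
    · obtain ⟨g, rfl⟩ := QuotientGroup.mk_surjective z
      obtain ⟨b, k, hk, hb, e⟩ := hL g
      exact ⟨b, hb, QuotientGroup.eq.2 (by rw [e]; simpa using hk), fun h => absurd h hz⟩
  choose b hb1 hb2 hb3 using h
  have h : ∀ z, ∃ n : ℤ, S.mat (b z) 2 2 ∈ S.pE n ∧ (S.mat (b z) 2 2)⁻¹ ∈ S.pE (-n) :=
    fun z => exists_val (IsUpper.inv_mul_apply (b := 1) (hb1 z)).2
  choose n hn1 hn2 using h
  refine ⟨b, fun z => -n z, hb1, hb2, hb3 _ rfl, fun z z' hl => ?_⟩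
  rw [(IsUpper.inv_mul_apply (hb1 z)).1]
  exact mul_mem_pE_of_le (hn2 z) (hn1 z') (by have : -n z' ≤ -n z := hl; omega)

lemma alpha_mul_betaE : S.alphaE * S.betaE = S.betaPr := by
  rw [alphaE_eq, mul_assoc, betaE_mul_betaE, mul_one]

/-- The rows of `α y β_K n α⁻¹` rule out membership in `K₁`. -/
lemma conj_betaPr_false {y n : S.GG} (hy : IsUpper y) (hy0 : S.mat y 2 2 ∈ S.pE 0)
    (hn : n ∈ gN S 0) (h : S.alphaE * (y * S.betaPr * n) * S.alphaE⁻¹ ∈ gK1 S) : False := by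
  have h2 := mem_gN.1 hn
  have e : ∀ j, S.mat (y * S.betaPr * n) 2 j = S.mat y 2 2 * (S.ϖ * S.mat n 0 j) := fun j => by
    rw [mul_assoc, IsUpper.mul_apply_two hy, (betaPr_mul_apply n j).2.2]
  have hϖ : S.ϖ ∈ S.pE 1 := by simpa using unif_zpow_mem (S := S) 1
  refine gI_row_false h ?_ ?_
  · rw [alpha_conj_apply, e]
    simp only [sub_self, zpow_zero, one_mul]
    exact mul_mem_pE_of_le hy0 (mul_mem_pE_of_le hϖ h2.2.2 le_rfl) (by omega)
  · rw [alpha_conj_apply, e, unif_zpow_mul_mem, h2.2.1.1, mul_one]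
    exact mul_mem_pE_of_le hy0 hϖ (by simp [wt])

end Sections

namespace WeightData

variable {S : Setting} {𝔽 : Type} [Field 𝔽] {W : Type} [AddCommGroup W] [Module 𝔽 W]

section Functions

/-- Right translation of functions on `G`. -/
def rt (𝔽 : Type) [Field 𝔽] (W : Type) [AddCommGroup W] [Module 𝔽 W] (g : S.GG) :
    (S.GG → W) →ₗ[𝔽] (S.GG → W) := LinearMap.funLeft 𝔽 W (· * g)

lemma rt_apply (g : S.GG) (f : S.GG → W) (x : S.GG) : rt 𝔽 W g f x = f (x * g) := rfl

lemma rt_rt (g h : S.GG) (f : S.GG → W) : rt 𝔽 W g (rt 𝔽 W h f) = rt 𝔽 W (g * h) f := by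
  ext x; simp only [rt_apply, mul_assoc]

lemma rt_one (f : S.GG → W) : rt 𝔽 W (1 : S.GG) f = f := by
  ext x; simp only [rt_apply, mul_one]

variable (D : WeightData S 𝔽 W)

/-- Left `K₁`-equivariant functions. -/
def equi : Submodule 𝔽 (S.GG → W) where
  carrier := {f | ∀ k ∈ gK1 S, ∀ g, f (k * g) = D.ρ k (f g)}
  add_mem' := fun hf hg k hk x => by simp [hf k hk x, hg k hk x]
  zero_mem' := fun k hk x => by simp
  smul_mem' := fun c f hf k hk x => by simp [hf k hk x]

variable {D} in
lemma rt_mem_equi {f : S.GG → W} (hf : f ∈ D.equi) (g : S.GG) : rt 𝔽 W g f ∈ D.equi :=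
  fun k hk x => by rw [rt_apply, mul_assoc]; exact hf k hk _

/-- The standard function `[g, v]`. -/
def std (g : S.GG) : W →ₗ[𝔽] (S.GG → W) where
  toFun v x := if x * g ∈ gK1 S then D.ρ (x * g) v else 0
  map_add' v w := by ext x; by_cases h : x * g ∈ gK1 S <;> simp [h]
  map_smul' c v := by ext x; by_cases h : x * g ∈ gK1 S <;> simp [h]

lemma std_apply (g : S.GG) (v : W) (x : S.GG) :
    D.std g v x = if x * g ∈ gK1 S then D.ρ (x * g) v else 0 := rfl

lemma std_mem_equi (g : S.GG) (v : W) : D.std g v ∈ D.equi := by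
  intro k hk x
  rw [std_apply, std_apply, mul_assoc]
  by_cases h : x * g ∈ gK1 S
  · rw [if_pos h, if_pos ((gK1 S).mul_mem hk h), D.mul_apply hk h]
  · rw [if_neg h, if_neg (fun h' => h (((gK1 S).mul_mem_cancel_left hk).1 h')), map_zero]

lemma rt_std (g h : S.GG) (v : W) : rt 𝔽 W g (D.std h v) = D.std (g * h) v := by
  ext x; simp only [rt_apply, std_apply, mul_assoc]

lemma std_mul {k : S.GG} (g : S.GG) (hk : k ∈ gK1 S) (v : W) :
    D.std (g * k) v = D.std g (D.ρ k v) := by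
  ext x
  rw [std_apply, std_apply, ← mul_assoc]
  by_cases h : x * g ∈ gK1 S
  · rw [if_pos h, if_pos ((gK1 S).mul_mem h hk), D.mul_apply h hk]
  · rw [if_neg h, if_neg (fun h' => h (((gK1 S).mul_mem_cancel_right hk).1 h'))]

/-- The kernel `∑ [u α⁻¹, v]` over `u ∈ U`. -/
def ker0 (U : Finset S.GG) : W →ₗ[𝔽] (S.GG → W) := ∑ u ∈ U, D.std (u * S.alphaE⁻¹)

lemma ker0_apply (U : Finset S.GG) (v : W) :
    D.ker0 U v = ∑ u ∈ U, D.std (u * S.alphaE⁻¹) v := by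
  simp [ker0]

lemma ker0_mem_equi (U : Finset S.GG) (v : W) : D.ker0 U v ∈ D.equi := by
  rw [ker0_apply]
  exact Submodule.sum_mem _ fun u _ => D.std_mem_equi _ _

/-- The Hecke operator on standard functions at the identity. -/
def hecke (Ua U : Finset S.GG) : W →ₗ[𝔽] (S.GG → W) :=
  ∑ u ∈ Ua, rt 𝔽 W u ∘ₗ D.ker0 U ∘ₗ D.j ∘ₗ D.ρ u⁻¹ +
    rt 𝔽 W S.betaPr ∘ₗ D.ker0 U ∘ₗ D.j ∘ₗ D.ρ S.betaPr

lemma hecke_apply (Ua U : Finset S.GG) (w : W) :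
    D.hecke Ua U w = ∑ u ∈ Ua, rt 𝔽 W u (D.ker0 U (D.j (D.ρ u⁻¹ w))) +
      rt 𝔽 W S.betaPr (D.ker0 U (D.j (D.ρ S.betaPr w))) := by
  simp [hecke]

lemma hecke_mem_equi (Ua U : Finset S.GG) (w : W) : D.hecke Ua U w ∈ D.equi := by
  rw [hecke_apply]
  exact D.equi.add_mem (Submodule.sum_mem _ fun u _ => rt_mem_equi (D.ker0_mem_equi _ _) _)
    (rt_mem_equi (D.ker0_mem_equi _ _) _)

end Functions

section Kernel

variable (D : WeightData S 𝔽 W) {Ua U : Finset S.GG}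

lemma ker0_support (hU : S.IsReps (gN S 0) (gN S 1) U) {v : W} {x : S.GG}
    (h : D.ker0 U v x ≠ 0) : ∃ κ ∈ gK1 S, ∃ n ∈ gN S 0, x = κ * S.alphaE * n := by
  rw [ker0_apply, Finset.sum_apply] at h
  obtain ⟨u, hu, h⟩ := Finset.exists_ne_zero_of_sum_ne_zero h
  rw [std_apply] at h
  have h1 : x * (u * S.alphaE⁻¹) ∈ gK1 S := by
    by_contra h'
    exact h (if_neg h')
  exact ⟨_, h1, u⁻¹, (gN S 0).inv_mem (hU.mem hu), by group⟩

lemma ker0_alpha_gN (hU : S.IsReps (gN S 0) (gN S 1) U) {n : S.GG} (hn : n ∈ gN S 0) :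
    D.ker0 U D.v0 (S.alphaE * n) = D.v0 := by
  obtain ⟨u0, hu0, h0⟩ := hU.exists ((gN S 0).inv_mem hn)
  rw [inv_inv] at h0
  have e : ∀ u, S.alphaE * n * (u * S.alphaE⁻¹) = S.alphaE * (n * u) * S.alphaE⁻¹ := fun u => by
    group
  rw [ker0_apply, Finset.sum_apply, Finset.sum_eq_single u0]
  · have h1 := alpha_conj_gN_one h0
    rw [std_apply, e, if_pos (gN_neg_one_le_gK1 h1), D.v0_inv _ (gN_neg_one_le_gI1 h1)]
  · intro u hu hne
    rw [std_apply, e]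
    refine if_neg fun h => hne ?_
    have h1 := (gN_one_iff (gN_zero_le ((gN S 0).mul_mem hn (hU.mem hu)))).2
      (alpha_conj_mem_gK1.1 h)
    refine hU.eq hu hu0 ?_
    have := (gN S 1).mul_mem ((gN S 1).inv_mem h1) h0
    simpa [mul_assoc] using this
  · exact fun h => absurd hu0 h

lemma ker0_alpha_gI' (hU : S.IsReps (gN S 0) (gN S 1) U) {b : S.GG} (hb : b ∈ gI' S) :
    D.ker0 U D.v0 (S.alphaE * b) = D.v0 := by
  obtain ⟨i, hi, n, hn, e⟩ := exists_alpha_mul hb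
  rw [e, mul_assoc, D.ker0_mem_equi _ _ i (gI1_le_gK1 hi), D.ker0_alpha_gN hU hn, D.v0_inv i hi]

lemma hecke_alpha_support (hUa : S.IsReps (gN S (-1)) (gN S 0) Ua)
    (hU : S.IsReps (gN S 0) (gN S 1) U) {w : W} {y : S.GG} (hy : IsUpper y)
    (hy0 : S.mat y 2 2 ∈ S.pE 0) (h : D.hecke Ua U w (S.alphaE * y) ≠ 0) : y ∈ gK1 S := by
  by_contra hyK
  refine h ?_
  rw [hecke_apply, Pi.add_apply, Finset.sum_apply]
  refine add_eq_zero_iff_eq_neg.2 ?_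
  rw [Finset.sum_eq_zero, eq_comm, neg_eq_zero, rt_apply]
  · by_contra h1
    obtain ⟨κ, hκ, n, hn, e⟩ := D.ker0_support hU h1
    refine conj_betaPr_false hy hy0 ((gN S 0).inv_mem hn) ?_
    have : S.alphaE * (y * S.betaPr * n⁻¹) * S.alphaE⁻¹ = κ := by
      rw [show S.alphaE * (y * S.betaPr * n⁻¹) * S.alphaE⁻¹ =
        (S.alphaE * y * S.betaPr) * n⁻¹ * S.alphaE⁻¹ by group, e]
      group
    rwa [this]
  · intro u hu
    rw [rt_apply]
    by_contra h1
    obtain ⟨κ, hκ, n, hn, e⟩ := D.ker0_support hU h1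
    have e1 : S.alphaE * (y * u * n⁻¹) * S.alphaE⁻¹ = κ := by
      rw [show S.alphaE * (y * u * n⁻¹) * S.alphaE⁻¹ =
        (S.alphaE * y * u) * n⁻¹ * S.alphaE⁻¹ by group, e]
      group
    have hu' := hUa.mem hu
    have h2 := gJ_le_gK1 (upper_mem_gJ_of_conj
      ((hy.mul (isUpper_of_gN hu')).mul (isUpper_of_gN hn).inv) (e1 ▸ hκ))
    refine hyK ?_
    have h3 := (gK1 S).mul_mem h2 (gN_neg_one_le_gK1 (gN_zero_le hn))
    have h4 := (gK1 S).mul_mem h3 ((gK1 S).inv_mem (gN_neg_one_le_gK1 hu'))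
    simpa [mul_assoc] using h4

lemma hecke_alpha_gN (hUa : S.IsReps (gN S (-1)) (gN S 0) Ua)
    (hU : S.IsReps (gN S 0) (gN S 1) U) (w : W) {n : S.GG} (hn : n ∈ gN S (-1)) :
    D.hecke Ua U w (S.alphaE * n) = D.j (D.ρ n w) := by
  have hβ : rt 𝔽 W S.betaPr (D.ker0 U (D.j (D.ρ S.betaPr w))) (S.alphaE * n) = 0 := by
    rw [rt_apply]
    by_contra h1
    obtain ⟨κ, hκ, m, hm, e⟩ := D.ker0_support hU h1
    refine conj_betaPr_false (y := n) (isUpper_of_gN hn) ?_ ((gN S 0).inv_mem hm) ?_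
    · rw [(mem_gN.1 hn).2.1.2.2]; exact one_mem_pE
    · have : S.alphaE * (n * S.betaPr * m⁻¹) * S.alphaE⁻¹ = κ := by
        rw [show S.alphaE * (n * S.betaPr * m⁻¹) * S.alphaE⁻¹ =
          (S.alphaE * n * S.betaPr) * m⁻¹ * S.alphaE⁻¹ by group, e]
        group
      rwa [this]
  obtain ⟨u0, hu0, h0⟩ := hUa.exists ((gN S (-1)).inv_mem hn)
  rw [inv_inv] at h0
  rw [hecke_apply, Pi.add_apply, hβ, add_zero, Finset.sum_apply, Finset.sum_eq_single u0]
  · obtain ⟨c, hc⟩ := D.exists_smul_v0 (D.ρ u0⁻¹ w)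
    rw [rt_apply, ← hc, map_smul, Pi.smul_apply, mul_assoc, D.ker0_alpha_gN hU h0, hc]
    have e : n = (n * u0) * u0⁻¹ := by group
    conv_rhs => rw [e, D.mul_apply (gK1one_le_gK1 (gN_zero_le_gK1one h0))
      ((gK1 S).inv_mem (gN_neg_one_le_gK1 (hUa.mem hu0))), D.triv_apply (gN_zero_le_gK1one h0)]
  · intro u hu hne
    rw [rt_apply]
    by_contra h1
    obtain ⟨κ, hκ, m, hm, e⟩ := D.ker0_support hU h1
    have e1 : S.alphaE * (n * u * m⁻¹) * S.alphaE⁻¹ = κ := by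
      rw [show S.alphaE * (n * u * m⁻¹) * S.alphaE⁻¹ =
        (S.alphaE * n * u) * m⁻¹ * S.alphaE⁻¹ by group, e]
      group
    have h2 := gN_zero_sub_of_conj ((gN S (-1)).mul_mem hn (hUa.mem hu)) hm (e1 ▸ hκ)
    refine hne (hUa.eq hu hu0 ?_)
    have := (gN S 0).mul_mem ((gN S 0).inv_mem h2) h0
    simpa [mul_assoc] using this
  · exact fun h => absurd hu0 h

/-- The function `∑ [u α⁻¹, v₀]` is not in the image of the Hecke operator. -/
lemma ker0_notMem (hUa : S.IsReps (gN S (-1)) (gN S 0) Ua)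
    (hU : S.IsReps (gN S 0) (gN S 1) U) {b : S.GG ⧸ gK1 S → S.GG} {lev : S.GG ⧸ gK1 S → ℤ}
    (hb : ∀ z, IsUpper (b z)) (hbz : ∀ z, (b z : S.GG ⧸ gK1 S) = z)
    (hb1 : b ((1 : S.GG) : S.GG ⧸ gK1 S) = 1)
    (hlev : ∀ z z', lev z' ≤ lev z → S.mat ((b z)⁻¹ * b z') 2 2 ∈ S.pE 0) :
    D.ker0 U D.v0 ∉ ⨆ z, (LinearMap.range (D.hecke Ua U)).map (rt 𝔽 W (b z)) := by
  intro hmem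
  have hne : D.ker0 U D.v0 ≠ 0 := by
    intro h
    have := D.ker0_alpha_gN hU (gN S 0).one_mem
    rw [h] at this
    exact D.v0_ne this.symm
  have hvan : ∀ i i', i ≠ i' → lev i' ≤ lev i →
      ∀ f ∈ (LinearMap.range (D.hecke Ua U)).map (rt 𝔽 W (b i')),
      ∀ g ∈ {x | ∃ κ ∈ gK1 S, ∃ m ∈ gK1 S, IsUpper m ∧ x = κ * S.alphaE * m * (b i)⁻¹},
      f g = 0 := by
    rintro i i' hne hl _ ⟨_, ⟨w, rfl⟩, rfl⟩ _ ⟨κ, hκ, m, hm, hmu, rfl⟩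
    have e : κ * S.alphaE * m * (b i)⁻¹ * b i' =
        κ * (S.alphaE * (m * ((b i)⁻¹ * b i'))) := by group
    rw [rt_apply, e, D.hecke_mem_equi _ _ _ κ hκ]
    by_contra h1
    have h2 := D.hecke_alpha_support hUa hU (hmu.mul ((hb i).inv.mul (hb i'))) (by
      rw [IsUpper.mul_apply_two hmu]
      exact mul_mem_pE_of_le (mem_gK1.1 hm).2.2.2.2 (hlev i i' hl) (by omega))
      (fun h0 => h1 (by rw [h0, map_zero]))
    refine hne ?_
    rw [← hbz i, ← hbz i']
    exact QuotientGroup.eq.2 (((gK1 S).mul_mem_cancel_left hm).1 h2)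
  obtain ⟨z, f, hf, hf0, hlow⟩ := exists_eq_on_of_mem_iSup _ lev _ hvan hmem hne
  obtain ⟨_, ⟨w, rfl⟩, rfl⟩ := hf
  have hw : w ≠ 0 := by
    rintro rfl
    exact hf0 (by simp)
  have hval : ∀ n ∈ gN S (-1), D.ker0 U D.v0 (S.alphaE * n * (b z)⁻¹) = D.j (D.ρ n w) := by
    intro n hn
    rw [hlow _ ⟨1, (gK1 S).one_mem, n, gN_neg_one_le_gK1 hn, isUpper_of_gN hn, by group⟩,
      rt_apply, inv_mul_cancel_right, D.hecke_alpha_gN hUa hU w hn]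
  have hbz1 : b z = 1 := by
    by_contra hbne
    refine hw (D.eq_zero_of_j fun n hn => ?_)
    rw [← hval n hn]
    by_contra h1
    obtain ⟨κ, hκ, m, hm, e⟩ := D.ker0_support hU h1
    have e1 : S.alphaE * (n * (b z)⁻¹ * m⁻¹) * S.alphaE⁻¹ = κ := by
      rw [show S.alphaE * (n * (b z)⁻¹ * m⁻¹) * S.alphaE⁻¹ =
        (S.alphaE * n * (b z)⁻¹) * m⁻¹ * S.alphaE⁻¹ by group, e]
      group
    have h2 := gJ_le_gK1 (upper_mem_gJ_of_conj
      (((isUpper_of_gN hn).mul (hb z).inv).mul (isUpper_of_gN hm).inv) (e1 ▸ hκ))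
    have h3 := (gK1 S).mul_mem h2 (gN_neg_one_le_gK1 (gN_zero_le hm))
    rw [inv_mul_cancel_right] at h3
    have h4 := ((gK1 S).mul_mem_cancel_left (gN_neg_one_le_gK1 hn)).1 h3
    refine hbne ?_
    rw [← hbz z, QuotientGroup.eq.2 (show (b z)⁻¹ * 1 ∈ gK1 S by rwa [mul_one]), hb1]
  simp only [hbz1, inv_one, mul_one] at hval
  refine D.not_exists_delta (y := w) (fun n hn => ?_) fun n hn hn0 => ?_
  · rw [← hval n (gN_zero_le hn), D.ker0_alpha_gN hU hn]
  · rw [← hval n hn]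
    by_contra h1
    obtain ⟨κ, hκ, m, hm, e⟩ := D.ker0_support hU h1
    refine hn0 (gN_zero_sub_of_conj hn hm ?_)
    have : S.alphaE * (n * m⁻¹) * S.alphaE⁻¹ = κ := by
      rw [show S.alphaE * (n * m⁻¹) * S.alphaE⁻¹ = (S.alphaE * n) * m⁻¹ * S.alphaE⁻¹ by group, e]
      group
    rwa [this]

end Kernel

end WeightData

end Setting

namespace Setting.WeightData

variable {S : Setting} {𝔽 : Type} [Field 𝔽] {W : Type} [AddCommGroup W] [Module 𝔽 W]

section HarmonicSubspace

variable (D : WeightData S 𝔽 W)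

/-- Equivariant functions supported on `K₁ K₀`, with values on `K₀` in the line of `β_K v₀`,
and annihilated by the sums over `u` of translates by `α u⁻¹`. -/
def harm (U : Finset S.GG) : Submodule 𝔽 (S.GG → W) where
  carrier := {f | f ∈ D.equi ∧ (∀ x, (∀ κ ∈ gK1 S, ∀ k ∈ gK0 S, x ≠ κ * k) → f x = 0) ∧
    (∀ k ∈ gK0 S, f k ∈ Submodule.span 𝔽 {D.ρ S.betaPr D.v0}) ∧
    ∀ k ∈ gK0 S, ∑ u ∈ U, f (S.alphaE * u⁻¹ * k) = 0}
  add_mem' := by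
    rintro f g ⟨hf1, hf2, hf3, hf4⟩ ⟨hg1, hg2, hg3, hg4⟩
    refine ⟨D.equi.add_mem hf1 hg1, fun x hx => by simp [hf2 x hx, hg2 x hx],
      fun k hk => Submodule.add_mem _ (hf3 k hk) (hg3 k hk), fun k hk => ?_⟩
    simp only [Pi.add_apply, Finset.sum_add_distrib, hf4 k hk, hg4 k hk, add_zero]
  zero_mem' := ⟨D.equi.zero_mem, fun _ _ => rfl, fun _ _ => Submodule.zero_mem _,
    fun _ _ => by simp⟩
  smul_mem' := by
    rintro c f ⟨hf1, hf2, hf3, hf4⟩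
    refine ⟨D.equi.smul_mem c hf1, fun x hx => by simp [hf2 x hx],
      fun k hk => Submodule.smul_mem _ c (hf3 k hk), fun k hk => ?_⟩
    simp only [Pi.smul_apply, ← Finset.smul_sum, hf4 k hk, smul_zero]

variable {D} {U : Finset S.GG}

lemma rt_mem_harm {f : S.GG → W} (hf : f ∈ D.harm U) {k : S.GG} (hk : k ∈ gK0 S) :
    rt 𝔽 W k f ∈ D.harm U := by
  obtain ⟨h1, h2, h3, h4⟩ := hf
  refine ⟨rt_mem_equi h1 k, fun x hx => h2 _ fun κ hκ k' hk' e => ?_,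
    fun k' hk' => h3 _ ((gK0 S).mul_mem hk' hk), fun k' hk' => ?_⟩
  · exact hx κ hκ (k' * k⁻¹) ((gK0 S).mul_mem hk' ((gK0 S).inv_mem hk))
      (by rw [← mul_assoc, ← e, mul_inv_cancel_right])
  · simpa only [rt_apply, mul_assoc] using h4 _ ((gK0 S).mul_mem hk' hk)

lemma alpha_mul_mem_span {f : S.GG → W} (hf : f ∈ D.equi)
    (hf' : ∀ k ∈ gK0 S, f k ∈ Submodule.span 𝔽 {D.ρ S.betaPr D.v0}) {k : S.GG} (hk : k ∈ gK0 S) :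
    ∃ c : 𝔽, f (S.alphaE * k) = c • D.v0 := by
  obtain ⟨c, hc⟩ := Submodule.mem_span_singleton.1 (hf' _ ((gK0 S).mul_mem betaE_mem hk))
  refine ⟨c, ?_⟩
  rw [show S.alphaE * k = S.betaPr * (S.betaE * k) by rw [alphaE_eq, mul_assoc],
    hf _ betaPr_mem, ← hc, map_smul, D.beta_beta]

lemma harm_eq_zero (hU : S.IsReps (gN S 0) (gN S 1) U) {r : S.GG → W} (hr : r ∈ D.harm U)
    (h0 : ∀ n ∈ gN S 0, r (S.alphaE * n) = 0) : r = 0 := by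
  obtain ⟨h1, h2, h3, h4⟩ := hr
  have hbig : ∀ k ∈ gK0 S, S.mat k 2 0 ∉ S.pE 1 → r k = 0 := by
    intro k hk hk2
    obtain ⟨u, -, hu, n, hn, rfl⟩ := exists_big_cell_K0 hk hk2
    have e : u * S.betaE * n = u * S.betaPr * (S.alphaE * n) := by
      rw [betaE_eq]; group
    rw [e, h1 _ ((gK1 S).mul_mem (gJ_le_gK1 hu) betaPr_mem), h0 n hn, map_zero]
  have hall : ∀ k ∈ gK0 S, r k = 0 := by
    intro k hk
    by_cases hk2 : S.mat k 2 0 ∈ S.pE 1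
    · have hkJ := small_cell_K0 hk hk2
      have hs := h4 _ ((gK0 S).mul_mem betaE_mem hk)
      obtain ⟨u0, hu0, hu01⟩ := hU.exists (gN S 0).one_mem
      rw [inv_one, one_mul] at hu01
      rw [Finset.sum_eq_single u0 _ (fun h => absurd hu0 h)] at hs
      · obtain ⟨c, hc⟩ := Submodule.mem_span_singleton.1 (h3 k hk)
        have hi := alpha_conj_gN_one ((gN S 1).inv_mem hu01)
        have e : S.alphaE * u0⁻¹ * (S.betaE * k) =
            (S.alphaE * u0⁻¹ * S.alphaE⁻¹) * (S.betaPr * k) := by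
          rw [← alpha_mul_betaE]; group
        rw [e, h1 _ (gN_neg_one_le_gK1 hi), h1 _ betaPr_mem, ← hc, map_smul, D.beta_beta,
          map_smul, D.v0_inv _ (gN_neg_one_le_gI1 hi), smul_eq_zero] at hs
        rw [← hc, hs.resolve_right D.v0_ne, zero_smul]
      · intro u hu hne
        have e : S.alphaE * u⁻¹ * (S.betaE * k) =
            S.betaPr * (S.betaE * u⁻¹ * S.betaE * k) := by
          rw [alphaE_eq]; group
        have hu' := (gN S 0).inv_mem (hU.mem hu)
        have huK : S.betaE * u⁻¹ * S.betaE ∈ gK0 S :=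
          (gK0 S).mul_mem ((gK0 S).mul_mem betaE_mem (gN_zero_le_gK0 hu')) betaE_mem
        rw [e, h1 _ betaPr_mem, hbig _ ((gK0 S).mul_mem huK hk), map_zero]
        intro h20
        have h5 := small_cell_K0 ((gK0 S).mul_mem huK hk) h20
        have h6 := (mem_gJ.1 (((gJ S).mul_mem_cancel_right hkJ).1 h5)).2.2.1
        rw [beta_conj_apply] at h6
        have h7 : u⁻¹ ∈ gN S 1 := mem_gN.2 ⟨(mem_gN.1 hu').1, (mem_gN.1 hu').2.1, h6⟩
        refine hne (hU.eq hu hu0 ((gN S 1).mul_mem h7 hu01))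
    · exact hbig k hk hk2
  ext x
  by_cases hx : ∀ κ ∈ gK1 S, ∀ k ∈ gK0 S, x ≠ κ * k
  · exact h2 x hx
  · push Not at hx
    obtain ⟨κ, hκ, k, hk, rfl⟩ := hx
    rw [h1 κ hκ, hall k hk, map_zero]; rfl

end HarmonicSubspace

section KernelHarmonic

variable (D : WeightData S 𝔽 W) {U : Finset S.GG}

lemma rt_ker0_gN (hU : S.IsReps (gN S 0) (gN S 1) U) {n : S.GG} (hn : n ∈ gN S 0) :
    rt 𝔽 W n (D.ker0 U D.v0) = D.ker0 U D.v0 := by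
  rw [ker0_apply, map_sum, ← hU.sum_comp (fun u => n * u) (fun a ha => (gN S 0).mul_mem hn ha)
    (fun a _ b _ h => by simpa [mul_assoc] using h) (fun u => D.std (u * S.alphaE⁻¹) D.v0)]
  · exact Finset.sum_congr rfl fun u _ => by rw [rt_std, mul_assoc]
  · intro a _ b hb
    have h1 := alpha_conj_gN_one hb
    rw [show a * b * S.alphaE⁻¹ = a * S.alphaE⁻¹ * (S.alphaE * b * S.alphaE⁻¹) by group,
      D.std_mul _ (gN_neg_one_le_gK1 h1), D.v0_inv _ (gN_neg_one_le_gI1 h1)]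

lemma gH_conj_inj {h : S.GG} (hh : h ∈ gH S) {k : ℤ} {a b : S.GG}
    (hab : (h * a * h⁻¹)⁻¹ * (h * b * h⁻¹) ∈ gN S k) : a⁻¹ * b ∈ gN S k := by
  have := gH_conj_mem_gN ((gH S).inv_mem hh) hab
  simpa [mul_assoc] using this

lemma rt_ker0_gH (hU : S.IsReps (gN S 0) (gN S 1) U) {h : S.GG} (hh : h ∈ gH S) :
    rt 𝔽 W h (D.ker0 U D.v0) = D.χ h • D.ker0 U D.v0 := by
  rw [ker0_apply, map_sum, ← hU.sum_comp (fun u => h * u * h⁻¹)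
    (fun a ha => gH_conj_mem_gN hh ha) (fun a _ b _ hab => gH_conj_inj hh hab)
    (fun u => D.std (u * S.alphaE⁻¹) D.v0), Finset.smul_sum]
  · refine Finset.sum_congr rfl fun u _ => ?_
    have e : h * (u * S.alphaE⁻¹) = h * u * h⁻¹ * S.alphaE⁻¹ * h := by
      have := alpha_comm_gH hh
      have e2 : S.alphaE⁻¹ * h = h * S.alphaE⁻¹ := by
        rw [inv_mul_eq_iff_eq_mul, ← mul_assoc, this, mul_inv_cancel_right]
      rw [mul_assoc _ _ h, e2]; group
    rw [rt_std, e, D.std_mul _ (gH_le_gK1 hh), D.v0_eig h hh, map_smul]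
  · intro a _ b hb
    have h1 := alpha_conj_gN_one hb
    rw [show a * b * S.alphaE⁻¹ = a * S.alphaE⁻¹ * (S.alphaE * b * S.alphaE⁻¹) by group,
      D.std_mul _ (gN_neg_one_le_gK1 h1), D.v0_inv _ (gN_neg_one_le_gI1 h1)]

lemma exists_smul_of_gI {κ : S.GG} (hκ : κ ∈ gI S) : ∃ c : 𝔽, D.ρ κ D.v0 = c • D.v0 := by
  obtain ⟨h, hh, i, hi, rfl⟩ := exists_torus_gI hκ
  exact ⟨D.χ h, by rw [D.mul_apply (gH_le_gK1 hh) (gI1_le_gK1 hi), D.v0_inv i hi, D.v0_eig h hh]⟩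

lemma ker0_mem_span (hU : S.IsReps (gN S 0) (gN S 1) U) {k : S.GG} (hk : k ∈ gK0 S) :
    D.ker0 U D.v0 k ∈ Submodule.span 𝔽 {D.ρ S.betaPr D.v0} := by
  rw [ker0_apply, Finset.sum_apply]
  refine Submodule.sum_mem _ fun u hu => ?_
  rw [std_apply]
  split_ifs with hκ
  · have e : S.betaPr * (k * (u * S.alphaE⁻¹)) =
        S.alphaE * (S.betaE * k * u) * S.alphaE⁻¹ := by
      rw [← alpha_mul_betaE]; group
    have hI : S.betaPr * (k * (u * S.alphaE⁻¹)) ∈ gI S := by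
      have h1 := (gK1 S).mul_mem betaPr_mem hκ
      have h2 := mem_gK1.1 h1
      refine mem_gI.2 ⟨h2.1, h2.2.1, ?_, h2.2.2.2⟩
      have h3 := (gK0 S).mul_mem ((gK0 S).mul_mem betaE_mem hk) (gN_zero_le_gK0 (hU.mem hu))
      rw [e, alpha_conj_apply, unif_zpow_mul_mem]
      exact mem_gK0.1 h3 2 0
    obtain ⟨c, hc⟩ := D.exists_smul_of_gI hI
    rw [D.mul_apply betaPr_mem hκ] at hc
    have := congrArg (D.ρ S.betaPr) hc
    rw [D.beta_beta, map_smul] at this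
    rw [this]
    exact Submodule.smul_mem _ _ (Submodule.mem_span_singleton_self _)
  · exact Submodule.zero_mem _

/-- The sum appearing in the definition of `harm`, for the kernel function. -/
def phi (U : Finset S.GG) (k : S.GG) : W := ∑ u ∈ U, D.ker0 U D.v0 (S.alphaE * u⁻¹ * k)

lemma phi_mul_gN (hU : S.IsReps (gN S 0) (gN S 1) U) (k : S.GG) {n : S.GG} (hn : n ∈ gN S 0) :
    D.phi U (k * n) = D.phi U k := by
  refine Finset.sum_congr rfl fun u _ => ?_
  conv_rhs => rw [← D.rt_ker0_gN hU hn]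
  rw [rt_apply, mul_assoc _ k n]

lemma phi_mul_gH (hU : S.IsReps (gN S 0) (gN S 1) U) (k : S.GG) {h : S.GG} (hh : h ∈ gH S) :
    D.phi U (k * h) = D.χ h • D.phi U k := by
  rw [phi, phi, Finset.smul_sum]
  refine Finset.sum_congr rfl fun u _ => ?_
  have := congrFun (D.rt_ker0_gH hU hh) (S.alphaE * u⁻¹ * k)
  rw [← mul_assoc]
  exact this

lemma phi_aux (hU : S.IsReps (gN S 0) (gN S 1) U) {k : S.GG} (hk : k ∈ gK0 S) :
    ∀ a ∈ gN S 0, ∀ b ∈ gN S 1, D.ker0 U D.v0 (S.alphaE * (a * b)⁻¹ * k) =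
      D.ker0 U D.v0 (S.alphaE * a⁻¹ * k) := by
  intro a ha b hb
  have h1 := alpha_conj_gN_one ((gN S 1).inv_mem hb)
  have hk' := (gK0 S).mul_mem (gN_zero_le_gK0 ((gN S 0).inv_mem ha)) hk
  obtain ⟨c, hc⟩ := alpha_mul_mem_span (D.ker0_mem_equi U D.v0)
    (fun k hk => D.ker0_mem_span hU hk) hk'
  rw [show S.alphaE * (a * b)⁻¹ * k = S.alphaE * b⁻¹ * S.alphaE⁻¹ * (S.alphaE * (a⁻¹ * k)) by group,
    D.ker0_mem_equi _ _ _ (gN_neg_one_le_gK1 h1), mul_assoc _ a⁻¹ k, hc, map_smul,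
    D.v0_inv _ (gN_neg_one_le_gI1 h1)]

lemma phi_gN_mul (hU : S.IsReps (gN S 0) (gN S 1) U) {k n : S.GG} (hk : k ∈ gK0 S)
    (hn : n ∈ gN S 0) : D.phi U (n * k) = D.phi U k := by
  rw [phi, phi, ← hU.sum_comp (fun u => n⁻¹ * u)
    (fun a ha => (gN S 0).mul_mem ((gN S 0).inv_mem hn) ha)
    (fun a _ b _ h => by simpa [mul_assoc] using h)
    (fun u => D.ker0 U D.v0 (S.alphaE * u⁻¹ * k)) (D.phi_aux hU hk)]
  exact Finset.sum_congr rfl fun u _ => by rw [mul_inv_rev, inv_inv]; simp only [mul_assoc]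

lemma phi_gH_mul (hU : S.IsReps (gN S 0) (gN S 1) U) {k h : S.GG} (hk : k ∈ gK0 S)
    (hh : h ∈ gH S) : D.phi U (h * k) = D.χ h • D.phi U k := by
  have hh' := (gH S).inv_mem hh
  rw [phi, phi, ← hU.sum_comp (fun u => h⁻¹ * u * h⁻¹⁻¹)
    (fun a ha => gH_conj_mem_gN hh' ha) (fun a _ b _ hab => gH_conj_inj hh' hab)
    (fun u => D.ker0 U D.v0 (S.alphaE * u⁻¹ * k)) (D.phi_aux hU hk), Finset.smul_sum]
  refine Finset.sum_congr rfl fun u hu => ?_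
  have h1 := (gN S 0).inv_mem (by simpa using gH_conj_mem_gN hh' (hU.mem hu) : h⁻¹ * u * h ∈ gN S 0)
  obtain ⟨c, hc⟩ := alpha_mul_mem_span (D.ker0_mem_equi U D.v0)
    (fun k hk => D.ker0_mem_span hU hk) ((gK0 S).mul_mem (gN_zero_le_gK0 h1) hk)
  have e : S.alphaE * u⁻¹ * (h * k) = h * (S.alphaE * ((h⁻¹ * u * h)⁻¹ * k)) := by
    rw [← mul_assoc h, ← alpha_comm_gH hh]; group
  rw [inv_inv, mul_assoc _ _ k, e, D.ker0_mem_equi _ _ h (gH_le_gK1 hh), hc, map_smul,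
    D.v0_eig h hh, smul_comm]

lemma phi_gI' (hU : S.IsReps (gN S 0) (gN S 1) U) {i : S.GG} (hi : i ∈ gI' S) :
    D.phi U i = 0 := by
  have h1 : (U.card : 𝔽) = 0 := by
    have : S.p ∣ U.card := IsReps.dvd_card (k := 0) hU
    obtain ⟨m, hm⟩ := this
    rw [hm, Nat.cast_mul, D.char, zero_mul]
  have h2 : ∀ u ∈ U, D.ker0 U D.v0 (S.alphaE * u⁻¹ * i) = D.v0 := fun u hu => by
    rw [mul_assoc]
    exact D.ker0_alpha_gI' hU ((gI' S).mul_mem (gK1one_le_gI' (gN_zero_le_gK1one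
      ((gN S 0).inv_mem (hU.mem hu)))) hi)
  rw [phi, Finset.sum_congr rfl h2, Finset.sum_const, ← Nat.cast_smul_eq_nsmul 𝔽, h1, zero_smul]

lemma phi_beta (hU : S.IsReps (gN S 0) (gN S 1) U) : D.phi U S.betaE = 0 := by
  obtain ⟨h, hh, hne⟩ := D.reg
  refine D.eq_zero_of_smul hne ?_
  rw [← D.phi_gH_mul hU betaE_mem hh, ← D.phi_mul_gH hU _ (beta_conj_mem_gH hh)]
  congr 1
  rw [← mul_assoc, ← mul_assoc, betaE_mul_betaE, one_mul]

lemma phi_eq_zero (hU : S.IsReps (gN S 0) (gN S 1) U) {k : S.GG} (hk : k ∈ gK0 S) :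
    D.phi U k = 0 := by
  by_cases h : S.mat k 2 0 ∈ S.pE 1
  · obtain ⟨t, ht, i, hi, rfl⟩ := exists_torus_gJ (small_cell_K0 hk h)
    rw [D.phi_gH_mul hU (gJ_le_gK0 (gI'_le_gJ hi)) ht, D.phi_gI' hU hi, smul_zero]
  · obtain ⟨u, hu, huJ, n, hn, rfl⟩ := exists_big_cell_K0 hk h
    obtain ⟨t, ht, m, hm, rfl⟩ := exists_gH_mul_gN_zero hu huJ
    have hm' := (gK0 S).mul_mem (gN_zero_le_gK0 hm) betaE_mem
    rw [D.phi_mul_gN hU _ hn, mul_assoc, D.phi_gH_mul hU hm' ht, D.phi_gN_mul hU betaE_mem hm,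
      D.phi_beta hU, smul_zero]

lemma ker0_mem_harm (hU : S.IsReps (gN S 0) (gN S 1) U) : D.ker0 U D.v0 ∈ D.harm U := by
  refine ⟨D.ker0_mem_equi _ _, fun x hx => ?_, fun k hk => D.ker0_mem_span hU hk,
    fun k hk => D.phi_eq_zero hU hk⟩
  by_contra h
  obtain ⟨κ, hκ, n, hn, e⟩ := D.ker0_support hU h
  exact hx (κ * S.betaPr) ((gK1 S).mul_mem hκ betaPr_mem) (S.betaE * n)
    ((gK0 S).mul_mem betaE_mem (gN_zero_le_gK0 hn)) (by rw [e, alphaE_eq]; group)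

/-- The subrepresentation generated by `harm`. -/
def harmSpan (U : Finset S.GG) : Submodule 𝔽 (S.GG → W) := ⨆ g : S.GG, (D.harm U).map (rt 𝔽 W g)

lemma rt_mem_harmSpan (g : S.GG) {f : S.GG → W} (hf : f ∈ D.harmSpan U) :
    rt 𝔽 W g f ∈ D.harmSpan U := by
  have : D.harmSpan U ≤ (D.harmSpan U).comap (rt 𝔽 W g) := by
    refine iSup_le fun h => ?_
    rintro _ ⟨r, hr, rfl⟩
    rw [Submodule.mem_comap, rt_rt]
    exact Submodule.mem_iSup_of_mem (g * h) ⟨r, hr, rfl⟩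
  exact this hf

lemma hecke_mem_harmSpan {Ua : Finset S.GG} (hU : S.IsReps (gN S 0) (gN S 1) U) (w : W) :
    D.hecke Ua U w ∈ D.harmSpan U := by
  have h : ∀ (g : S.GG) (v : W), rt 𝔽 W g (D.ker0 U (D.j v)) ∈ D.harmSpan U := by
    intro g v
    obtain ⟨c, hc⟩ := D.exists_smul_v0 v
    rw [← hc, map_smul]
    exact Submodule.mem_iSup_of_mem g ⟨_, (D.harm U).smul_mem c (D.ker0_mem_harm hU), rfl⟩
  rw [hecke_apply]
  exact Submodule.add_mem _ (Submodule.sum_mem _ fun u _ => h _ _) (h _ _)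

lemma ker0_mem_harmSpan (hU : S.IsReps (gN S 0) (gN S 1) U) : D.ker0 U D.v0 ∈ D.harmSpan U :=
  Submodule.mem_iSup_of_mem 1 ⟨_, D.ker0_mem_harm hU, rt_one _⟩

lemma beta_v0_notMem_span {c : 𝔽} (h : D.ρ S.betaPr D.v0 = c • D.v0) : False := by
  obtain ⟨t, ht, hne⟩ := D.reg
  have h1 := D.beta_apply_torus (beta_conj_mem_gH ht) D.v0
  have e : S.betaE * (S.betaE * t * S.betaE) * S.betaE = t := by
    simp only [mul_assoc, betaE_mul_betaE, mul_one]
    rw [← mul_assoc, betaE_mul_betaE, one_mul]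
  rw [e, D.v0_eig _ (beta_conj_mem_gH ht), map_smul, h, map_smul, D.v0_eig t ht,
    smul_comm c (D.χ t)] at h1
  have h2 := D.eq_zero_of_smul hne h1.symm
  rw [← h] at h2
  exact D.v0_ne (D.apply_eq_zero betaPr_mem h2)

lemma harm_alpha_support {r : S.GG → W} (hr : r ∈ D.harm U) {y : S.GG} (hy : IsUpper y)
    (hy0 : S.mat y 2 2 ∈ S.pE 0) (h : r (S.alphaE * y) ≠ 0) : y ∈ gK0 S := by
  by_contra hyK
  refine h (hr.2.1 _ fun κ hκ k hk e => ?_)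
  by_cases h20 : S.mat k 2 0 ∈ S.pE 1
  · have h1 := (gK1 S).mul_mem hκ (gJ_le_gK1 (small_cell_K0 hk h20))
    rw [← e] at h1
    have hα : ∀ j, S.mat (S.alphaE * y) 2 j = S.ϖ * S.mat y 2 j := fun j => by
      simp [mat_mul_apply, alpha_apply, alphaM]
    refine gI_row_false h1 ?_ ?_
    · rw [hα]
      exact mul_mem_pE_of_le (k := 1) (by simpa using unif_zpow_mem (S := S) 1) hy0 (by omega)
    · rw [hα, hy.2.1, mul_zero]; exact zero_mem_pE _
  · obtain ⟨u, -, huJ, n, hn, rfl⟩ := exists_big_cell_K0 hk h20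
    have e1 : S.alphaE * (y * n⁻¹) * S.alphaE⁻¹ = κ * u * S.betaPr := by
      rw [show S.alphaE * (y * n⁻¹) * S.alphaE⁻¹ = (S.alphaE * y) * n⁻¹ * S.alphaE⁻¹ by group, e,
        betaE_eq]
      group
    have h2 := upper_mem_gJ_of_conj (hy.mul (isUpper_of_gN hn).inv)
      (e1 ▸ (gK1 S).mul_mem ((gK1 S).mul_mem hκ (gJ_le_gK1 huJ)) betaPr_mem)
    have h3 := (gK0 S).mul_mem (gJ_le_gK0 h2) (gN_zero_le_gK0 hn)
    rw [inv_mul_cancel_right] at h3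
    exact hyK h3

lemma std_notMem_harmSpan (hU : S.IsReps (gN S 0) (gN S 1) U) :
    D.std 1 (D.ρ S.betaPr D.v0) ∉ D.harmSpan U := by
  intro hmem
  obtain ⟨b, lev, hb, hbz, -, hlev⟩ := exists_upper_section (gK0 S) exists_upper_mul_K0
  have hle : D.harmSpan U ≤ ⨆ z, (D.harm U).map (rt 𝔽 W (b z)) := by
    refine iSup_le fun g => ?_
    rintro _ ⟨r, hr, rfl⟩
    have hk : (b (g : S.GG ⧸ gK0 S))⁻¹ * g ∈ gK0 S := QuotientGroup.eq.1 (hbz _)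
    refine Submodule.mem_iSup_of_mem (g : S.GG ⧸ gK0 S) ⟨_, rt_mem_harm hr hk, ?_⟩
    rw [rt_rt, mul_inv_cancel_left]
  have hw0 : D.ρ S.betaPr D.v0 ≠ 0 := fun h => D.v0_ne (D.apply_eq_zero betaPr_mem h)
  have hne : D.std 1 (D.ρ S.betaPr D.v0) ≠ 0 := by
    intro h
    have := congrFun h 1
    rw [std_apply, mul_one, if_pos (gK1 S).one_mem, D.one_apply] at this
    exact hw0 this
  have hvan : ∀ i i', i ≠ i' → lev i' ≤ lev i →
      ∀ f ∈ (D.harm U).map (rt 𝔽 W (b i')),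
      ∀ g ∈ {x | ∃ κ ∈ gK1 S, ∃ m ∈ gK0 S, IsUpper m ∧ x = κ * S.alphaE * m * (b i)⁻¹},
      f g = 0 := by
    rintro i i' hne hl _ ⟨r, hr, rfl⟩ _ ⟨κ, hκ, m, hm, hmu, rfl⟩
    have e : κ * S.alphaE * m * (b i)⁻¹ * b i' =
        κ * (S.alphaE * (m * ((b i)⁻¹ * b i'))) := by group
    rw [rt_apply, e, hr.1 κ hκ]
    by_contra h1
    have h2 := D.harm_alpha_support hr (hmu.mul ((hb i).inv.mul (hb i'))) (by
      rw [IsUpper.mul_apply_two hmu]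
      exact mul_mem_pE_of_le (mem_gK0.1 hm 2 2) (hlev i i' hl) (by omega))
      (fun h0 => h1 (by rw [h0, map_zero]))
    refine hne ?_
    rw [← hbz i, ← hbz i']
    exact QuotientGroup.eq.2 (((gK0 S).mul_mem_cancel_left hm).1 h2)
  obtain ⟨z, f, hf, hf0, hlow⟩ := exists_eq_on_of_mem_iSup _ lev _ hvan (hle hmem) hne
  obtain ⟨r, hr, rfl⟩ := hf
  have hex : ∃ n ∈ gN S 0, r (S.alphaE * n) ≠ 0 := by
    by_contra hall
    push Not at hall
    exact hf0 (by rw [harm_eq_zero hU hr hall, map_zero])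
  obtain ⟨n, hn, hrn⟩ := hex
  obtain ⟨c, hc⟩ := alpha_mul_mem_span hr.1 hr.2.2.1 (gN_zero_le_gK0 hn)
  have hval := hlow _ ⟨1, (gK1 S).one_mem, n, gN_zero_le_gK0 hn, isUpper_of_gN hn, rfl⟩
  rw [one_mul, rt_apply, inv_mul_cancel_right, std_apply, mul_one] at hval
  have hκ : S.alphaE * n * (b z)⁻¹ ∈ gK1 S := by
    by_contra h'
    rw [if_neg h'] at hval
    exact hrn hval.symm
  have hα : IsUpper S.alphaE := by
    simp [IsUpper, alpha_apply, alphaM]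
  have hκI := upper_mem_gI ((hα.mul (isUpper_of_gN hn)).mul (hb z).inv) hκ
  rw [if_pos hκ, hc] at hval
  obtain ⟨d, hd⟩ := D.exists_smul_of_gI ((gI S).inv_mem hκI)
  have h1 := D.inv_apply hκ (D.ρ S.betaPr D.v0)
  rw [hval, map_smul, hd, smul_smul] at h1
  exact D.beta_v0_notMem_span h1.symm

end KernelHarmonic

end Setting.WeightData

namespace Setting.WeightData

variable {S : Setting} {𝔽 : Type} [Field 𝔽] {W : Type} [AddCommGroup W] [Module 𝔽 W]
variable (D : WeightData S 𝔽 W)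

/-- The compact induction, described through the functions `D.std`. -/
def ind : Submodule 𝔽 (S.GG → W) := Submodule.span 𝔽 {f | ∃ g w, f = D.std g w}

lemma std_mem_ind (g : S.GG) (w : W) : D.std g w ∈ D.ind :=
  Submodule.subset_span ⟨g, w, rfl⟩

lemma mem_ind_of_finite_support (s : Finset S.GG) {f : S.GG → W} (hf : f ∈ D.equi)
    (hs : ∀ x, f x ≠ 0 → ∃ k ∈ gK1 S, ∃ t ∈ s, x = k * t) : f ∈ D.ind := by
  induction s using Finset.induction_on generalizing f with
  | empty =>
    have : f = 0 := by
      funext x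
      by_contra h
      obtain ⟨-, -, t, ht, -⟩ := hs x h
      exact absurd ht (Finset.notMem_empty t)
    rw [this]
    exact D.ind.zero_mem
  | insert t s _ ih =>
    have hval : ∀ k ∈ gK1 S, (f - D.std t⁻¹ (f t)) (k * t) = 0 := by
      intro k hk
      rw [Pi.sub_apply, std_apply, mul_inv_cancel_right, if_pos hk, hf k hk, sub_self]
    have hsub : f - D.std t⁻¹ (f t) ∈ D.ind := by
      refine ih (D.equi.sub_mem hf (D.std_mem_equi _ _)) fun x hx => ?_
      have hxt : x * t⁻¹ ∉ gK1 S := fun h => hx (by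
        have := hval _ h
        rwa [inv_mul_cancel_right] at this)
      rw [Pi.sub_apply, std_apply, if_neg hxt, sub_zero] at hx
      obtain ⟨k, hk, t', ht', rfl⟩ := hs x hx
      rcases Finset.mem_insert.1 ht' with rfl | h
      · exact absurd (by rwa [mul_inv_cancel_right]) hxt
      · exact ⟨k, hk, t', h, rfl⟩
    have := D.ind.add_mem hsub (D.std_mem_ind t⁻¹ (f t))
    rwa [sub_add_cancel] at this

lemma ker0_mem_ind (U : Finset S.GG) (v : W) : D.ker0 U v ∈ D.ind := by
  rw [ker0_apply]
  exact D.ind.sum_mem fun u _ => D.std_mem_ind _ _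

/-- An equivariant operator on the compact induction whose values on the functions `[1, w]`
are given by `D.hecke` has a proper invariant submodule strictly above its range. -/
theorem exists_intermediate {Ua U : Finset S.GG} (hUa : S.IsReps (gN S (-1)) (gN S 0) Ua)
    (hU : S.IsReps (gN S 0) (gN S 1) U) {I : Submodule 𝔽 (S.GG → W)} (hI : I = D.ind)
    (T : Module.End 𝔽 I)
    (hT : ∀ (g : S.GG) (x y : I), (y : S.GG → W) = rt 𝔽 W g x →
      (T y : S.GG → W) = rt 𝔽 W g (T x))
    (hT1 : ∀ (w : W) (x : I), (x : S.GG → W) = D.std 1 w →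
      (T x : S.GG → W) = D.hecke Ua U w) :
    ∃ M : Submodule 𝔽 I,
      (∀ (g : S.GG) (x y : I), (y : S.GG → W) = rt 𝔽 W g x → x ∈ M → y ∈ M) ∧
      LinearMap.range T ≤ M ∧ M ≠ LinearMap.range T ∧ M ≠ ⊤ := by
  subst hI
  have hTg : ∀ (g : S.GG) (w : W), (T ⟨D.std g w, D.std_mem_ind g w⟩ : S.GG → W) =
      rt 𝔽 W g (D.hecke Ua U w) := fun g w => by
    rw [← hT1 w ⟨D.std 1 w, D.std_mem_ind 1 w⟩ rfl]
    exact hT g _ _ (by rw [rt_std, mul_one])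
  have hrange : ∀ Q : Submodule 𝔽 (S.GG → W),
      (∀ g w, rt 𝔽 W g (D.hecke Ua U w) ∈ Q) → ∀ x, (T x : S.GG → W) ∈ Q := by
    rintro Q hQ ⟨f, hf⟩
    have hle : D.ind ≤ (Q.comap (D.ind.subtype ∘ₗ T)).map D.ind.subtype := by
      refine Submodule.span_le.2 ?_
      rintro _ ⟨g, w, rfl⟩
      refine ⟨⟨D.std g w, D.std_mem_ind g w⟩, ?_, rfl⟩
      change (T _ : S.GG → W) ∈ Q
      rw [hTg]
      exact hQ g w
    obtain ⟨x, hx, rfl⟩ := hle hf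
    exact hx
  refine ⟨(D.harmSpan U).comap D.ind.subtype, ?_, ?_, ?_, ?_⟩
  · intro g x y hy hx
    change (y : S.GG → W) ∈ D.harmSpan U
    rw [hy]
    exact rt_mem_harmSpan D g hx
  · rintro _ ⟨x, rfl⟩
    exact hrange _ (fun g w => rt_mem_harmSpan D g (hecke_mem_harmSpan D hU w)) x
  · intro h
    obtain ⟨b, lev, hb, hbz, hb1, hlev⟩ := exists_upper_section (gK1 S) exists_upper_mul_K1
    have hmem : (⟨D.ker0 U D.v0, D.ker0_mem_ind U _⟩ : D.ind) ∈ LinearMap.range T := by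
      rw [← h]
      exact D.ker0_mem_harmSpan hU
    obtain ⟨x, hx⟩ := hmem
    refine D.ker0_notMem hUa hU hb hbz hb1 hlev ?_
    have hx' : D.ker0 U D.v0 = T x := by rw [hx]
    rw [hx']
    refine hrange _ (fun g w => ?_) x
    have hk : (b (g : S.GG ⧸ gK1 S))⁻¹ * g ∈ gK1 S := QuotientGroup.eq.1 (hbz _)
    refine Submodule.mem_iSup_of_mem (g : S.GG ⧸ gK1 S)
      ⟨_, ⟨D.ρ ((b (g : S.GG ⧸ gK1 S))⁻¹ * g) w, rfl⟩, ?_⟩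
    have e : (⟨D.std g w, D.std_mem_ind g w⟩ : D.ind) =
        ⟨D.std (b (g : S.GG ⧸ gK1 S)) (D.ρ ((b (g : S.GG ⧸ gK1 S))⁻¹ * g) w),
          D.std_mem_ind _ _⟩ := Subtype.ext (by
        change D.std g w = D.std _ _
        rw [← D.std_mul _ hk, mul_inv_cancel_left])
    rw [← hTg, ← hTg, e]
  · intro h
    refine D.std_notMem_harmSpan hU ?_
    have : (⟨D.std 1 (D.ρ S.betaPr D.v0), D.std_mem_ind _ _⟩ : D.ind) ∈
        (D.harmSpan U).comap D.ind.subtype := by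
      rw [h]
      exact Submodule.mem_top
    exact this

lemma hecke_eq_sum {Ua U : Finset S.GG} (hUa : S.IsReps (gN S (-1)) (gN S 0) Ua)
    (hU : S.IsReps (gN S 0) (gN S 1) U) (w : W) :
    D.hecke Ua U w =
      ∑ u ∈ (Ua ×ˢ U).image fun z => z.1 * z.2, D.std (u * S.alphaE⁻¹) (D.j (D.ρ u⁻¹ w)) +
      ∑ u ∈ U, D.std (S.betaPr * u * S.alphaE⁻¹) (D.j (D.ρ S.betaPr w)) := by
  rw [Finset.sum_image (IsReps.mul gN_zero_le hUa hU gN_one_le).2, Finset.sum_product,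
    hecke_apply]
  simp only [ker0_apply, map_sum, rt_std]
  congr 1
  · refine Finset.sum_congr rfl fun u hu => Finset.sum_congr rfl fun n hn => ?_
    rw [D.rho_inv_mul_triv (hUa.mem hu) (hU.mem hn), mul_assoc u]
  · simp only [mul_assoc]

end Setting.WeightData

end U21

namespace U21

/-- Suppose `K = K₁`, `q = p`, and `σ` is a weight with `χ_σ ≠ χ_σ^s`.
Then `(ind_K^G σ)/(T)` is not irreducible. -/
theorem stmt2
    (S : Setting) (C : Chamber S)
    (hK1 : (C.K : Set S.GG) = S.K1set) (hqp : S.q = S.p)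
    (𝔽 : Type) [Field 𝔽] [IsAlgClosed 𝔽] [Algebra (ZMod S.p) 𝔽]
    [Algebra.IsAlgebraic (ZMod S.p) 𝔽]
    (W : Type) [AddCommGroup W] [Module 𝔽 W]
    (σ : Representation 𝔽 ↥C.K W) (hσ : IsWeight C 𝔽 W σ)
    (v0 : W) (hv0 : v0 ≠ 0) (hv0inv : ∀ g ∈ C.I1, sigma' C 𝔽 W σ g v0 = v0)
    (χ : S.GG → 𝔽) (hχ : IsChi C 𝔽 W σ v0 χ)
    (hreg : ∃ h ∈ C.H0, χ h ≠ χ (C.βK * h * C.βK))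
    (jσ : W →ₗ[𝔽] W) (hj : IsJ C 𝔽 W σ jσ)
    (T : Module.End 𝔽 ↥(IndSub C 𝔽 W σ)) (hT : IsHeckeT C 𝔽 W σ jσ T) :
    ¬ QuotientIrreducible 𝔽 (indRep C 𝔽 W σ) (LinearMap.range T) := by
  have hβ : S.betaE ∉ C.K := fun h => by
    have h1 : S.betaE ∈ S.K1set := hK1 ▸ h
    have h2 := h1.2.2.2.2.2.2.1
    rw [Setting.beta_apply] at h2
    exact Setting.one_notMem_pE (by simpa [Setting.betaM] using h2)
  rcases C.cases with hC | ⟨-, hKone, hIK, hI1, hI1', hβK, hnK, -, -⟩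
  · refine absurd (?_ : S.betaE ∈ (C.K : Set S.GG)) hβ
    rw [hC.1]
    exact fun i j => Setting.mem_O_iff.2 (Setting.mem_gK0.1 Setting.betaE_mem i j)
  have hK : C.K = Setting.gK1 S := SetLike.coe_injective (hK1.trans Setting.gK1_eq.symm)
  rw [← Setting.gK1one_eq] at hKone
  rw [← Setting.gI1_eq] at hI1
  rw [← Setting.gI'_eq] at hI1'
  have hH : C.H0 = Setting.gH S := by rw [Chamber.H0, hIK, ← Setting.gH_eq]
  have hs : ∀ (g : S.GG) (hg : g ∈ C.K), sigma' C 𝔽 W σ g = σ ⟨g, hg⟩ := fun g hg => dif_pos hg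
  let D : Setting.WeightData S 𝔽 W :=
    { ρ := sigma' C 𝔽 W σ
      one := by rw [hs 1 C.K.one_mem]; exact map_one σ
      mul := by
        intro a ha b hb
        rw [← hK] at ha hb
        rw [hs _ ha, hs _ hb, hs _ (C.K.mul_mem ha hb), ← map_mul]
        rfl
      triv := by
        intro a ha
        have haK : a ∈ C.K := hK ▸ Setting.gK1one_le_gK1 ha
        rw [hs a haK, hσ.2.2.2 a haK (hKone ▸ ha)]
        rfl
      irr := by
        intro P hP
        refine hσ.2.2.1 P fun k w hw => ?_
        rw [← hs k.1 k.2]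
        exact hP k (hK ▸ k.2) w hw
      v0 := v0
      v0_ne := hv0
      v0_inv := fun g hg => hv0inv g (hI1 ▸ hg)
      χ := χ
      v0_eig := fun h hh => hχ h (hH ▸ hh)
      reg := by
        obtain ⟨h, hh, hne⟩ := hreg
        have hh' : h ∈ Setting.gH S := hH.subset hh
        refine ⟨h, hh', ?_⟩
        rwa [hβK, Setting.betaPr_conj_gH hh'] at hne
      j := jσ
      j_inv := fun w hw => hj.1 w fun g hg => hw g (hI1.subset hg)
      j_aug := fun w g hg => sub_eq_zero.1 (by rw [← map_sub]; exact hj.2 w g (hI1' ▸ hg))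
      char := by
        have := congrArg (algebraMap (ZMod S.p) 𝔽) (ZMod.natCast_self S.p)
        rwa [map_natCast, map_zero] at this }
  have hstd : ∀ g v, stdFn C 𝔽 W σ g v = D.std g v := by
    intro g v
    funext x
    rw [Setting.WeightData.std_apply, stdFn]
    by_cases h : x * g ∈ C.K
    · rw [dif_pos h, if_pos (hK ▸ h), ← hs]
    · rw [dif_neg h, if_neg (hK ▸ h)]
  have hI : IndSub C 𝔽 W σ = D.ind := by
    refine le_antisymm ?_ (Submodule.span_le.2 ?_)
    · rintro f ⟨hf, s, hsupp⟩
      refine D.mem_ind_of_finite_support s ?_ ?_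
      · intro k hk g
        have hkC : k ∈ C.K := hK ▸ hk
        rw [hf k hkC g, ← hs]
      · rwa [← hK]
    · rintro _ ⟨g, w, rfl⟩
      refine ⟨fun k hk x => ?_, {g⁻¹}, fun x hx => ?_⟩
      · rw [← hs k hk]
        exact D.std_mem_equi g w k (hK ▸ hk) x
      · rw [Setting.WeightData.std_apply] at hx
        have : x * g ∈ Setting.gK1 S := by
          by_contra h
          exact hx (if_neg h)
        exact ⟨x * g, hK ▸ this, g⁻¹, Finset.mem_singleton_self _,
          (mul_inv_cancel_right x g).symm⟩
  obtain ⟨Ua, hUa⟩ := Setting.exists_isReps_gN_neg_one S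
  obtain ⟨U, hU⟩ := Setting.exists_isReps_gN_zero S
  obtain ⟨M, hinv, hle, hne, htop⟩ := D.exists_intermediate hUa hU hI T (by
    intro g x y hy
    have : y = indRep C 𝔽 W σ g x := Subtype.ext hy
    rw [this, hT.1]
    rfl) (by
    intro w x hx
    rw [← hstd] at hx
    have h2 := (Setting.IsReps.mul Setting.gN_zero_le hUa hU Setting.gN_one_le).1
    have := hT.2 w x hx _ _ (by rw [hnK]; exact h2) (by rw [hnK]; exact hU)
    rw [this, D.hecke_eq_sum hUa hU]
    simp only [hstd, hβK]
    rfl)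
  rintro ⟨-, hirr⟩
  rcases hirr M (fun g x hx => hinv g x _ rfl hx) hle with h | h
  · exact hne h
  · exact htop h

end U21
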